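/- arXiv:math/0108212 — 2 statements merged into one kernel-verified Lean document; each statement's English description precedes it below -/
import Mathlib

section
/- Let F ⊂ ℝⁿ be a compact convex set of volume 1 and let P be a non-constant polynomial on ℝⁿ of degree at most d. Let M(P) be the unique positive number such that Vol{x ∈ F : |P(x)| ≥ M(P)} = 1/e. Then for every λ > 1, Vol{x ∈ F : |P(x)| < (4λ)^{−d} M(P)} ≤ 1/λ. -/
open MeasureTheory

open Polynomial Polynomial.Chebyshev in
theorem eval_T_le_two_mul_pow (d : ℕ) {z : ℝ} (hz : 1 ≤ z) : (T ℝ d).eval z ≤ (2 * z) ^ d := by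
  obtain ⟨θ, hθ, rfl⟩ : ∃ θ : ℝ, 0 ≤ θ ∧ Real.cosh θ = z :=
    ⟨Real.arcosh z, Real.arcosh_nonneg hz, Real.cosh_arcosh hz⟩
  rw [T_real_cosh]
  have h1 : Real.cosh (((d : ℕ) : ℤ) * θ) ≤ Real.exp (d * θ) := by
    rw [Real.cosh_eq]
    have : Real.exp (-(((d : ℕ) : ℤ) * θ)) ≤ Real.exp (d * θ) := by
      apply Real.exp_le_exp.mpr
      have : 0 ≤ (d : ℝ) * θ := by positivity
      push_cast
      linarith
    push_cast at *
    linarith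
  refine h1.trans ?_
  rw [Real.exp_nat_mul]
  apply pow_le_pow_left₀ (Real.exp_pos _).le
  rw [Real.cosh_eq]
  have := Real.exp_pos (-θ)
  linarith

/-- A compact set of measure at least `ℓ` contains, for each `t ∈ [0, ℓ]`, a point with exactly
measure `t` of the set on its left. -/
theorem exists_mem_volume_inter_Iic_eq {E : Set ℝ} (hE : IsCompact E) {ℓ t : ℝ} (hℓ : 0 < ℓ)
    (hEℓ : ℓ ≤ volume.real E) (ht0 : 0 ≤ t) (htℓ : t ≤ ℓ) :
    ∃ y ∈ E, volume.real (E ∩ Set.Iic y) = t := by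
  have hfin : ∀ s, volume (E ∩ s) ≠ ⊤ := fun s =>
    ((measure_mono Set.inter_subset_left).trans_lt hE.measure_lt_top).ne
  have hne : E.Nonempty := by
    rw [Set.nonempty_iff_ne_empty]
    rintro rfl
    simp at hEℓ
    linarith
  have hlip : ∀ a b, a ≤ b →
      volume.real (E ∩ Set.Iic b) ≤ volume.real (E ∩ Set.Iic a) + (b - a) := by
    intro a b hab
    have : E ∩ Set.Iic b ⊆ (E ∩ Set.Iic a) ∪ Set.Ioc a b := by
      intro x hx
      by_cases h : x ≤ a
      · exact Or.inl ⟨hx.1, h⟩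
      · exact Or.inr ⟨not_le.mp h, hx.2⟩
    calc _ ≤ volume.real ((E ∩ Set.Iic a) ∪ Set.Ioc a b) :=
          measureReal_mono this (by
            apply (measure_union_lt_top ((hfin _).lt_top) (by simp)).ne)
      _ ≤ _ := (measureReal_union_le _ _).trans (by simp [hab])
  have hmono : ∀ a b, a ≤ b → volume.real (E ∩ Set.Iic a) ≤ volume.real (E ∩ Set.Iic b) :=
    fun a b hab => measureReal_mono (by gcongr) (hfin _)
  have hcont : Continuous fun y => volume.real (E ∩ Set.Iic y) := by
    have : LipschitzWith 1 fun y => volume.real (E ∩ Set.Iic y) := by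
      apply LipschitzWith.of_le_add
      intro a b
      rcases le_total a b with h | h
      · exact (hmono a b h).trans (by simp)
      · rw [Real.dist_eq, abs_of_nonneg (by linarith)]
        exact hlip b a h
    exact this.continuous
  rcases ht0.eq_or_lt with rfl | ht
  · refine ⟨sInf E, hE.sInf_mem hne, ?_⟩
    have : E ∩ Set.Iic (sInf E) ⊆ {sInf E} := fun x hx =>
      le_antisymm hx.2 (csInf_le hE.bddBelow hx.1)
    rw [measureReal_def, measure_mono_null this (by simp)]
    simp
  · have hlo : volume.real (E ∩ Set.Iic (sInf E)) = 0 := by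
      have : E ∩ Set.Iic (sInf E) ⊆ {sInf E} := fun x hx =>
        le_antisymm hx.2 (csInf_le hE.bddBelow hx.1)
      rw [measureReal_def, measure_mono_null this (by simp)]
      simp
    have hhi : volume.real (E ∩ Set.Iic (sSup E)) = volume.real E := by
      congr 1
      exact Set.inter_eq_left.mpr fun x hx => le_csSup hE.bddAbove hx
    obtain ⟨y, -, hy⟩ := intermediate_value_Icc
      (csInf_le_csSup hne hE.bddBelow hE.bddAbove) hcont.continuousOn
      (show t ∈ Set.Icc _ _ from ⟨hlo ▸ ht0, hhi ▸ htℓ.trans hEℓ⟩)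
    have hne' : (E ∩ Set.Iic y).Nonempty := by
      rw [Set.nonempty_iff_ne_empty]
      intro h
      simp only [h] at hy
      simp at hy
      linarith
    have hc : IsCompact (E ∩ Set.Iic y) := hE.inter_right isClosed_Iic
    have hm := hc.sSup_mem hne'
    refine ⟨sSup (E ∩ Set.Iic y), hm.1, ?_⟩
    rw [← hy]
    congr 1
    ext x
    constructor
    · rintro ⟨h1, h2⟩
      exact ⟨h1, Set.mem_Iic.mpr (le_trans (Set.mem_Iic.mp h2) hm.2)⟩
    · intro h
      exact ⟨h.1, le_csSup hc.bddAbove h⟩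

open Polynomial Polynomial.Chebyshev in
/-- One-dimensional Remez inequality at an endpoint. -/
theorem abs_eval_le_of_abs_le_on {p : ℝ[X]} {d : ℕ} (hp : p.natDegree ≤ d) {E : Set ℝ}
    (hE : IsCompact E) {x L ℓ ε : ℝ} (hEsub : E ⊆ Set.Icc (x - L) x) (hℓ : 0 < ℓ)
    (hEℓ : ℓ ≤ volume.real E) (hpE : ∀ y ∈ E, |p.eval y| ≤ ε) :
    |p.eval x| ≤ ε * (4 * L / ℓ) ^ d := by
  have hLℓ : ℓ ≤ L := by
    have h1 : volume.real E ≤ volume.real (Set.Icc (x - L) x) :=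
      measureReal_mono hEsub (by simp)
    rcases le_total 0 L with hL | hL
    · simp [hL] at h1
      linarith
    · have : volume.real (Set.Icc (x - L) x) = 0 := by
        simp [measureReal_def, ENNReal.ofReal_eq_zero.mpr hL]
      linarith
  have hfin : ∀ s, volume (E ∩ s) ≠ ⊤ := fun s =>
    ((measure_mono Set.inter_subset_left).trans_lt hE.measure_lt_top).ne
  have hn : ∀ k, ∃ y ∈ E, volume.real (E ∩ Set.Iic y) = ℓ * (1 + node d k) / 2 := by
    intro k
    have := node_mem_Icc (n := d) (i := k)
    exact exists_mem_volume_inter_Iic_eq hE hℓ hEℓ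
      (by have := this.1; apply div_nonneg _ (by norm_num); apply mul_nonneg hℓ.le; linarith)
      (by nlinarith [this.2])
  choose y hyE hy using hn
  have hdist : ∀ j k, ℓ / 2 * |node d j - node d k| ≤ |y j - y k| := by
    have key : ∀ j k, y j ≤ y k → ℓ / 2 * |node d j - node d k| ≤ |y j - y k| := by
      intro j k hjk
      have h1 : volume.real (E ∩ Set.Iic (y j)) ≤ volume.real (E ∩ Set.Iic (y k)) :=
        measureReal_mono (by gcongr) (hfin _)
      have h2 : volume.real (E ∩ Set.Iic (y k)) ≤
          volume.real (E ∩ Set.Iic (y j)) + (y k - y j) := by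
        have : E ∩ Set.Iic (y k) ⊆ (E ∩ Set.Iic (y j)) ∪ Set.Ioc (y j) (y k) := by
          intro x hx
          by_cases h : x ≤ y j
          · exact Or.inl ⟨hx.1, h⟩
          · exact Or.inr ⟨not_le.mp h, hx.2⟩
        calc _ ≤ volume.real ((E ∩ Set.Iic (y j)) ∪ Set.Ioc (y j) (y k)) :=
              measureReal_mono this (by
                apply (measure_union_lt_top ((hfin _).lt_top) (by simp)).ne)
          _ ≤ _ := (measureReal_union_le _ _).trans (by simp [hjk])
      rw [hy, hy] at h1 h2
      rw [abs_of_nonpos (by nlinarith), abs_of_nonpos (by linarith)]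
      linarith
    intro j k
    rcases le_total (y j) (y k) with h | h
    · exact key j k h
    · rw [abs_sub_comm, abs_sub_comm (y j)]
      exact key k j h
  set z : ℝ := 2 * L / ℓ - 1 with hz
  have hz1 : 1 ≤ z := by
    have : 1 ≤ L / ℓ := by rwa [le_div_iff₀ hℓ, one_mul]
    rw [hz, mul_div_assoc]; linarith
  have hxy : ∀ k, |x - y k| ≤ ℓ / 2 * (z - node d k) := by
    intro k
    have h1 := (hEsub (hyE k)).1
    have h2 := (hEsub (hyE k)).2
    have h3 : volume.real (E ∩ Set.Iic (y k)) ≤ y k - (x - L) := by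
      calc _ ≤ volume.real (Set.Icc (x - L) (y k)) :=
            measureReal_mono (fun a ha => ⟨(hEsub ha.1).1, ha.2⟩) (by simp)
        _ = _ := by simp; linarith
    rw [hy] at h3
    rw [abs_of_nonneg (by linarith), hz]
    have : ℓ / 2 * (2 * L / ℓ - 1 - node d k) = L - ℓ * (1 + node d k) / 2 := by
      field_simp; ring
    linarith
  have hinj : Set.InjOn y (Finset.range (d + 1)) := by
    intro j hj k hk hjk
    by_contra hne
    have h1 := hdist j k
    rw [hjk, sub_self, abs_zero] at h1
    have h2 : node d j ≠ node d k := fun h => hne ((strictAntiOn_node d).injOn hj hk h)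
    have : 0 < |node d j - node d k| := abs_pos.mpr (sub_ne_zero.mpr h2)
    nlinarith
  have hdeg : p.degree < (Finset.range (d + 1)).card := by
    rw [Finset.card_range]
    refine (degree_le_natDegree).trans_lt ?_
    exact_mod_cast Nat.lt_succ_of_le hp
  have hTdeg : (T ℝ d).degree < (Finset.range (d + 1)).card := by
    rw [degree_T, Finset.card_range]
    exact_mod_cast Nat.lt_succ_self d
  have hform : ∀ (q : ℝ[X]) (v : ℕ → ℝ), Set.InjOn v (Finset.range (d + 1)) →
      q.degree < (Finset.range (d + 1)).card → ∀ w : ℝ,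
      q.eval w = ∑ k ∈ Finset.range (d + 1), q.eval (v k) *
        ∏ j ∈ (Finset.range (d + 1)).erase k, ((w - v j) / (v k - v j)) := by
    intro q v hv hq w
    conv_lhs => rw [Lagrange.eq_interpolate hv hq]
    rw [Lagrange.interpolate_apply, eval_finsetSum]
    apply Finset.sum_congr rfl
    intro k hk
    rw [eval_mul, eval_C, Lagrange.basis, eval_prod]
    congr 1
    apply Finset.prod_congr rfl
    intro j hj
    simp [Lagrange.basisDivisor, div_eq_inv_mul]
  have hε : 0 ≤ ε := (abs_nonneg _).trans (hpE _ (hyE 0))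
  calc |p.eval x| ≤ ∑ k ∈ Finset.range (d + 1), |p.eval (y k)| *
        ∏ j ∈ (Finset.range (d + 1)).erase k, (|x - y j| / |y k - y j|) := by
        rw [hform p y hinj hdeg x]
        refine (Finset.abs_sum_le_sum_abs _ _).trans (le_of_eq ?_)
        simp [abs_mul, Finset.abs_prod, abs_div]
    _ ≤ ∑ k ∈ Finset.range (d + 1), ε * ((T ℝ d).eval (node d k) *
        ∏ j ∈ (Finset.range (d + 1)).erase k, ((z - node d j) / (node d k - node d j))) := by
        apply Finset.sum_le_sum
        intro k hk
        have hk' : k ≤ d := Nat.lt_succ_iff.mp (Finset.mem_range.mp hk)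
        have hpos := zero_lt_prod_node_sub_node hk'
        rw [eval_T_real_node (Finset.mem_Iic.mpr hk')]
        have hprod : (-1 : ℝ) ^ k * ∏ j ∈ (Finset.range (d + 1)).erase k,
            ((z - node d j) / (node d k - node d j)) =
            ∏ j ∈ (Finset.range (d + 1)).erase k, ((z - node d j) / |node d k - node d j|) := by
          rw [Finset.prod_div_distrib, Finset.prod_div_distrib, ← Finset.abs_prod]
          have hsq : ((-1 : ℝ) ^ k) * (-1) ^ k = 1 := by simp [← mul_pow]
          have habs : |∏ j ∈ (Finset.range (d + 1)).erase k, (node d k - node d j)| =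
              (-1) ^ k * ∏ j ∈ (Finset.range (d + 1)).erase k, (node d k - node d j) := by
            rw [← abs_of_pos hpos, abs_mul, abs_neg_one_pow, one_mul]
          rw [habs]
          have hne : ∏ j ∈ (Finset.range (d + 1)).erase k, (node d k - node d j) ≠ 0 :=
            fun h => by simp [h] at hpos
          field_simp
          rw [pow_two] ; simp [hsq]
        rw [hprod]
        have hfac : ∀ j ∈ (Finset.range (d + 1)).erase k,
            |x - y j| / |y k - y j| ≤ (z - node d j) / |node d k - node d j| := by
          intro j hj
          have hjk := Finset.mem_erase.mp hj
          have h2 : node d k ≠ node d j := fun h => hjk.1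
            ((strictAntiOn_node d).injOn (by exact_mod_cast hk) (by exact_mod_cast hjk.2) h).symm
          have h3 : 0 < |node d k - node d j| := abs_pos.mpr (sub_ne_zero.mpr h2)
          calc |x - y j| / |y k - y j| ≤
              (ℓ / 2 * (z - node d j)) / (ℓ / 2 * |node d k - node d j|) := by
                apply div_le_div₀ ((abs_nonneg _).trans (hxy j)) (hxy j) (by positivity) (hdist k j)
            _ = _ := by rw [mul_div_mul_left _ _ (by positivity)]
        exact mul_le_mul (hpE _ (hyE k)) (Finset.prod_le_prod (fun j _ => by positivity) hfac)
          (Finset.prod_nonneg fun j _ => by positivity) hε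
    _ = ε * (T ℝ d).eval z := by
        rw [← Finset.mul_sum, ← hform (T ℝ d) (node d) (strictAntiOn_node d).injOn hTdeg z]
    _ ≤ ε * (4 * L / ℓ) ^ d := by
        refine mul_le_mul_of_nonneg_left ((eval_T_le_two_mul_pow d hz1).trans ?_) hε
        apply pow_le_pow_left₀ (by linarith)
        rw [hz]
        have : 4 * L / ℓ = 2 * (2 * L / ℓ) := by ring
        linarith
open Polynomial in
theorem volume_sublevel_inter_Icc_le {p : ℝ[X]} {d : ℕ} (hd : d ≠ 0) (hp : p.natDegree ≤ d)
    {ε l : ℝ} (hε : 0 < ε) (hl : 0 < l) {x y : ℝ} (hyx : y ≤ x)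
    (hx : (4 * l) ^ d * ε ≤ |p.eval x|) :
    ENNReal.ofReal l * volume ({s | |p.eval s| < ε} ∩ Set.Icc y x) ≤ ENNReal.ofReal (x - y) := by
  set E : Set ℝ := {s | |p.eval s| ≤ ε} ∩ Set.Icc y x with hEdef
  have hE : IsCompact E := by
    apply isCompact_Icc.inter_left
    exact isClosed_le (by fun_prop) continuous_const
  have hsub : volume ({s | |p.eval s| < ε} ∩ Set.Icc y x) ≤ volume E := by
    apply measure_mono
    exact Set.inter_subset_inter_left _ fun s (hs : |p.eval s| < ε) => (show |p.eval s| ≤ ε from hs.le)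
  suffices h : l * volume.real E ≤ x - y by
    calc _ ≤ ENNReal.ofReal l * volume E := by gcongr
      _ = ENNReal.ofReal (l * volume.real E) := by
        rw [ENNReal.ofReal_mul hl.le, measureReal_def, ENNReal.ofReal_toReal hE.measure_lt_top.ne]
      _ ≤ _ := ENNReal.ofReal_le_ofReal h
  by_contra! h
  have hm : 0 < volume.real E := by
    by_contra! h0
    nlinarith
  have key := abs_eval_le_of_abs_le_on hp hE (x := x) (L := x - y)
    (by rw [sub_sub_cancel]; exact Set.inter_subset_right) hm le_rfl (fun s hs => hs.1)
  have h4 : 4 * (x - y) / volume.real E < 4 * l := by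
    rw [div_lt_iff₀ hm]
    linarith
  have h5 : (4 * (x - y) / volume.real E) ^ d < (4 * l) ^ d :=
    pow_lt_pow_left₀ h4 (div_nonneg (by linarith) hm.le) hd
  nlinarith

open Polynomial in
theorem volume_sublevel_inter_Icc_le' {p : ℝ[X]} {d : ℕ} (hd : d ≠ 0) (hp : p.natDegree ≤ d)
    {ε l : ℝ} (hε : 0 < ε) (hl : 0 < l) {x y : ℝ} (hxy : x ≤ y)
    (hx : (4 * l) ^ d * ε ≤ |p.eval x|) :
    ENNReal.ofReal l * volume ({s | |p.eval s| < ε} ∩ Set.Icc x y) ≤ ENNReal.ofReal (y - x) := by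
  have h := volume_sublevel_inter_Icc_le (p := p.comp (-X)) hd
    (by simpa [natDegree_comp] using hp) hε hl (neg_le_neg hxy) (by simpa using hx)
  have e : -({s | |p.eval s| < ε} ∩ Set.Icc x y) =
      {s | |(p.comp (-X)).eval s| < ε} ∩ Set.Icc (-y) (-x) := by
    ext s
    simp [and_comm]
  rw [← e, Measure.measure_neg] at h
  convert h using 2
  ring

/-- A measure dominated by Lebesgue measure on all intervals starting at `u` gives a smaller
integral to functions decreasing on the right of `u`. -/
theorem setLIntegral_Ioi_le_of_antitoneOn {μ : Measure ℝ} {u : ℝ}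
    (hμ : ∀ y, u < y → μ (Set.Ioc u y) ≤ ENNReal.ofReal (y - u)) {g : ℝ → ℝ} (hg0 : ∀ x, 0 ≤ g x)
    (hgm : Measurable g) (hg : AntitoneOn g (Set.Ioi u)) :
    ∫⁻ x in Set.Ioi u, ENNReal.ofReal (g x) ∂μ ≤ ∫⁻ x in Set.Ioi u, ENNReal.ofReal (g x) := by
  rw [lintegral_eq_lintegral_meas_lt _ (Filter.Eventually.of_forall hg0) hgm.aemeasurable,
    lintegral_eq_lintegral_meas_lt _ (Filter.Eventually.of_forall hg0) hgm.aemeasurable]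
  refine lintegral_mono fun t => ?_
  have hms : MeasurableSet {a | t < g a} := measurableSet_lt measurable_const hgm
  rw [Measure.restrict_apply hms, Measure.restrict_apply hms]
  set S := {a | t < g a} ∩ Set.Ioi u with hS
  have hlow : ∀ x ∈ S, Set.Ioc u x ⊆ S := fun x hx y hy =>
    ⟨lt_of_lt_of_le hx.1 (hg hy.1 hx.2 hy.2), hy.1⟩
  rcases S.eq_empty_or_nonempty with he | hne
  · rw [he]; simp
  by_cases hb : BddAbove S
  · have hu : u < sSup S := lt_of_lt_of_le hne.some_mem.2 (le_csSup hb hne.some_mem)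
    calc μ S ≤ μ (Set.Ioc u (sSup S)) := measure_mono fun x hx => ⟨hx.2, le_csSup hb hx⟩
      _ ≤ ENNReal.ofReal (sSup S - u) := hμ _ hu
      _ = volume (Set.Ioo u (sSup S)) := by simp
      _ ≤ volume S := by
        apply measure_mono
        intro x hx
        obtain ⟨y, hy, hxy⟩ := exists_lt_of_lt_csSup hne hx.2
        exact hlow y hy ⟨hx.1, hxy.le⟩
  · have : volume S = ⊤ := by
      apply top_unique
      calc (⊤ : ENNReal) = volume (Set.Ioi u) := by simp
        _ ≤ volume S := by
          apply measure_mono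
          intro x hx
          obtain ⟨y, hy, hxy⟩ := not_bddAbove_iff.mp hb x
          exact hlow y hy ⟨hx, hxy.le⟩
    rw [this]
    exact le_top

theorem setLIntegral_Iio_le_of_monotoneOn {μ : Measure ℝ} {u : ℝ}
    (hμ : ∀ y, y < u → μ (Set.Ico y u) ≤ ENNReal.ofReal (u - y)) {g : ℝ → ℝ} (hg0 : ∀ x, 0 ≤ g x)
    (hgm : Measurable g) (hg : MonotoneOn g (Set.Iio u)) :
    ∫⁻ x in Set.Iio u, ENNReal.ofReal (g x) ∂μ ≤ ∫⁻ x in Set.Iio u, ENNReal.ofReal (g x) := by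
  have key : ∀ m : Measure ℝ, ∫⁻ x in Set.Ioi (-u), ENNReal.ofReal (g (-x)) ∂(m.map Neg.neg) =
      ∫⁻ x in Set.Iio u, ENNReal.ofReal (g x) ∂m := by
    intro m
    rw [setLIntegral_map measurableSet_Ioi (by fun_prop) measurable_neg]
    simp
  have h := setLIntegral_Ioi_le_of_antitoneOn (μ := μ.map Neg.neg) (u := -u)
    (g := fun x => g (-x)) (fun y hy => by
      rw [Measure.map_apply measurable_neg measurableSet_Ioc]
      have := hμ (-y) (by linarith)
      convert this using 2
      · simp
      · ring) (fun x => hg0 _) (by fun_prop)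
    (fun x hx y hy hxy => hg (by simp at *; linarith) (by simp at *; linarith) (neg_le_neg hxy))
  rw [key, ← key volume, Measure.map_neg_eq_self (volume : Measure ℝ)] at *
  exact h

/-- Among the probability densities that are log-concave up to `c`, the left tails are at most
those of the exponential density with the same value at `c`. -/
theorem setIntegral_Iic_le_exp {f : ℝ → ℝ}
    (hlc : ∀ x y t : ℝ, 0 < t → t < 1 → f x ^ (1 - t) * f y ^ t ≤ f ((1 - t) * x + t * y))
    {c : ℝ} (hfi : IntegrableOn f (Set.Iic c)) (hfc : 0 < f c)
    (hN : 0 < ∫ x in Set.Iic c, f x) {u : ℝ} (huc : u ≤ c) :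
    ∫ x in Set.Iic u, f x ≤
      (∫ x in Set.Iic c, f x) * Real.exp (-(f c / (∫ x in Set.Iic c, f x) * (c - u))) := by
  set N := ∫ x in Set.Iic c, f x with hNdef
  set κ := f c / N with hκ
  have hκ0 : 0 < κ := div_pos hfc hN
  set g : ℝ → ℝ := fun x => f c * Real.exp (-(κ * c)) * Real.exp (κ * x) with hg
  have hg0 : ∀ x, 0 < g x := fun x => by positivity
  have hgc : g c = f c := by
    rw [hg]; simp only [mul_assoc, ← Real.exp_add]; simp
  have hgi : ∀ s, IntegrableOn g (Set.Iic s) := fun s =>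
    (integrableOn_exp_mul_Iic hκ0 s).const_mul _
  have hgs : ∀ s, ∫ x in Set.Iic s, g x = N * Real.exp (-(κ * (c - s))) := by
    intro s
    rw [hg, integral_const_mul, integral_exp_mul_Iic hκ0]
    have : N * κ = f c := by rw [hκ]; field_simp
    rw [show -(κ * (c - s)) = -(κ * c) + κ * s by ring, Real.exp_add, ← this]
    field_simp
  have hgl : ∀ x y t : ℝ, g x ^ (1 - t) * g y ^ t = g ((1 - t) * x + t * y) := by
    intro x y t
    have e : ∀ x, g x = Real.exp (Real.log (f c) + (-(κ * c)) + κ * x) := by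
      intro x
      rw [Real.exp_add, Real.exp_add, Real.exp_log hfc]
    rw [e, e, e, ← Real.exp_mul, ← Real.exp_mul, ← Real.exp_add]
    congr 1; ring
  rw [← hgs u]
  rcases huc.eq_or_lt with rfl | huc'
  · rw [hgs]; simp [hNdef]
  rcases le_or_gt (g u) (f u) with h | h
  · have hle : ∫ x in Set.Ioc u c, g x ≤ ∫ x in Set.Ioc u c, f x := by
      apply setIntegral_mono_on ((hgi c).mono_set Set.Ioc_subset_Iic_self)
        (hfi.mono_set Set.Ioc_subset_Iic_self) measurableSet_Ioc
      intro x hx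
      rcases hx.2.eq_or_lt with rfl | hxc
      · exact hgc.le
      have hcu : 0 < c - u := by linarith
      set t := (x - u) / (c - u) with ht
      have hx' : x = (1 - t) * u + t * c := by rw [ht]; field_simp; ring
      have ht0 : 0 < t := div_pos (by linarith [hx.1]) hcu
      have ht1 : t < 1 := by rw [ht, div_lt_one hcu]; linarith
      rw [hx', ← hgl, hgc]
      refine le_trans ?_ (hlc u c t ht0 ht1)
      gcongr
    have h1 : ∀ φ : ℝ → ℝ, IntegrableOn φ (Set.Iic c) →
        ∫ x in Set.Iic c, φ x = (∫ x in Set.Iic u, φ x) + ∫ x in Set.Ioc u c, φ x := by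
      intro φ hφ
      rw [← Set.Iic_union_Ioc_eq_Iic huc, setIntegral_union (by
        rw [Set.disjoint_left]; intro x hx hx'; exact absurd hx'.1 (not_lt.mpr hx))
        measurableSet_Ioc (hφ.mono_set (Set.Iic_subset_Iic.mpr huc))
        (hφ.mono_set Set.Ioc_subset_Iic_self)]
    have h2 := h1 f hfi
    have h3 := h1 g (hgi c)
    have h4 := hgs c
    simp at h4
    linarith
  · apply setIntegral_mono_on (hfi.mono_set (Set.Iic_subset_Iic.mpr huc)) (hgi u) measurableSet_Iic
    intro x hx
    rcases (Set.mem_Iic.mp hx).eq_or_lt with rfl | hxu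
    · exact h.le
    by_contra! hlt
    have hcx : 0 < c - x := by linarith
    set t := (u - x) / (c - x) with ht
    have hu' : u = (1 - t) * x + t * c := by rw [ht]; field_simp; ring
    have ht0 : 0 < t := div_pos (by linarith) hcx
    have ht1 : t < 1 := by rw [ht, div_lt_one hcx]; linarith
    have h5 := hlc x c t ht0 ht1
    have h6 := hgl x c t
    rw [← hu'] at h5 h6
    have : g x ^ (1 - t) * g c ^ t ≤ f x ^ (1 - t) * f c ^ t := by
      rw [hgc]
      gcongr
    linarith
theorem volume_inter_add_volume_inter_Icc_le {A B : Set ℝ} {l ρ : ℝ} (hA : IsClosed A)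
    (hρ : 0 < ρ) (hsep : ∀ a ∈ A, ∀ b ∈ B, ρ ≤ |a - b|)
    (hL : ∀ x ∈ A, ∀ y ≤ x,
      ENNReal.ofReal l * volume (B ∩ Set.Icc y x) ≤ ENNReal.ofReal (x - y))
    {u : ℝ} (hu : u ∈ A) {y : ℝ} (hyu : y ≤ u) :
    ENNReal.ofReal l * volume (B ∩ Set.Icc y u) + volume (A ∩ Set.Icc y u) ≤
      ENNReal.ofReal (u - y) := by
  have main : ∀ k : ℕ, ∀ y ≤ u, u - y ≤ k * (ρ / 2) →
      ENNReal.ofReal l * volume (B ∩ Set.Icc y u) + volume (A ∩ Set.Icc y u) ≤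
      ENNReal.ofReal (u - y) := by
    intro k
    induction k with
    | zero =>
      intro y hy hk
      have : y = u := by simp at hk; linarith
      subst this
      have h0 : ∀ S : Set ℝ, volume (S ∩ Set.Icc y y) = 0 := fun S =>
        measure_mono_null Set.inter_subset_right (by simp)
      rw [h0, h0]
      simp
    | succ k ih =>
      intro y hy hk
      have hne : (A ∩ Set.Icc y u).Nonempty := ⟨u, hu, hy, le_rfl⟩
      have hc : IsCompact (A ∩ Set.Icc y u) := isCompact_Icc.inter_left hA
      set q := sInf (A ∩ Set.Icc y u) with hq
      obtain ⟨hqA, hyq, hqu⟩ : q ∈ A ∩ Set.Icc y u := hc.sInf_mem hne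
      set q' := min (q + ρ / 2) u with hq'
      have hqq' : q ≤ q' := le_min (by linarith) hqu
      have hq'u : q' ≤ u := min_le_right _ _
      have hB : volume (B ∩ Set.Icc y u) ≤
          volume (B ∩ Set.Icc y q) + volume (B ∩ Set.Icc q' u) := by
        refine (measure_mono ?_).trans (measure_union_le _ _)
        rintro x ⟨hxB, hx1, hx2⟩
        by_cases h1 : x ≤ q
        · exact Or.inl ⟨hxB, hx1, h1⟩
        · by_cases h2 : q' ≤ x
          · exact Or.inr ⟨hxB, h2, hx2⟩
          · exfalso
            have h3 := hsep q hqA x hxB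
            push Not at h1 h2
            have h4 : x < q + ρ / 2 := lt_of_lt_of_le h2 (min_le_left _ _)
            rw [abs_of_neg (by linarith)] at h3
            linarith
      have hA' : volume (A ∩ Set.Icc y u) ≤
          ENNReal.ofReal (q' - q) + volume (A ∩ Set.Icc q' u) := by
        rw [← Real.volume_Icc]
        refine (measure_mono ?_).trans (measure_union_le _ _)
        intro x hx
        have h1 : q ≤ x := csInf_le hc.bddBelow hx
        by_cases h2 : q' ≤ x
        · exact Or.inr ⟨hx.1, h2, hx.2.2⟩
        · exact Or.inl ⟨h1, (not_le.mp h2).le⟩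
      have hI := ih q' hq'u (by
        rcases min_choice (q + ρ / 2) u with h | h
        · rw [hq', h]; push_cast at hk; linarith
        · rw [hq', h, sub_self]; positivity)
      calc _ ≤ ENNReal.ofReal l * (volume (B ∩ Set.Icc y q) + volume (B ∩ Set.Icc q' u)) +
            (ENNReal.ofReal (q' - q) + volume (A ∩ Set.Icc q' u)) := by gcongr
        _ = ENNReal.ofReal l * volume (B ∩ Set.Icc y q) + ENNReal.ofReal (q' - q) +
            (ENNReal.ofReal l * volume (B ∩ Set.Icc q' u) + volume (A ∩ Set.Icc q' u)) := by ring
        _ ≤ ENNReal.ofReal (q - y) + ENNReal.ofReal (q' - q) + ENNReal.ofReal (u - q') := by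
          gcongr
          exact hL q hqA y hyq
        _ = _ := by
          rw [← ENNReal.ofReal_add (by linarith) (by linarith),
            ← ENNReal.ofReal_add (by linarith) (by linarith)]
          congr 1; ring
  obtain ⟨k, hk⟩ := exists_nat_ge ((u - y) / (ρ / 2))
  exact main k y hyu (by rwa [div_le_iff₀ (by positivity)] at hk)

theorem mul_le_sub_add_of_le_exp {N Nu a τ : ℝ} (hN : 0 < N) (hτ : 0 ≤ τ)
    (hNu : Nu ≤ N * Real.exp (-τ)) (ha : Real.exp (-1) * N ≤ a) (haN : a ≤ Nu) :
    τ * N ≤ N - Nu + a := by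
  have h1 : Real.exp (-1) ≤ Real.exp (-τ) := by
    have : Real.exp (-1) * N ≤ Real.exp (-τ) * N := by linarith
    exact le_of_mul_le_mul_right this hN
  have hτ1 : τ ≤ 1 := by
    have := Real.exp_le_exp.mp h1
    linarith
  have h2 : Real.exp (-τ) ≤ (1 - τ) + τ * Real.exp (-1) := by
    have := convexOn_exp.2 (Set.mem_univ (0 : ℝ)) (Set.mem_univ (-1 : ℝ))
      (show 0 ≤ 1 - τ by linarith) hτ (by ring)
    simpa using this
  have h3 : Real.exp (-1) ≤ 1 := by simp
  have h4 := Real.exp_pos (-1)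
  have h5 : τ ≤ 1 - Real.exp (-τ) + Real.exp (-1) := by nlinarith
  nlinarith

/-- The one-dimensional dilation inequality when the left of the mode `c` carries enough of `A`. -/
theorem mul_setLIntegral_le_of_left_mass {f : ℝ → ℝ} (hf0 : ∀ x, 0 ≤ f x)
    (hlc : ∀ x y t : ℝ, 0 < t → t < 1 → f x ^ (1 - t) * f y ^ t ≤ f ((1 - t) * x + t * y))
    (hfm : Measurable f) (hfi : Integrable f) {c : ℝ} (hmono : MonotoneOn f (Set.Iic c))
    (hanti : AntitoneOn f (Set.Ici c))
    {A B : Set ℝ} {l ρ : ℝ} (hA : IsClosed A)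
    (hρ : 0 < ρ) (hsep : ∀ a ∈ A, ∀ b ∈ B, ρ ≤ |a - b|)
    (hL : ∀ x ∈ A, ∀ y ≤ x,
      ENNReal.ofReal l * volume (B ∩ Set.Icc y x) ≤ ENNReal.ofReal (x - y))
    (hR : ∀ x ∈ A, ∀ y, x ≤ y →
      ENNReal.ofReal l * volume (B ∩ Set.Icc x y) ≤ ENNReal.ofReal (y - x))
    (hpos : 0 < ∫ x in Set.Iic c, f x)
    (hmass : Real.exp (-1) * ∫ x in Set.Iic c, f x ≤ ∫ x in A ∩ Set.Iic c, f x) :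
    ENNReal.ofReal l * ∫⁻ x in B, ENNReal.ofReal (f x) ≤ ∫⁻ x, ENNReal.ofReal (f x) := by
  have hane : (A ∩ Set.Iic c).Nonempty := by
    rw [Set.nonempty_iff_ne_empty]
    intro h
    rw [h] at hmass
    simp at hmass
    have := mul_pos (Real.exp_pos (-1)) hpos
    linarith
  have hbdd : BddAbove (A ∩ Set.Iic c) := ⟨c, fun x hx => hx.2⟩
  set u := sSup (A ∩ Set.Iic c) with hu
  obtain ⟨huA, huc⟩ : u ∈ A ∩ Set.Iic c := (hA.inter isClosed_Iic).csSup_mem hane hbdd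
  have huc : u ≤ c := huc
  have hsubA : A ∩ Set.Iic c ⊆ Set.Iic u := fun x hx => le_csSup hbdd hx
  have hfc : 0 < f c := by
    by_contra! h
    have h0 : ∀ x ∈ Set.Iic c, f x = 0 := fun x hx =>
      le_antisymm ((hmono hx (Set.mem_Iic.mpr le_rfl) hx).trans h) (hf0 x)
    rw [setIntegral_congr_fun measurableSet_Iic h0] at hpos
    simp at hpos
  set a := ∫ x in A ∩ Set.Iic c, f x with ha
  have hareal : ∀ S : Set ℝ, ∫⁻ x in S, ENNReal.ofReal (f x) = ENNReal.ofReal (∫ x in S, f x) :=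
    fun S => (ofReal_integral_eq_lintegral_ofReal hfi.integrableOn
      (Filter.Eventually.of_forall hf0)).symm
  -- the part to the left of `u`
  have hleft : ENNReal.ofReal l * (∫⁻ x in B ∩ Set.Iio u, ENNReal.ofReal (f x)) +
      ENNReal.ofReal a ≤ ∫⁻ x in Set.Iio u, ENNReal.ofReal (f x) := by
    have h := setLIntegral_Iio_le_of_monotoneOn
      (μ := ENNReal.ofReal l • volume.restrict B + volume.restrict A) (u := u) (fun y hy => by
        have := volume_inter_add_volume_inter_Icc_le hA hρ hsep hL huA hy.le
        simp only [Measure.coe_add, Measure.coe_smul, Pi.add_apply, Pi.smul_apply, smul_eq_mul,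
          Measure.restrict_apply measurableSet_Ico]
        refine le_trans ?_ this
        rw [Set.inter_comm B, Set.inter_comm A]
        gcongr <;> exact Set.Ico_subset_Icc_self) hf0 hfm
      (hmono.mono fun x hx => (le_of_lt hx).trans huc)
    rw [Measure.restrict_add, Measure.restrict_smul, lintegral_add_measure,
      lintegral_smul_measure, Measure.restrict_restrict measurableSet_Iio,
      Measure.restrict_restrict measurableSet_Iio, smul_eq_mul] at h
    refine le_trans (le_of_eq ?_) h
    rw [Set.inter_comm B, ha, ← hareal]
    refine congrArg₂ (· + ·) rfl (setLIntegral_congr ?_)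
    have h1 : A ∩ Set.Iic c = A ∩ Set.Iic u :=
      Set.Subset.antisymm (fun x hx => ⟨hx.1, hsubA hx⟩)
        (fun x hx => ⟨hx.1, (show x ≤ u from hx.2).trans huc⟩)
    rw [h1, Set.inter_comm A]
    exact (Iio_ae_eq_Iic.inter (Filter.EventuallyEq.refl _ _)).symm
  -- the part to the right of `u`
  set g : ℝ → ℝ := fun x => if x ≤ c then f c else f x with hg
  have hfg : ∀ x, f x ≤ g x := by
    intro x
    rw [hg]; dsimp only
    split_ifs with h
    · exact hmono h (Set.mem_Iic.mpr le_rfl) h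
    · exact le_rfl
  have hgm : Measurable g := Measurable.ite measurableSet_Iic measurable_const hfm
  have hg0 : ∀ x, 0 ≤ g x := fun x => (hf0 x).trans (hfg x)
  have hganti : Antitone g := by
    intro x y hxy
    rw [hg]; dsimp only
    split_ifs with h1 h2 h2
    · exact le_rfl
    · linarith
    · exact hanti (Set.mem_Ici.mpr le_rfl) (not_le.mp h1).le (not_le.mp h1).le
    · exact hanti (not_le.mp h2).le (not_le.mp h1).le hxy
  have hright : ENNReal.ofReal l * ∫⁻ x in B ∩ Set.Ioi u, ENNReal.ofReal (f x) ≤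
      ENNReal.ofReal (f c * (c - u)) + ∫⁻ x in Set.Ioi c, ENNReal.ofReal (f x) := by
    have h := setLIntegral_Ioi_le_of_antitoneOn
      (μ := ENNReal.ofReal l • volume.restrict B) (u := u) (fun y hy => by
        simp only [Measure.coe_smul, Pi.smul_apply, smul_eq_mul,
          Measure.restrict_apply measurableSet_Ioc]
        refine le_trans ?_ (hR u huA y hy.le)
        rw [Set.inter_comm B]
        gcongr
        exact Set.Ioc_subset_Icc_self) hg0 hgm (hganti.antitoneOn _)
    rw [Measure.restrict_smul, lintegral_smul_measure,
      Measure.restrict_restrict measurableSet_Ioi, smul_eq_mul] at h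
    calc _ ≤ ENNReal.ofReal l * ∫⁻ x in Set.Ioi u ∩ B, ENNReal.ofReal (g x) := by
          rw [Set.inter_comm B]
          gcongr with x
          exact hfg x
      _ ≤ _ := h
      _ = (∫⁻ x in Set.Ioc u c, ENNReal.ofReal (g x)) +
          ∫⁻ x in Set.Ioi c, ENNReal.ofReal (g x) := by
        rw [← Set.Ioc_union_Ioi_eq_Ioi huc, lintegral_union measurableSet_Ioi]
        rw [Set.disjoint_left]; intro x hx hx'; exact absurd hx.2 (not_le.mpr hx')
      _ = _ := by
        congr 1
        · rw [setLIntegral_congr_fun (g := fun _ => ENNReal.ofReal (f c)) measurableSet_Ioc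
            (fun x hx => by simp [hg, hx.2])]
          simp [ENNReal.ofReal_mul hfc.le]
        · exact setLIntegral_congr_fun measurableSet_Ioi
            (fun x hx => by simp [hg, not_le.mpr (show c < x from hx)])
  -- the tail estimate
  have htail : f c * (c - u) ≤ (∫ x in Set.Ioc u c, f x) + a := by
    set N := ∫ x in Set.Iic c, f x with hN
    have h1 := setIntegral_Iic_le_exp hlc hfi.integrableOn hfc hpos huc
    have h2 : a ≤ ∫ x in Set.Iic u, f x :=
      setIntegral_mono_set hfi.integrableOn (Filter.Eventually.of_forall hf0)
        (Filter.Eventually.of_forall hsubA)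
    have h3 := mul_le_sub_add_of_le_exp hpos
      (mul_nonneg (div_nonneg hfc.le hpos.le) (sub_nonneg.mpr huc)) h1 hmass h2
    have h4 : N = (∫ x in Set.Iic u, f x) + ∫ x in Set.Ioc u c, f x := by
      rw [hN, ← Set.Iic_union_Ioc_eq_Iic huc, setIntegral_union (by
        rw [Set.disjoint_left]; intro x hx hx'; exact absurd hx'.1 (not_lt.mpr hx))
        measurableSet_Ioc hfi.integrableOn hfi.integrableOn]
    have h5 : f c / N * (c - u) * N = f c * (c - u) := by field_simp
    linarith
  have hsplitB : ∫⁻ x in B, ENNReal.ofReal (f x) ≤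
      (∫⁻ x in B ∩ Set.Iio u, ENNReal.ofReal (f x)) +
      ∫⁻ x in B ∩ Set.Ioi u, ENNReal.ofReal (f x) := by
    refine le_trans (lintegral_mono_set' ?_) (lintegral_union_le _ _ _)
    have : ∀ᵐ x : ℝ, x ≠ u := by simp [ae_iff]
    filter_upwards [this] with x hx hxB
    rcases lt_or_gt_of_ne hx with h | h
    · exact Or.inl ⟨hxB, h⟩
    · exact Or.inr ⟨hxB, h⟩
  have hsplit : ∫⁻ x, ENNReal.ofReal (f x) = (∫⁻ x in Set.Iio u, ENNReal.ofReal (f x)) +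
      (∫⁻ x in Set.Ioc u c, ENNReal.ofReal (f x)) + ∫⁻ x in Set.Ioi c, ENNReal.ofReal (f x) := by
    rw [setLIntegral_congr (Iio_ae_eq_Iic (a := u)), ← lintegral_union measurableSet_Ioc (by
        rw [Set.disjoint_left]; intro x hx hx'; exact absurd hx'.1 (not_lt.mpr hx)),
      Set.Iic_union_Ioc_eq_Iic huc, ← lintegral_union measurableSet_Ioi (by
        rw [Set.disjoint_left]; intro x hx hx'; exact not_lt.mpr (show x ≤ c from hx) hx'),
      Set.Iic_union_Ioi, setLIntegral_univ]
  have ha0 : 0 ≤ a := setIntegral_nonneg_ae (hA.inter isClosed_Iic).measurableSet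
    (Filter.Eventually.of_forall fun x _ => hf0 x)
  have htail' : ENNReal.ofReal (f c * (c - u)) ≤
      (∫⁻ x in Set.Ioc u c, ENNReal.ofReal (f x)) + ENNReal.ofReal a := by
    rw [hareal, ← ENNReal.ofReal_add (setIntegral_nonneg measurableSet_Ioc fun x _ => hf0 x) ha0]
    exact ENNReal.ofReal_le_ofReal htail
  have hfin : ENNReal.ofReal a ≠ ⊤ := ENNReal.ofReal_ne_top
  rw [← ENNReal.add_le_add_iff_right hfin, hsplit]
  calc _ ≤ ENNReal.ofReal l * ((∫⁻ x in B ∩ Set.Iio u, ENNReal.ofReal (f x)) +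
        ∫⁻ x in B ∩ Set.Ioi u, ENNReal.ofReal (f x)) + ENNReal.ofReal a := by gcongr
    _ = (ENNReal.ofReal l * (∫⁻ x in B ∩ Set.Iio u, ENNReal.ofReal (f x)) + ENNReal.ofReal a) +
        ENNReal.ofReal l * ∫⁻ x in B ∩ Set.Ioi u, ENNReal.ofReal (f x) := by ring
    _ ≤ (∫⁻ x in Set.Iio u, ENNReal.ofReal (f x)) +
        (((∫⁻ x in Set.Ioc u c, ENNReal.ofReal (f x)) + ENNReal.ofReal a) +
          ∫⁻ x in Set.Ioi c, ENNReal.ofReal (f x)) := by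
        refine add_le_add hleft (hright.trans ?_)
        gcongr
    _ = _ := by ring

/-- The one-dimensional dilation inequality for log-concave densities with a mode. -/
theorem mul_setLIntegral_le_of_mass {f : ℝ → ℝ} (hf0 : ∀ x, 0 ≤ f x)
    (hlc : ∀ x y t : ℝ, 0 < t → t < 1 → f x ^ (1 - t) * f y ^ t ≤ f ((1 - t) * x + t * y))
    (hfm : Measurable f) (hfi : Integrable f) {c : ℝ} (hmono : MonotoneOn f (Set.Iic c))
    (hanti : AntitoneOn f (Set.Ici c))
    {A B : Set ℝ} {l ρ : ℝ} (hA : IsClosed A)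
    (hρ : 0 < ρ) (hsep : ∀ a ∈ A, ∀ b ∈ B, ρ ≤ |a - b|)
    (hL : ∀ x ∈ A, ∀ y ≤ x,
      ENNReal.ofReal l * volume (B ∩ Set.Icc y x) ≤ ENNReal.ofReal (x - y))
    (hR : ∀ x ∈ A, ∀ y, x ≤ y →
      ENNReal.ofReal l * volume (B ∩ Set.Icc x y) ≤ ENNReal.ofReal (y - x))
    (hpos : 0 < ∫ x, f x)
    (hmass : Real.exp (-1) * ∫ x, f x ≤ ∫ x in A, f x) :
    ENNReal.ofReal l * ∫⁻ x in B, ENNReal.ofReal (f x) ≤ ∫⁻ x, ENNReal.ofReal (f x) := by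
  by_cases h1 : 0 < ∫ x in Set.Iic c, f x ∧
      Real.exp (-1) * ∫ x in Set.Iic c, f x ≤ ∫ x in A ∩ Set.Iic c, f x
  · exact mul_setLIntegral_le_of_left_mass hf0 hlc hfm hfi hmono hanti hA hρ hsep hL hR
      h1.1 h1.2
  have hdec : ∫ x, f x = (∫ x in Set.Iic c, f x) + ∫ x in Set.Ici c, f x := by
    rw [integral_Ici_eq_integral_Ioi, ← integral_add_compl measurableSet_Iic hfi, Set.compl_Iic]
  have hdecA : ∫ x in A, f x ≤ (∫ x in A ∩ Set.Iic c, f x) + ∫ x in A ∩ Set.Ici c, f x := by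
    have hd : Disjoint (A ∩ Set.Iic c) (A ∩ Set.Ioi c) := by
      rw [Set.disjoint_left]
      intro x hx hx'
      exact not_lt.mpr (show x ≤ c from hx.2) hx'.2
    have he : A = (A ∩ Set.Iic c) ∪ (A ∩ Set.Ioi c) := by
      rw [← Set.inter_union_distrib_left, Set.Iic_union_Ioi, Set.inter_univ]
    conv_lhs => rw [he]
    rw [setIntegral_union hd (hA.measurableSet.inter measurableSet_Ioi) hfi.integrableOn
      hfi.integrableOn]
    refine add_le_add le_rfl ?_
    exact setIntegral_mono_set hfi.integrableOn (Filter.Eventually.of_forall hf0)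
      (Filter.Eventually.of_forall fun x hx => ⟨hx.1, (le_of_lt hx.2 : c ≤ x)⟩)
  have hn1 : 0 ≤ ∫ x in Set.Iic c, f x := setIntegral_nonneg measurableSet_Iic fun x _ => hf0 x
  have hn2 : 0 ≤ ∫ x in Set.Ici c, f x := setIntegral_nonneg measurableSet_Ici fun x _ => hf0 x
  have hA1 : ∫ x in A ∩ Set.Iic c, f x ≤ ∫ x in Set.Iic c, f x :=
    setIntegral_mono_set hfi.integrableOn (Filter.Eventually.of_forall hf0)
      (Filter.Eventually.of_forall fun x hx => hx.2)
  have hA2 : ∫ x in A ∩ Set.Ici c, f x ≤ ∫ x in Set.Ici c, f x :=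
    setIntegral_mono_set hfi.integrableOn (Filter.Eventually.of_forall hf0)
      (Filter.Eventually.of_forall fun x hx => hx.2)
  have he := Real.exp_pos (-1)
  have h2 : 0 < ∫ x in Set.Ici c, f x ∧
      Real.exp (-1) * ∫ x in Set.Ici c, f x ≤ ∫ x in A ∩ Set.Ici c, f x := by
    rw [hdec, mul_add] at hmass
    rw [not_and_or, not_lt, not_le] at h1
    rcases h1 with h | h
    · have h0 : ∫ x in Set.Iic c, f x = 0 := le_antisymm h hn1
      rw [h0] at hmass hA1 hdec
      constructor <;> linarith
    · have h3 : Real.exp (-1) * ∫ x in Set.Ici c, f x < ∫ x in A ∩ Set.Ici c, f x := by linarith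
      refine ⟨lt_of_le_of_ne hn2 fun h0 => ?_, h3.le⟩
      rw [← h0] at h3 hA2
      linarith
  have hrefl : ∀ S : Set ℝ, ∫ x in -S, f (-x) = ∫ x in S, f x := by
    intro S
    have := (Measure.measurePreserving_neg (volume : Measure ℝ)).setIntegral_preimage_emb
      (Homeomorph.neg ℝ).measurableEmbedding f S
    simpa using this
  have hrefl' : ∀ S : Set ℝ, ∫⁻ x in -S, ENNReal.ofReal (f (-x)) =
      ∫⁻ x in S, ENNReal.ofReal (f x) := by
    intro S
    have := (Measure.measurePreserving_neg (volume : Measure ℝ)).setLIntegral_comp_preimage_emb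
      (Homeomorph.neg ℝ).measurableEmbedding (fun x => ENNReal.ofReal (f x)) S
    simpa using this
  have hvol : ∀ y x : ℝ, volume (-B ∩ Set.Icc y x) = volume (B ∩ Set.Icc (-x) (-y)) := by
    intro y x
    rw [← Measure.measure_neg]
    congr 1
    ext z
    simp [and_comm]
  have key := mul_setLIntegral_le_of_left_mass (f := fun x => f (-x)) (c := -c) (A := -A) (B := -B)
    (l := l) (ρ := ρ) (fun x => hf0 _)
    (fun x y t h0 h1 => by
      have := hlc (-x) (-y) t h0 h1
      convert this using 2
      ring)
    (hfm.comp measurable_neg) hfi.comp_neg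
    (fun x hx y hy hxy => hanti (le_neg.mpr (Set.mem_Iic.mp hy)) (le_neg.mpr (Set.mem_Iic.mp hx)) (neg_le_neg hxy))
    (fun x hx y hy hxy => hmono (neg_le.mp (Set.mem_Ici.mp hy)) (neg_le.mp (Set.mem_Ici.mp hx)) (neg_le_neg hxy))
    (hA.preimage continuous_neg) hρ
    (fun a ha b hb => by
      have := hsep (-a) ha (-b) hb
      rwa [← abs_neg, show -(-a - -b) = a - b by ring] at this)
    (fun x hx y hyx => by
      rw [hvol]
      convert hR (-x) hx (-y) (neg_le_neg hyx) using 2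
      ring)
    (fun x hx y hyx => by
      rw [hvol]
      convert hL (-x) hx (-y) (neg_le_neg hyx) using 2
      ring)
    (by
      have := hrefl (Set.Ici c)
      rw [show -Set.Ici c = Set.Iic (-c) by simp] at this
      rw [this]
      exact h2.1)
    (by
      have h3 := hrefl (Set.Ici c)
      have h4 := hrefl (A ∩ Set.Ici c)
      rw [Set.inter_neg] at h4
      rw [show -Set.Ici c = Set.Iic (-c) by simp] at h3 h4
      rw [h3, h4]
      exact h2.2)
  rw [hrefl' B] at key
  refine key.trans (le_of_eq ?_)
  have := hrefl' Set.univ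
  simpa using this

theorem volume_add_volume_le_of_ordConnected {I J H : Set ℝ} (hI : I.OrdConnected)
    (hJ : J.OrdConnected) (hIne : I.Nonempty) (hJne : J.Nonempty) {t : ℝ} (ht0 : 0 < t)
    (ht1 : t < 1) (h : ∀ r ∈ I, ∀ s ∈ J, (1 - t) * r + t * s ∈ H) :
    ENNReal.ofReal (1 - t) * volume I + ENNReal.ofReal t * volume J ≤ volume H := by
  have h1t : 0 < 1 - t := by linarith
  have base' : ∀ r₁ ∈ I, ∀ r₂ ∈ I, ∀ s₁ ∈ J, ∀ s₂ ∈ J, r₁ ≤ r₂ → s₁ ≤ s₂ →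
      ENNReal.ofReal ((1 - t) * (r₂ - r₁) + t * (s₂ - s₁)) ≤ volume H := by
    intro r₁ hr₁ r₂ hr₂ s₁ hs₁ s₂ hs₂ hr hs
    have hle : (1 - t) * r₁ + t * s₁ ≤ (1 - t) * r₂ + t * s₂ := by gcongr
    have hsub : Set.Icc ((1 - t) * r₁ + t * s₁) ((1 - t) * r₂ + t * s₂) ⊆ H := by
      rw [← segment_eq_Icc hle]
      rintro x ⟨p, q, hp, hq, hpq, rfl⟩
      have e1 : p • ((1 - t) * r₁ + t * s₁) + q • ((1 - t) * r₂ + t * s₂) =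
          (1 - t) * (p * r₁ + q * r₂) + t * (p * s₁ + q * s₂) := by
        simp only [smul_eq_mul]; ring
      rw [e1]
      have mem : ∀ {S : Set ℝ}, S.OrdConnected → ∀ x ∈ S, ∀ y ∈ S, p * x + q * y ∈ S := by
        intro S hS x hx y hy
        exact hS.convex hx hy hp hq hpq
      exact h _ (mem hI _ hr₁ _ hr₂) _ (mem hJ _ hs₁ _ hs₂)
    calc _ = volume (Set.Icc ((1 - t) * r₁ + t * s₁) ((1 - t) * r₂ + t * s₂)) := by
          rw [Real.volume_Icc]; congr 1; ring
      _ ≤ _ := measure_mono hsub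
  have base : ∀ r₁ ∈ I, ∀ r₂ ∈ I, ∀ s₁ ∈ J, ∀ s₂ ∈ J,
      ENNReal.ofReal (1 - t) * edist r₁ r₂ + ENNReal.ofReal t * edist s₁ s₂ ≤ volume H := by
    intro r₁ hr₁ r₂ hr₂ s₁ hs₁ s₂ hs₂
    rw [edist_dist, edist_dist, ← ENNReal.ofReal_mul h1t.le, ← ENNReal.ofReal_mul ht0.le,
      ← ENNReal.ofReal_add (by positivity) (by positivity), Real.dist_eq, Real.dist_eq]
    rcases le_total r₁ r₂ with hr | hr <;> rcases le_total s₁ s₂ with hs | hs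
    · rw [abs_sub_comm, abs_of_nonneg (sub_nonneg.mpr hr), abs_sub_comm s₁,
        abs_of_nonneg (sub_nonneg.mpr hs)]
      exact base' _ hr₁ _ hr₂ _ hs₁ _ hs₂ hr hs
    · rw [abs_sub_comm, abs_of_nonneg (sub_nonneg.mpr hr), 
        abs_of_nonneg (sub_nonneg.mpr hs)]
      exact base' _ hr₁ _ hr₂ _ hs₂ _ hs₁ hr hs
    · rw [abs_of_nonneg (sub_nonneg.mpr hr), abs_sub_comm s₁,
        abs_of_nonneg (sub_nonneg.mpr hs)]
      exact base' _ hr₂ _ hr₁ _ hs₁ _ hs₂ hr hs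
    · rw [abs_of_nonneg (sub_nonneg.mpr hr), abs_of_nonneg (sub_nonneg.mpr hs)]
      exact base' _ hr₂ _ hr₁ _ hs₂ _ hs₁ hr hs
  by_cases htop : volume H = ⊤
  · rw [htop]; exact le_top
  have c1 : ENNReal.ofReal (1 - t) ≠ 0 := by simpa using h1t
  have c2 : ENNReal.ofReal t ≠ 0 := by simpa using ht0
  have step1 : ∀ s₁ ∈ J, ∀ s₂ ∈ J,
      ENNReal.ofReal (1 - t) * Metric.ediam I + ENNReal.ofReal t * edist s₁ s₂ ≤ volume H := by
    intro s₁ hs₁ s₂ hs₂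
    obtain ⟨r, hr⟩ := hIne
    have hX : ENNReal.ofReal t * edist s₁ s₂ ≤ volume H :=
      le_trans le_add_self (base r hr r hr _ hs₁ _ hs₂)
    rw [← ENNReal.le_sub_iff_add_le_right (ne_top_of_le_ne_top htop hX) hX, mul_comm,
      ← ENNReal.le_div_iff_mul_le (Or.inl c1) (Or.inl ENNReal.ofReal_ne_top)]
    refine Metric.ediam_le fun r₁ hr₁ r₂ hr₂ => ?_
    rw [ENNReal.le_div_iff_mul_le (Or.inl c1) (Or.inl ENNReal.ofReal_ne_top), mul_comm,
      ENNReal.le_sub_iff_add_le_right (ne_top_of_le_ne_top htop hX) hX]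
    exact base _ hr₁ _ hr₂ _ hs₁ _ hs₂
  have step2 : ENNReal.ofReal (1 - t) * Metric.ediam I + ENNReal.ofReal t * Metric.ediam J ≤
      volume H := by
    obtain ⟨s, hs⟩ := hJne
    have hX : ENNReal.ofReal (1 - t) * Metric.ediam I ≤ volume H :=
      le_trans le_self_add (step1 s hs s hs)
    rw [← ENNReal.le_sub_iff_add_le_left (ne_top_of_le_ne_top htop hX) hX, mul_comm (ENNReal.ofReal t),
      ← ENNReal.le_div_iff_mul_le (Or.inl c2) (Or.inl ENNReal.ofReal_ne_top)]
    refine Metric.ediam_le fun r₁ hr₁ r₂ hr₂ => ?_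
    rw [ENNReal.le_div_iff_mul_le (Or.inl c2) (Or.inl ENNReal.ofReal_ne_top), mul_comm,
      ENNReal.le_sub_iff_add_le_left (ne_top_of_le_ne_top htop hX) hX]
    exact step1 _ hr₁ _ hr₂
  exact le_trans (by gcongr <;> exact Real.volume_le_diam _) step2

/-- The one-dimensional Prékopa–Leindler inequality for quasi-concave functions. -/
theorem integral_rpow_mul_integral_rpow_le {a b h : ℝ → ℝ} (ha0 : ∀ x, 0 ≤ a x)
    (hb0 : ∀ x, 0 ≤ b x) (hh0 : ∀ x, 0 ≤ h x) (ham : Measurable a) (hbm : Measurable b)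
    (hhm : Measurable h) (hai : Integrable a) (hbi : Integrable b) (hhi : Integrable h)
    (hab : BddAbove (Set.range a)) (hbb : BddAbove (Set.range b))
    (haq : ∀ r, {x | r < a x}.OrdConnected) (hbq : ∀ r, {x | r < b x}.OrdConnected)
    {t : ℝ} (ht0 : 0 < t) (ht1 : t < 1)
    (hle : ∀ x y, a x ^ (1 - t) * b y ^ t ≤ h ((1 - t) * x + t * y)) :
    (∫ x, a x) ^ (1 - t) * (∫ x, b x) ^ t ≤ ∫ x, h x := by
  have h1t : 0 < 1 - t := by linarith
  have hhint : 0 ≤ ∫ x, h x := integral_nonneg hh0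
  have haint : 0 ≤ ∫ x, a x := integral_nonneg ha0
  have hbint : 0 ≤ ∫ x, b x := integral_nonneg hb0
  rcases haint.eq_or_lt with h0 | hapos
  · rw [← h0, Real.zero_rpow h1t.ne', zero_mul]; exact hhint
  rcases hbint.eq_or_lt with h0 | hbpos
  · rw [← h0, Real.zero_rpow ht0.ne', mul_zero]; exact hhint
  have hsup : ∀ {g : ℝ → ℝ}, (∀ x, 0 ≤ g x) → BddAbove (Set.range g) → 0 < ∫ x, g x →
      0 < ⨆ x, g x := by
    intro g hg0 hgb hg
    by_contra! hn
    have : ∀ x, g x = 0 := fun x => le_antisymm ((le_ciSup hgb x).trans hn) (hg0 x)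
    simp [this] at hg
  have hSa := hsup ha0 hab hapos
  have hSb := hsup hb0 hbb hbpos
  set Sa := ⨆ x, a x with hSad
  set Sb := ⨆ x, b x with hSbd
  set S := Sa ^ (1 - t) * Sb ^ t with hSd
  have hS : 0 < S := by positivity
  have hlev : ∀ (g : ℝ → ℝ) (r : ℝ), BddAbove (Set.range g) → 0 < ⨆ x, g x → 1 ≤ r →
      volume {x | r < g x / ⨆ x, g x} = 0 := by
    intro g r hgb hg hr
    convert measure_empty (μ := (volume : Measure ℝ))
    ext x
    simp only [Set.mem_ofPred_eq, Set.mem_empty_iff_false, iff_false, not_lt]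
    refine le_trans ?_ hr
    rw [div_le_one hg]
    exact le_ciSup hgb x
  have hne : ∀ (g : ℝ → ℝ) (r : ℝ), 0 < ⨆ x, g x → r < 1 →
      {x | r < g x / ⨆ x, g x}.Nonempty := by
    intro g r hg hr
    obtain ⟨x, hx⟩ := exists_lt_of_lt_ciSup (show r * (⨆ x, g x) < ⨆ x, g x by nlinarith)
    exact ⟨x, (lt_div_iff₀ hg).mpr hx⟩
  have hpt : ∀ r ∈ Set.Ioi (0 : ℝ), ENNReal.ofReal (1 - t) * volume {x | r < a x / Sa} +
      ENNReal.ofReal t * volume {x | r < b x / Sb} ≤ volume {x | r < h x / S} := by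
    intro r hr
    have hr : 0 < r := hr
    rcases le_or_gt 1 r with h1 | h1
    · rw [hlev a r hab hSa h1, hlev b r hbb hSb h1]; simp
    · refine volume_add_volume_le_of_ordConnected ?_ ?_ (hne a r hSa h1) (hne b r hSb h1) ht0 ht1 ?_
      · convert haq (r * Sa) using 3
        exact lt_div_iff₀ hSa
      · convert hbq (r * Sb) using 3
        exact lt_div_iff₀ hSb
      · intro x hx y hy
        replace hx : r * Sa < a x := (lt_div_iff₀ hSa).mp hx
        replace hy : r * Sb < b y := (lt_div_iff₀ hSb).mp hy
        refine (lt_div_iff₀ hS).mpr ?_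
        refine lt_of_lt_of_le ?_ (hle x y)
        calc r * S = (r * Sa) ^ (1 - t) * (r * Sb) ^ t := by
              rw [Real.mul_rpow hr.le hSa.le, Real.mul_rpow hr.le hSb.le, hSd]
              have : r ^ (1 - t) * r ^ t = r := by
                rw [← Real.rpow_add hr]; simp
              calc _ = (r ^ (1 - t) * r ^ t) * (Sa ^ (1 - t) * Sb ^ t) := by rw [this]
                _ = _ := by ring
          _ < _ := by
              have q1 : 0 < r * Sa := by positivity
              have q2 : 0 < r * Sb := by positivity
              apply mul_lt_mul'' (Real.rpow_lt_rpow q1.le hx h1t) (Real.rpow_lt_rpow q2.le hy ht0)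
                <;> positivity
  have hmeas : ∀ g : ℝ → ℝ, Measurable fun r : ℝ => volume {x | r < g x} := fun g =>
    Antitone.measurable fun r r' hrr => measure_mono fun x hx => lt_of_le_of_lt hrr hx
  have hcake : ∀ (g : ℝ → ℝ) (s : ℝ), 0 < s → (∀ x, 0 ≤ g x) → Measurable g → Integrable g →
      ENNReal.ofReal ((∫ x, g x) / s) = ∫⁻ r in Set.Ioi 0, volume {x | r < g x / s} := by
    intro g s hs hg0 hgm hgi
    rw [← lintegral_eq_lintegral_meas_lt _ (Filter.Eventually.of_forall fun x =>
      div_nonneg (hg0 x) hs.le) (hgm.div_const s).aemeasurable, ← integral_div,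
      ofReal_integral_eq_lintegral_ofReal (hgi.div_const s)
        (Filter.Eventually.of_forall fun x => div_nonneg (hg0 x) hs.le)]
  have hfin : (1 - t) * ((∫ x, a x) / Sa) + t * ((∫ x, b x) / Sb) ≤ (∫ x, h x) / S := by
    rw [← ENNReal.ofReal_le_ofReal_iff (by positivity), ENNReal.ofReal_add (by positivity)
      (by positivity), ENNReal.ofReal_mul h1t.le, ENNReal.ofReal_mul ht0.le,
      hcake a Sa hSa ha0 ham hai, hcake b Sb hSb hb0 hbm hbi, hcake h S hS hh0 hhm hhi,
      ← lintegral_const_mul _ (hmeas _), ← lintegral_const_mul _ (hmeas _),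
      ← lintegral_add_left ((hmeas _).const_mul _)]
    exact setLIntegral_mono (hmeas _) hpt
  have hamgm := Real.geom_mean_le_arith_mean2_weighted h1t.le ht0.le
    (div_nonneg haint hSa.le) (div_nonneg hbint hSb.le) (by ring)
  have := hamgm.trans hfin
  rw [Real.div_rpow haint hSa.le, Real.div_rpow hbint hSb.le, div_mul_div_comm,
    div_le_div_iff_of_pos_right hS] at this
  exact this

/-- The section of `K` at height `s` in the coordinate direction `i`. -/
def coordSlice {m : ℕ} (K : Set (Fin (m + 1) → ℝ)) (i : Fin (m + 1)) (s : ℝ) :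
    Set (Fin m → ℝ) :=
  {z | Fin.insertNth (α := fun _ => ℝ) i s z ∈ K}

section coordSlice

variable {m : ℕ} {K : Set (Fin (m + 1) → ℝ)} (i : Fin (m + 1))

theorem continuous_insertNth (s : ℝ) :
    Continuous fun z : Fin m → ℝ => Fin.insertNth (α := fun _ => ℝ) i s z :=
  Continuous.finInsertNth (A := fun _ => ℝ) i continuous_const continuous_id

theorem coordSlice_subset (s : ℝ) : coordSlice K i s ⊆ (fun x => i.removeNth x) '' K := by
  intro z hz
  exact ⟨_, hz, by ext j; simp [Fin.removeNth]⟩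

theorem isCompact_removeNth_image (hK : IsCompact K) :
    IsCompact ((fun x => i.removeNth x) '' K : Set (Fin m → ℝ)) :=
  hK.image (by unfold Fin.removeNth; fun_prop)

theorem IsCompact.coordSlice (hK : IsCompact K) (s : ℝ) : IsCompact (coordSlice K i s) :=
  (isCompact_removeNth_image i hK).of_isClosed_subset
    (hK.isClosed.preimage (continuous_insertNth i s)) (coordSlice_subset i s)

theorem insertNth_combo (a b r s : ℝ) (x y : Fin m → ℝ) :
    a • Fin.insertNth (α := fun _ => ℝ) i r x + b • Fin.insertNth (α := fun _ => ℝ) i s y =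
      Fin.insertNth (α := fun _ => ℝ) i (a * r + b * s) (a • x + b • y) := by
  ext j
  induction j using i.succAboveCases <;> simp

theorem Convex.combo_mem_coordSlice (hK : Convex ℝ K) {r s t : ℝ} (ht0 : 0 ≤ t) (ht1 : t ≤ 1)
    {x y : Fin m → ℝ} (hx : x ∈ coordSlice K i r) (hy : y ∈ coordSlice K i s) :
    (1 - t) • x + t • y ∈ coordSlice K i ((1 - t) * r + t * s) := by
  have := hK hx hy (sub_nonneg.mpr ht1) ht0 (by ring)
  rwa [insertNth_combo] at this

theorem Convex.coordSlice (hK : Convex ℝ K) (s : ℝ) : Convex ℝ (coordSlice K i s) := by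
  intro x hx y hy a b ha hb hab
  have := hK hx hy ha hb hab
  rwa [insertNth_combo, ← add_mul, hab, one_mul] at this

theorem measurable_volume_coordSlice (hK : MeasurableSet K) :
    Measurable fun s => volume (coordSlice K i s) := by
  have := measurable_measure_prodMk_left (ν := (volume : Measure (Fin m → ℝ)))
    ((MeasurableEquiv.piFinSuccAbove (fun _ => ℝ) i).symm.measurable hK)
  exact this

theorem lintegral_volume_coordSlice (hK : MeasurableSet K) :
    ∫⁻ s, volume (coordSlice K i s) = volume K := by
  have h := (volume_preserving_piFinSuccAbove (fun _ => ℝ) i).symm.measure_preimage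
    hK.nullMeasurableSet
  rw [← h, Measure.volume_eq_prod,
    Measure.prod_apply ((MeasurableEquiv.piFinSuccAbove (fun _ => ℝ) i).symm.measurable hK)]
  rfl

theorem setLIntegral_volume_coordSlice (hK : MeasurableSet K) {S : Set ℝ} (hS : MeasurableSet S) :
    ∫⁻ s in S, volume (coordSlice K i s) = volume (K ∩ {x | x i ∈ S}) := by
  have hKS : MeasurableSet (K ∩ {x | x i ∈ S}) := hK.inter (measurable_pi_apply i hS)
  rw [← lintegral_volume_coordSlice i hKS,
    ← lintegral_indicator hS]
  congr 1
  ext s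
  by_cases hs : s ∈ S
  · rw [Set.indicator_of_mem hs]
    congr 1
    ext z
    simp [coordSlice, hs]
  · rw [Set.indicator_of_notMem hs]
    symm
    convert measure_empty (μ := (volume : Measure (Fin m → ℝ)))
    ext z
    simp [coordSlice, hs]

/-- The `m`-dimensional volume of the section at height `s`. -/
noncomputable def sliceVolume (K : Set (Fin (m + 1) → ℝ)) (i : Fin (m + 1)) (s : ℝ) : ℝ :=
  volume.real (coordSlice K i s)

theorem ofReal_sliceVolume (hK : IsCompact K) (s : ℝ) :
    ENNReal.ofReal (sliceVolume K i s) = volume (coordSlice K i s) :=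
  ENNReal.ofReal_toReal (hK.coordSlice i s).measure_lt_top.ne

theorem sliceVolume_nonneg (s : ℝ) : 0 ≤ sliceVolume K i s := measureReal_nonneg

theorem measurable_sliceVolume (hK : IsCompact K) : Measurable (sliceVolume K i) :=
  (measurable_volume_coordSlice i hK.measurableSet).ennreal_toReal

theorem setLIntegral_sliceVolume (hK : IsCompact K) {S : Set ℝ} (hS : MeasurableSet S) :
    ∫⁻ s in S, ENNReal.ofReal (sliceVolume K i s) = volume (K ∩ {x | x i ∈ S}) := by
  simp_rw [ofReal_sliceVolume i hK]
  exact setLIntegral_volume_coordSlice i hK.measurableSet hS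

theorem lintegral_sliceVolume (hK : IsCompact K) :
    ∫⁻ s, ENNReal.ofReal (sliceVolume K i s) = volume K := by
  simp_rw [ofReal_sliceVolume i hK]
  exact lintegral_volume_coordSlice i hK.measurableSet

theorem integrable_sliceVolume (hK : IsCompact K) : Integrable (sliceVolume K i) := by
  rw [← lintegral_ofReal_ne_top_iff_integrable
    (measurable_sliceVolume i hK).aestronglyMeasurable
    (Filter.Eventually.of_forall (sliceVolume_nonneg i)), lintegral_sliceVolume i hK]
  exact hK.measure_lt_top.ne

theorem setIntegral_sliceVolume (hK : IsCompact K) {S : Set ℝ} (hS : MeasurableSet S) :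
    ∫ s in S, sliceVolume K i s = volume.real (K ∩ {x | x i ∈ S}) := by
  rw [integral_eq_lintegral_of_nonneg_ae (Filter.Eventually.of_forall (sliceVolume_nonneg i))
    (measurable_sliceVolume i hK).aestronglyMeasurable, setLIntegral_sliceVolume i hK hS]
  rfl

theorem integral_sliceVolume (hK : IsCompact K) :
    ∫ s, sliceVolume K i s = volume.real K := by
  simpa using setIntegral_sliceVolume i hK MeasurableSet.univ

theorem bddAbove_range_sliceVolume (hK : IsCompact K) :
    BddAbove (Set.range (sliceVolume K i)) := by
  refine ⟨volume.real ((fun x => i.removeNth x) '' K : Set (Fin m → ℝ)), ?_⟩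
  rintro _ ⟨s, rfl⟩
  exact measureReal_mono (coordSlice_subset i s) (isCompact_removeNth_image i hK).measure_lt_top.ne

end coordSlice

/-- A function satisfying the log-concavity inequality has convex superlevel sets. -/
theorem ordConnected_lt_of_rpow_mul_rpow_le {f : ℝ → ℝ} (hf0 : ∀ x, 0 ≤ f x)
    (hlc : ∀ x y t : ℝ, 0 < t → t < 1 → f x ^ (1 - t) * f y ^ t ≤ f ((1 - t) * x + t * y))
    (r : ℝ) : {x | r < f x}.OrdConnected := by
  rw [Set.ordConnected_iff]
  intro x hx y hy hxy z hz
  rcases hz.1.eq_or_lt with rfl | hxz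
  · exact hx
  rcases hz.2.eq_or_lt with rfl | hzy
  · exact hy
  have hpos : 0 < y - x := by linarith
  set t := (z - x) / (y - x) with ht
  have ht0 : 0 < t := div_pos (by linarith) hpos
  have ht1 : t < 1 := by rw [ht, div_lt_one hpos]; linarith
  have hz' : z = (1 - t) * x + t * y := by rw [ht]; field_simp; ring
  rcases lt_or_ge r 0 with hr | hr
  · exact hr.trans_le (hf0 z)
  have h := hlc x y t ht0 ht1
  rw [← hz'] at h
  refine lt_of_lt_of_le ?_ h
  have hmin : r < min (f x) (f y) := lt_min hx hy
  set μ := min (f x) (f y)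
  have hμ : 0 < μ := hr.trans_lt hmin
  calc r < μ := hmin
    _ = μ ^ (1 - t) * μ ^ t := by rw [← Real.rpow_add hμ]; simp
    _ ≤ f x ^ (1 - t) * f y ^ t := by
      exact mul_le_mul (Real.rpow_le_rpow hμ.le (min_le_left _ _) (by linarith))
        (Real.rpow_le_rpow hμ.le (min_le_right _ _) ht0.le) (by positivity)
        (Real.rpow_nonneg (hf0 x) _)

/-- The Brunn–Minkowski inequality, in multiplicative form, for compact convex sets. -/
theorem rpow_volume_mul_rpow_volume_le {m : ℕ} {X Y Z : Set (Fin m → ℝ)} (hX : IsCompact X)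
    (hY : IsCompact Y) (hZ : IsCompact Z) (hXc : Convex ℝ X) (hYc : Convex ℝ Y) (hZc : Convex ℝ Z)
    {t : ℝ} (ht0 : 0 < t) (ht1 : t < 1) (h : ∀ x ∈ X, ∀ y ∈ Y, (1 - t) • x + t • y ∈ Z) :
    volume.real X ^ (1 - t) * volume.real Y ^ t ≤ volume.real Z := by
  induction m generalizing t with
  | zero =>
    have h1t : 0 < 1 - t := by linarith
    rcases X.eq_empty_or_nonempty with rfl | ⟨x, hx⟩
    · simp [Real.zero_rpow h1t.ne']
    rcases Y.eq_empty_or_nonempty with rfl | ⟨y, hy⟩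
    · simp [Real.zero_rpow ht0.ne']
    have e : ∀ (S : Set (Fin 0 → ℝ)) x, x ∈ S → volume.real S = 1 := by
      intro S x hx
      have : S = Set.univ := Set.eq_univ_of_forall fun y => Subsingleton.elim x y ▸ hx
      rw [this, measureReal_def, Measure.volume_pi_eq_dirac]
      simp
    rw [e X x hx, e Y y hy, e Z _ (h x hx y hy)]
    simp
  | succ m ih =>
    have hlc : ∀ {W : Set (Fin (m + 1) → ℝ)}, IsCompact W → Convex ℝ W → ∀ x y t : ℝ, 0 < t →
        t < 1 → sliceVolume W 0 x ^ (1 - t) * sliceVolume W 0 y ^ t ≤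
          sliceVolume W 0 ((1 - t) * x + t * y) := by
      intro W hW hWc x y t ht0 ht1
      exact ih (hW.coordSlice 0 x) (hW.coordSlice 0 y) (hW.coordSlice 0 _) (hWc.coordSlice 0 x)
        (hWc.coordSlice 0 y) (hWc.coordSlice 0 _) ht0 ht1
        (fun p hp q hq => hWc.combo_mem_coordSlice 0 ht0.le ht1.le hp hq)
    have := integral_rpow_mul_integral_rpow_le (sliceVolume_nonneg (K := X) 0)
      (sliceVolume_nonneg (K := Y) 0) (sliceVolume_nonneg (K := Z) 0)
      (measurable_sliceVolume 0 hX) (measurable_sliceVolume 0 hY) (measurable_sliceVolume 0 hZ)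
      (integrable_sliceVolume 0 hX) (integrable_sliceVolume 0 hY) (integrable_sliceVolume 0 hZ)
      (bddAbove_range_sliceVolume 0 hX) (bddAbove_range_sliceVolume 0 hY)
      (ordConnected_lt_of_rpow_mul_rpow_le (sliceVolume_nonneg 0) (hlc hX hXc))
      (ordConnected_lt_of_rpow_mul_rpow_le (sliceVolume_nonneg 0) (hlc hY hYc)) ht0 ht1
      (fun x y => ih (hX.coordSlice 0 x) (hY.coordSlice 0 y) (hZ.coordSlice 0 _)
        (hXc.coordSlice 0 x) (hYc.coordSlice 0 y) (hZc.coordSlice 0 _) ht0 ht1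
        (fun p hp q hq => by
          have := h _ hp _ hq
          rwa [insertNth_combo] at this))
    rwa [integral_sliceVolume 0 hX, integral_sliceVolume 0 hY, integral_sliceVolume 0 hZ] at this

theorem sliceVolume_rpow_mul_rpow_le {m : ℕ} {K : Set (Fin (m + 1) → ℝ)} (i : Fin (m + 1))
    (hK : IsCompact K) (hKc : Convex ℝ K) (x y t : ℝ) (ht0 : 0 < t) (ht1 : t < 1) :
    sliceVolume K i x ^ (1 - t) * sliceVolume K i y ^ t ≤
      sliceVolume K i ((1 - t) * x + t * y) :=
  rpow_volume_mul_rpow_volume_le (hK.coordSlice i x) (hK.coordSlice i y) (hK.coordSlice i _)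
    (hKc.coordSlice i x) (hKc.coordSlice i y) (hKc.coordSlice i _) ht0 ht1
    fun _ hp _ hq => hKc.combo_mem_coordSlice i ht0.le ht1.le hp hq

theorem upperSemicontinuous_sliceVolume {m : ℕ} {K : Set (Fin (m + 1) → ℝ)} (i : Fin (m + 1))
    (hK : IsCompact K) : UpperSemicontinuous (sliceVolume K i) := by
  intro s y hy
  have hlt : volume (coordSlice K i s) < ENNReal.ofReal y := by
    rw [← ofReal_sliceVolume i hK]
    exact (ENNReal.ofReal_lt_ofReal_iff (lt_of_le_of_lt (sliceVolume_nonneg i s) hy)).mpr hy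
  obtain ⟨U, hU, hUo, hUv⟩ := Set.exists_isOpen_lt_of_lt _ _ hlt
  have hrc : Continuous fun x : Fin (m + 1) → ℝ => i.removeNth x := by
    unfold Fin.removeNth; fun_prop
  have hC : IsCompact (K ∩ {x | i.removeNth x ∉ U}) :=
    hK.inter_right ((hUo.preimage hrc).isClosed_compl)
  have hC' : IsClosed ((fun x : Fin (m + 1) → ℝ => x i) '' (K ∩ {x | i.removeNth x ∉ U})) :=
    (hC.image (continuous_apply i)).isClosed
  have hs : s ∉ (fun x : Fin (m + 1) → ℝ => x i) '' (K ∩ {x | i.removeNth x ∉ U}) := by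
    rintro ⟨x, ⟨hxK, hxU⟩, rfl⟩
    apply hxU
    apply hU
    simpa [coordSlice] using hxK
  filter_upwards [hC'.isOpen_compl.mem_nhds hs] with s' hs'
  have hsub : coordSlice K i s' ⊆ U := by
    intro z hz
    by_contra hzU
    apply hs'
    exact ⟨_, ⟨hz, by simpa using hzU⟩, by simp⟩
  have h1 : ENNReal.ofReal (sliceVolume K i s') < ENNReal.ofReal y := by
    rw [ofReal_sliceVolume i hK]
    exact (measure_mono hsub).trans_lt hUv
  exact (ENNReal.ofReal_lt_ofReal_iff (lt_of_le_of_lt (sliceVolume_nonneg i s) hy)).mp h1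

theorem exists_monotoneOn_antitoneOn_sliceVolume {m : ℕ} {K : Set (Fin (m + 1) → ℝ)}
    (i : Fin (m + 1)) (hK : IsCompact K) (hKc : Convex ℝ K) (hne : K.Nonempty) :
    ∃ c, MonotoneOn (sliceVolume K i) (Set.Iic c) ∧ AntitoneOn (sliceVolume K i) (Set.Ici c) := by
  obtain ⟨c, -, hc⟩ := ((upperSemicontinuous_sliceVolume i hK).upperSemicontinuousOn
    _).exists_isMaxOn (hne.image fun x => x i) (hK.image (continuous_apply i))
  have hmax : ∀ x, sliceVolume K i x ≤ sliceVolume K i c := by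
    intro x
    by_cases hx : x ∈ (fun x => x i) '' K
    · exact hc hx
    · have : coordSlice K i x = ∅ := by
        rw [Set.eq_empty_iff_forall_notMem]
        intro z hz
        exact hx ⟨_, hz, by simp⟩
      rw [sliceVolume, this]
      simp [sliceVolume_nonneg]
  have hq := ordConnected_lt_of_rpow_mul_rpow_le (sliceVolume_nonneg i)
    (sliceVolume_rpow_mul_rpow_le i hK hKc)
  refine ⟨c, fun x hx y hy hxy => ?_, fun x hx y hy hxy => ?_⟩
  · by_contra! hlt
    have := (hq (sliceVolume K i y)).out hlt (hlt.trans_le (hmax x)) ⟨hxy, hy⟩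
    exact lt_irrefl (sliceVolume K i y) this
  · by_contra! hlt
    have := (hq (sliceVolume K i x)).out (hlt.trans_le (hmax y)) hlt ⟨hx, hxy⟩
    exact lt_irrefl (sliceVolume K i x) this

open Polynomial in
/-- The dilation inequality for sets controlled by a univariate polynomial in one coordinate. -/
theorem mul_volume_le_of_coordinate_polynomial {m : ℕ} {K A B : Set (Fin (m + 1) → ℝ)}
    (i : Fin (m + 1)) (hK : IsCompact K) (hKc : Convex ℝ K) (hKpos : 0 < volume.real K)
    {p : ℝ[X]} {d : ℕ} (hd : d ≠ 0) (hp : p.natDegree ≤ d) {ε N l : ℝ} (hε : 0 < ε) (hl : 0 < l)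
    (hεN : ε < N) (hlN : (4 * l) ^ d * ε ≤ N)
    (hA : ∀ x ∈ K ∩ A, N ≤ |p.eval (x i)|) (hB : ∀ x ∈ K ∩ B, |p.eval (x i)| < ε)
    (hmass : Real.exp (-1) * volume.real K ≤ volume.real (K ∩ A)) :
    l * volume.real (K ∩ B) ≤ volume.real K := by
  have hne : K.Nonempty := by
    rw [Set.nonempty_iff_ne_empty]
    rintro rfl
    simp at hKpos
  obtain ⟨c, hmono, hanti⟩ := exists_monotoneOn_antitoneOn_sliceVolume i hK hKc hne
  set J : Set ℝ := (fun x => x i) '' K with hJ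
  have hJc : IsCompact J := hK.image (continuous_apply i)
  set A' : Set ℝ := J ∩ {s | N ≤ |p.eval s|} with hA'
  set B' : Set ℝ := J ∩ {s | |p.eval s| < ε} with hB'
  have hpc : Continuous fun s => |p.eval s| := by fun_prop
  have hA'c : IsClosed A' := hJc.isClosed.inter (isClosed_le continuous_const hpc)
  have hB'm : MeasurableSet B' :=
    hJc.measurableSet.inter (measurableSet_lt hpc.measurable measurable_const)
  obtain ⟨ρ, hρ, hρs⟩ := Metric.uniformContinuousOn_iff.mp
    (hJc.uniformContinuousOn_of_continuous hpc.continuousOn) (N - ε) (by linarith)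
  have hfin : ∀ S, volume (K ∩ S) ≠ ⊤ := fun S =>
    ne_top_of_le_ne_top hK.measure_lt_top.ne (measure_mono Set.inter_subset_left)
  have key := mul_setLIntegral_le_of_mass (f := sliceVolume K i) (A := A') (B := B') (l := l)
    (ρ := ρ)
    (sliceVolume_nonneg i) (sliceVolume_rpow_mul_rpow_le i hK hKc) (measurable_sliceVolume i hK)
    (integrable_sliceVolume i hK) hmono hanti hA'c hρ
    (fun a ha b hb => by
      by_contra! hlt
      have h1 := hρs a ha.1 b hb.1 hlt
      have h2 : N ≤ |p.eval a| := ha.2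
      have h3 : |p.eval b| < ε := hb.2
      rw [Real.dist_eq] at h1
      have := le_abs_self (|p.eval a| - |p.eval b|)
      linarith)
    (fun x hx y hyx => le_trans (by gcongr; exact Set.inter_subset_right)
      (volume_sublevel_inter_Icc_le hd hp hε hl hyx (hlN.trans hx.2)))
    (fun x hx y hyx => le_trans (by gcongr; exact Set.inter_subset_right)
      (volume_sublevel_inter_Icc_le' hd hp hε hl hyx (hlN.trans hx.2)))
    (by rwa [integral_sliceVolume i hK])
    (by
      rw [integral_sliceVolume i hK, setIntegral_sliceVolume i hK hA'c.measurableSet]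
      refine hmass.trans (measureReal_mono (fun x hx => ?_) (hfin _))
      exact ⟨hx.1, ⟨x, hx.1, rfl⟩, hA x hx⟩)
  rw [lintegral_sliceVolume i hK, setLIntegral_sliceVolume i hK hB'm] at key
  have h2 : ENNReal.ofReal l * volume (K ∩ B) ≤ volume K := by
    have hsub : K ∩ B ⊆ K ∩ {x | x i ∈ B'} := fun x hx => ⟨hx.1, ⟨x, hx.1, rfl⟩, hB x hx⟩
    exact le_trans (mul_le_mul' le_rfl (measure_mono hsub)) key
  have h3 := ENNReal.toReal_mono hK.measure_lt_top.ne h2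
  rwa [ENNReal.toReal_mul, ENNReal.toReal_ofReal hl.le] at h3

section Bisection

variable {n : ℕ}

/-- The affine function vanishing on the hyperplane with unit normal `(cos θ, sin θ)` in the
coordinates `i, j`, passing through the points with these coordinates equal to `q₁, q₂`. -/
noncomputable def rotatingForm (i j : Fin n) (q₁ q₂ θ : ℝ) (x : Fin n → ℝ) : ℝ :=
  Real.cos θ * (x i - q₁) + Real.sin θ * (x j - q₂)

variable {i j : Fin n} {q₁ q₂ : ℝ}

theorem rotatingForm_add_pi (θ : ℝ) (x : Fin n → ℝ) :
    rotatingForm i j q₁ q₂ (θ + Real.pi) x = -rotatingForm i j q₁ q₂ θ x := by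
  simp [rotatingForm]; ring

theorem continuous_rotatingForm (θ : ℝ) : Continuous (rotatingForm i j q₁ q₂ θ) := by
  unfold rotatingForm; fun_prop

theorem continuous_rotatingForm_angle (x : Fin n → ℝ) :
    Continuous fun θ => rotatingForm i j q₁ q₂ θ x := by
  unfold rotatingForm; fun_prop

theorem volume_rotatingForm_eq_zero (hij : i ≠ j) (θ : ℝ) :
    volume {x : Fin n → ℝ | rotatingForm i j q₁ q₂ θ x = 0} = 0 := by
  let L : (Fin n → ℝ) →ₗ[ℝ] ℝ :=
    Real.cos θ • LinearMap.proj i + Real.sin θ • LinearMap.proj j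
  have hL : LinearMap.ker L ≠ ⊤ := by
    intro h
    have h1 : ∀ x, L x = 0 := fun x => by
      have : x ∈ LinearMap.ker L := h ▸ Submodule.mem_top
      exact this
    have h2 := h1 (Pi.single i 1)
    have h3 := h1 (Pi.single j 1)
    simp [L, hij, hij.symm] at h2 h3
    have := Real.sin_sq_add_cos_sq θ
    rw [h2, h3] at this
    norm_num at this
  have h0 := Measure.addHaar_submodule (volume : Measure (Fin n → ℝ)) _ hL
  rw [← measure_preimage_add_right volume (fun k => if k = i then -q₁ else -q₂)] at h0
  convert h0 using 2
  ext x
  simp [rotatingForm, L, hij.symm, sub_eq_add_neg]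

theorem ae_rotatingForm_ne_zero (hij : i ≠ j) (q₁ q₂ θ : ℝ) :
    ∀ᵐ x : Fin n → ℝ, rotatingForm i j q₁ q₂ θ x ≠ 0 := by
  rw [ae_iff]
  simpa only [ne_eq, not_not] using volume_rotatingForm_eq_zero hij θ

theorem isClosed_rotatingForm_nonpos (θ : ℝ) :
    IsClosed {x : Fin n → ℝ | rotatingForm i j q₁ q₂ θ x ≤ 0} :=
  isClosed_le (continuous_rotatingForm θ) continuous_const

theorem convex_rotatingForm_nonpos (θ : ℝ) :
    Convex ℝ {x : Fin n → ℝ | rotatingForm i j q₁ q₂ θ x ≤ 0} := by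
  intro x hx y hy a b ha hb hab
  have hx : rotatingForm i j q₁ q₂ θ x ≤ 0 := hx
  have hy : rotatingForm i j q₁ q₂ θ y ≤ 0 := hy
  have e : rotatingForm i j q₁ q₂ θ (a • x + b • y) =
      a * rotatingForm i j q₁ q₂ θ x + b * rotatingForm i j q₁ q₂ θ y := by
    simp only [rotatingForm, Pi.add_apply, Pi.smul_apply, smul_eq_mul]
    linear_combination (Real.cos θ * q₁ + Real.sin θ * q₂) * hab
  change rotatingForm i j q₁ q₂ θ (a • x + b • y) ≤ 0
  rw [e]
  nlinarith

theorem continuous_volume_inter_rotatingForm_nonpos (hij : i ≠ j) {S : Set (Fin n → ℝ)}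
    (hS : MeasurableSet S) (hSf : volume S ≠ ⊤) :
    Continuous fun θ => volume.real (S ∩ {x | rotatingForm i j q₁ q₂ θ x ≤ 0}) := by
  rw [continuous_iff_continuousAt]
  intro θ₀
  have hm : ∀ θ, MeasurableSet (S ∩ {x | rotatingForm i j q₁ q₂ θ x ≤ 0}) := fun θ =>
    hS.inter (isClosed_rotatingForm_nonpos θ).measurableSet
  simp_rw [← fun θ => integral_indicator_one (μ := volume) (hm θ)]
  apply continuousAt_of_dominated (bound := S.indicator 1)
  · exact Filter.Eventually.of_forall fun θ =>
      ((measurable_one.indicator (hm θ)).aestronglyMeasurable)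
  · refine Filter.Eventually.of_forall fun θ => Filter.Eventually.of_forall fun x => ?_
    by_cases hx : x ∈ S ∩ {x | rotatingForm i j q₁ q₂ θ x ≤ 0}
    · rw [Set.indicator_of_mem hx, Set.indicator_of_mem hx.1]; simp
    · rw [Set.indicator_of_notMem hx]
      simp only [norm_zero]
      exact Set.indicator_nonneg (fun _ _ => zero_le_one) x
  · exact (integrable_indicator_iff hS).mpr (integrableOn_const (C := (1 : ℝ)) hSf)
  · filter_upwards [ae_rotatingForm_ne_zero hij q₁ q₂ θ₀] with x hx
    have hc := (continuous_rotatingForm_angle (i := i) (j := j) (q₁ := q₁) (q₂ := q₂)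
      x).continuousAt (x := θ₀)
    by_cases hxS : x ∈ S
    · rcases lt_or_gt_of_ne hx with h | h
      · refine (continuousAt_const (y := (1 : ℝ))).congr ?_
        filter_upwards [hc.eventually_lt continuousAt_const h] with θ hθ
        rw [Set.indicator_of_mem (show x ∈ S ∩ {x | rotatingForm i j q₁ q₂ θ x ≤ 0} from
          ⟨hxS, hθ.le⟩)]
        rfl
      · refine (continuousAt_const (y := (0 : ℝ))).congr ?_
        filter_upwards [continuousAt_const.eventually_lt hc h] with θ hθ
        exact (Set.indicator_of_notMem (fun hx' => not_lt.mpr hx'.2 hθ) _).symm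
    · refine (continuousAt_const (y := (0 : ℝ))).congr (Filter.Eventually.of_forall fun θ => ?_)
      exact (Set.indicator_of_notMem (fun hx' => hxS hx'.1) _).symm

theorem volume_inter_rotatingForm_add (hij : i ≠ j) {S : Set (Fin n → ℝ)} (hSf : volume S ≠ ⊤)
    (θ : ℝ) :
    volume.real (S ∩ {x | rotatingForm i j q₁ q₂ θ x ≤ 0}) +
      volume.real (S ∩ {x | rotatingForm i j q₁ q₂ (θ + Real.pi) x ≤ 0}) = volume.real S := by
  rw [← measureReal_inter_add_sdiff (s := S)
    (isClosed_rotatingForm_nonpos (i := i) (j := j) (q₁ := q₁) (q₂ := q₂) θ).measurableSet hSf]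
  congr 1
  apply measureReal_congr
  filter_upwards [ae_rotatingForm_ne_zero hij q₁ q₂ θ] with x hx
  apply propext
  change (x ∈ S ∧ rotatingForm i j q₁ q₂ (θ + Real.pi) x ≤ 0) ↔
    (x ∈ S ∧ ¬ rotatingForm i j q₁ q₂ θ x ≤ 0)
  rw [rotatingForm_add_pi, not_le, neg_nonpos, le_iff_lt_or_eq]
  simp [hx.symm]

/-- A convex body in which `B` has relative volume exactly `b` and `A` at least `a`. -/
structure IsBalanced (A B : Set (Fin n → ℝ)) (a b : ℝ) (K : Set (Fin n → ℝ)) : Prop where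
  isCompact : IsCompact K
  convex : Convex ℝ K
  volume_pos : 0 < volume.real K
  volume_inter_eq : volume.real (K ∩ B) = b * volume.real K
  le_volume_inter : a * volume.real K ≤ volume.real (K ∩ A)

theorem IsBalanced.exists_subset_halfspace {A B K : Set (Fin n → ℝ)} {a b : ℝ}
    (hK : IsBalanced A B a b K) (hB : MeasurableSet B) (hij : i ≠ j)
    (q₁ q₂ : ℝ) :
    ∃ K' ⊆ K, IsBalanced A B a b K' ∧ ∃ θ, ∀ x ∈ K', rotatingForm i j q₁ q₂ θ x ≤ 0 := by
  have hKm := hK.isCompact.measurableSet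
  have hKf : volume K ≠ ⊤ := hK.isCompact.measure_lt_top.ne
  have hf : ∀ S, volume (K ∩ S) ≠ ⊤ := fun S =>
    ne_top_of_le_ne_top hKf (measure_mono Set.inter_subset_left)
  set H : ℝ → Set (Fin n → ℝ) := fun θ => {x | rotatingForm i j q₁ q₂ θ x ≤ 0} with hH
  have sK := fun θ => volume_inter_rotatingForm_add (q₁ := q₁) (q₂ := q₂) hij hKf θ
  have sA := fun θ => volume_inter_rotatingForm_add (q₁ := q₁) (q₂ := q₂) hij (hf A) θ
  have sB := fun θ => volume_inter_rotatingForm_add (q₁ := q₁) (q₂ := q₂) hij (hf B) θ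
  change ∀ θ, volume.real (K ∩ H θ) + volume.real (K ∩ H (θ + Real.pi)) = _ at sK
  change ∀ θ, volume.real (K ∩ A ∩ H θ) + volume.real (K ∩ A ∩ H (θ + Real.pi)) = _ at sA
  change ∀ θ, volume.real (K ∩ B ∩ H θ) + volume.real (K ∩ B ∩ H (θ + Real.pi)) = _ at sB
  set φ : ℝ → ℝ := fun θ => volume.real (K ∩ B ∩ H θ) - b * volume.real (K ∩ H θ) with hφ
  have hφc : Continuous φ :=
    (continuous_volume_inter_rotatingForm_nonpos hij (hKm.inter hB) (hf B)).sub
      ((continuous_volume_inter_rotatingForm_nonpos hij hKm hKf).const_mul b)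
  have hanti : ∀ θ, φ (θ + Real.pi) = -φ θ := by
    intro θ
    have h1 := sK θ
    have h2 := sB θ
    rw [hK.volume_inter_eq, ← h1] at h2
    simp only [hφ]
    linarith
  obtain ⟨θ, hθ⟩ : ∃ θ, φ θ = 0 := by
    have h1 := hanti 0
    rcases le_total (φ 0) 0 with h | h
    · exact mem_range_of_exists_le_of_exists_ge hφc ⟨_, h⟩ ⟨0 + Real.pi, by linarith⟩
    · exact mem_range_of_exists_le_of_exists_ge hφc ⟨0 + Real.pi, by linarith⟩ ⟨_, h⟩
  have hθ' : φ (θ + Real.pi) = 0 := by rw [hanti, hθ, neg_zero]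
  have good : ∀ θ, φ θ = 0 → 0 < volume.real (K ∩ H θ) →
      a * volume.real (K ∩ H θ) ≤ volume.real (K ∩ A ∩ H θ) →
      ∃ K' ⊆ K, IsBalanced A B a b K' ∧ ∃ θ, ∀ x ∈ K', rotatingForm i j q₁ q₂ θ x ≤ 0 := by
    intro θ h0 h1 h2
    refine ⟨K ∩ H θ, Set.inter_subset_left,
      ⟨hK.isCompact.inter_right (isClosed_rotatingForm_nonpos θ),
      hK.convex.inter (convex_rotatingForm_nonpos θ), h1, ?_, ?_⟩, θ, fun x hx => hx.2⟩
    · rw [Set.inter_right_comm]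
      simp only [hφ] at h0
      linarith
    · rw [Set.inter_right_comm]
      exact h2
  have sKθ := sK θ
  have sAθ := sA θ
  have hmass := hK.le_volume_inter
  have hmono : ∀ θ, volume.real (K ∩ A ∩ H θ) ≤ volume.real (K ∩ H θ) := fun θ =>
    measureReal_mono (Set.inter_subset_inter_left _ Set.inter_subset_left) (hf _)
  have hKpos := hK.volume_pos
  have hA0 : ∀ θ, 0 ≤ volume.real (K ∩ A ∩ H θ) := fun _ => measureReal_nonneg
  rcases (measureReal_nonneg (μ := volume) (s := K ∩ H θ)).eq_or_lt with h0 | h0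
  · have := hmono θ
    have h2 := hA0 θ
    refine good _ hθ' (by linarith) ?_
    have h3 : volume.real (K ∩ H (θ + Real.pi)) = volume.real K := by linarith
    rw [h3]
    linarith
  rcases (measureReal_nonneg (μ := volume) (s := K ∩ H (θ + Real.pi))).eq_or_lt with h1 | h1
  · have := hmono (θ + Real.pi)
    have h2 := hA0 (θ + Real.pi)
    refine good _ hθ h0 ?_
    have h3 : volume.real (K ∩ H θ) = volume.real K := by linarith
    rw [h3]
    linarith
  by_cases h2 : a * volume.real (K ∩ H θ) ≤ volume.real (K ∩ A ∩ H θ)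
  · exact good _ hθ h0 h2
  · refine good _ hθ' h1 ?_
    rw [← sKθ, mul_add] at hmass
    linarith

end Bisection

/-- A nondegenerate planar triangle contains a rational point in its interior. -/
theorem exists_rat_mem_triangle {p₁ p₂ r₁ r₂ x₁ x₂ : ℝ}
    (hD : (r₁ - p₁) * (x₂ - p₂) - (r₂ - p₂) * (x₁ - p₁) ≠ 0) :
    ∃ q₁ q₂ : ℚ, ∃ u v w : ℝ, 0 < u ∧ 0 < v ∧ 0 < w ∧
      u * (p₁ - q₁) + v * (r₁ - q₁) + w * (x₁ - q₁) = 0 ∧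
      u * (p₂ - q₂) + v * (r₂ - q₂) + w * (x₂ - q₂) = 0 := by
  set D := (r₁ - p₁) * (x₂ - p₂) - (r₂ - p₂) * (x₁ - p₁) with hDdef
  let v : ℝ × ℝ → ℝ := fun y => ((y.1 - p₁) * (x₂ - p₂) - (y.2 - p₂) * (x₁ - p₁)) / D
  let w : ℝ × ℝ → ℝ := fun y => ((r₁ - p₁) * (y.2 - p₂) - (r₂ - p₂) * (y.1 - p₁)) / D
  have hv : Continuous v := by fun_prop
  have hw : Continuous w := by fun_prop
  have ho : IsOpen {y | 0 < v y ∧ 0 < w y ∧ 0 < 1 - v y - w y} :=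
    (isOpen_lt continuous_const hv).inter ((isOpen_lt continuous_const hw).inter
      (isOpen_lt continuous_const ((continuous_const.sub hv).sub hw)))
  have hcen : ((p₁ + r₁ + x₁) / 3, (p₂ + r₂ + x₂) / 3) ∈
      {y | 0 < v y ∧ 0 < w y ∧ 0 < 1 - v y - w y} := by
    have e1 : v ((p₁ + r₁ + x₁) / 3, (p₂ + r₂ + x₂) / 3) = 1 / 3 := by
      simp only [v]
      rw [div_eq_iff hD, hDdef]
      ring
    have e2 : w ((p₁ + r₁ + x₁) / 3, (p₂ + r₂ + x₂) / 3) = 1 / 3 := by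
      simp only [w]
      rw [div_eq_iff hD, hDdef]
      ring
    simp only [Set.mem_ofPred_eq, e1, e2]
    norm_num
  obtain ⟨⟨q₁, q₂⟩, h1, h2, h3⟩ := ((Rat.denseRange_cast (𝕜 := ℝ)).prodMap
    (Rat.denseRange_cast (𝕜 := ℝ))).exists_mem_open ho ⟨_, hcen⟩
  refine ⟨q₁, q₂, _, _, _, h3, h1, h2, ?_, ?_⟩
  · simp only [v, w, Prod.map]
    field_simp
    rw [hDdef]
    ring
  · simp only [v, w, Prod.map]
    field_simp
    rw [hDdef]
    ring

/-- If every rational point of every coordinate plane lies on a line bounding the projection of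
`L`, then `L` is contained in a line. -/
theorem exists_line_of_forall_rotatingForm_nonpos {m : ℕ} {L : Set (Fin (m + 1) → ℝ)}
    (hL : ∀ i j : Fin (m + 1), i ≠ j → ∀ q₁ q₂ : ℚ,
      ∃ θ, ∀ x ∈ L, rotatingForm i j q₁ q₂ θ x ≤ 0) :
    ∃ (i : Fin (m + 1)) (p e : Fin (m + 1) → ℝ),
      ∀ x ∈ L, ∀ j, x j = p j + (x i - p i) * e j := by
  rcases L.subsingleton_or_nontrivial with hs | ⟨p, hp, r, hr, hpr⟩
  · rcases L.eq_empty_or_nonempty with rfl | ⟨p, hp⟩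
    · exact ⟨0, 0, 0, by simp⟩
    · refine ⟨0, p, 0, fun x hx j => ?_⟩
      rw [hs hx hp]
      simp
  obtain ⟨i, hi⟩ : ∃ i, p i ≠ r i := by
    by_contra! h
    exact hpr (funext h)
  have hi' : r i - p i ≠ 0 := sub_ne_zero.mpr hi.symm
  refine ⟨i, p, fun j => (r j - p j) / (r i - p i), fun x hx j => ?_⟩
  have hD : (r i - p i) * (x j - p j) - (r j - p j) * (x i - p i) = 0 := by
    by_cases hij : i = j
    · subst hij; ring
    by_contra hD
    obtain ⟨q₁, q₂, u, v, w, hu, hv, hw, h1, h2⟩ := exists_rat_mem_triangle hD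
    obtain ⟨θ, hθ⟩ := hL i j hij q₁ q₂
    have a1 := hθ p hp
    have a2 := hθ r hr
    have a3 := hθ x hx
    have hsum : u * rotatingForm i j q₁ q₂ θ p + v * rotatingForm i j q₁ q₂ θ r +
        w * rotatingForm i j q₁ q₂ θ x = 0 := by
      simp only [rotatingForm]
      linear_combination Real.cos θ * h1 + Real.sin θ * h2
    have b1 : rotatingForm i j q₁ q₂ θ p = 0 := by nlinarith
    have b2 : rotatingForm i j q₁ q₂ θ r = 0 := by nlinarith
    have b3 : rotatingForm i j q₁ q₂ θ x = 0 := by nlinarith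
    simp only [rotatingForm] at b1 b2 b3
    have c1 : Real.cos θ * (r i - p i) + Real.sin θ * (r j - p j) = 0 := by linarith
    have c2 : Real.cos θ * (x i - p i) + Real.sin θ * (x j - p j) = 0 := by linarith
    have d1 : Real.cos θ = 0 := by
      refine (mul_eq_zero.mp ?_).resolve_right hD
      linear_combination (x j - p j) * c1 - (r j - p j) * c2
    have d2 : Real.sin θ = 0 := by
      refine (mul_eq_zero.mp ?_).resolve_right hD
      linear_combination (r i - p i) * c2 - (x i - p i) * c1
    have := Real.sin_sq_add_cos_sq θ
    rw [d1, d2] at this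
    norm_num at this
  field_simp
  linarith

/-- Balanced convex bodies localise to arbitrarily thin balanced bodies around a line. -/
theorem IsBalanced.exists_line {m : ℕ} {A B K : Set (Fin (m + 1) → ℝ)} {a b : ℝ}
    (hK : IsBalanced A B a b K) (hB : MeasurableSet B) :
    ∃ (i : Fin (m + 1)) (p e : Fin (m + 1) → ℝ), ∀ U : Set (Fin (m + 1) → ℝ), IsOpen U →
      {x | ∀ j, x j = p j + (x i - p i) * e j} ⊆ U → ∃ K' ⊆ U, IsBalanced A B a b K' := by
  let ι := Fin (m + 1) × Fin (m + 1) × ℚ × ℚ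
  obtain ⟨f, hf⟩ := exists_surjective_nat ι
  have step : ∀ (c : ι) (S : {S // IsBalanced A B a b S}), ∃ T : {S // IsBalanced A B a b S},
      T.1 ⊆ S.1 ∧ (c.1 ≠ c.2.1 →
        ∃ θ, ∀ x ∈ T.1, rotatingForm c.1 c.2.1 c.2.2.1 c.2.2.2 θ x ≤ 0) := by
    rintro ⟨i, j, q₁, q₂⟩ ⟨S, hS⟩
    by_cases hij : i = j
    · exact ⟨⟨S, hS⟩, subset_rfl, fun h => absurd hij h⟩
    · obtain ⟨T, hTS, hT, hθ⟩ := hS.exists_subset_halfspace hB hij q₁ q₂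
      exact ⟨⟨T, hT⟩, hTS, fun _ => hθ⟩
  choose next hsub hform using step
  let V : ℕ → {S // IsBalanced A B a b S} := fun k =>
    Nat.rec ⟨K, hK⟩ (fun k S => next (f k) S) k
  have hV : Antitone fun k => (V k).1 := antitone_nat_of_succ_le fun k => hsub (f k) (V k)
  obtain ⟨i, p, e, hline⟩ := exists_line_of_forall_rotatingForm_nonpos (L := ⋂ k, (V k).1)
    (fun i j hij q₁ q₂ => by
      obtain ⟨k, hk⟩ := hf (i, j, q₁, q₂)
      have := hform (f k) (V k)
      rw [hk] at this
      obtain ⟨θ, hθ⟩ := this hij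
      refine ⟨θ, fun x hx => hθ x ?_⟩
      have h1 := Set.mem_iInter.mp hx (k + 1)
      have h2 : (V (k + 1)).1 = (next (f k) (V k)).1 := rfl
      rw [h2, hk] at h1
      exact h1)
  refine ⟨i, p, e, fun U hU hsU => ?_⟩
  obtain ⟨k, hk⟩ := exists_subset_nhds_of_isCompact (V := fun k => (V k).1)
    hV.directed_ge (fun k => (V k).2.isCompact)
    (fun x hx => hU.mem_nhds (hsU (hline x hx)))
  exact ⟨_, hk, (V k).2⟩

open Polynomial in
/-- The restriction of a polynomial of degree at most `d` to a parametrised line is a univariate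
polynomial of degree at most `d`. -/
theorem exists_polynomial_eval_line {σ : Type*} {d : ℕ} (P : MvPolynomial σ ℝ)
    (hP : P.totalDegree ≤ d) (u v : σ → ℝ) :
    ∃ q : ℝ[X], q.natDegree ≤ d ∧ ∀ s, q.eval s = MvPolynomial.eval (fun j => u j + s * v j) P := by
  refine ⟨MvPolynomial.aeval (fun j => C (u j) + X * C (v j)) P, ?_, fun s => ?_⟩
  · refine (MvPolynomial.aeval_natDegree_le P hP _ (n := 1) fun j => ?_).trans (by simp)
    compute_degree
  · rw [← Polynomial.coe_aeval_eq_eval, MvPolynomial.comp_aeval_apply,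
      ← MvPolynomial.aeval_eq_eval]
    simp only [map_add, map_mul, Polynomial.aeval_C, Polynomial.aeval_X, Algebra.algebraMap_self,
      RingHom.id_apply]

theorem IsBalanced.mul_le_one {m d : ℕ} (hd : d ≠ 0) {P : MvPolynomial (Fin (m + 1)) ℝ}
    (hP : P.totalDegree ≤ d) {K : Set (Fin (m + 1) → ℝ)} {M ε l b : ℝ} (hε : 0 < ε) (hl : 1 ≤ l)
    (hlM : (4 * l) ^ d * ε < M)
    (hK : IsBalanced {x | M ≤ |MvPolynomial.eval x P|} {x | |MvPolynomial.eval x P| < ε}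
      (Real.exp (-1)) b K) : l * b ≤ 1 := by
  have hPc : Continuous fun x : Fin (m + 1) → ℝ => MvPolynomial.eval x P :=
    MvPolynomial.continuous_eval P
  have hB : MeasurableSet {x : Fin (m + 1) → ℝ | |MvPolynomial.eval x P| < ε} :=
    (isOpen_lt hPc.abs continuous_const).measurableSet
  obtain ⟨i, p, e, hU⟩ := hK.exists_line hB
  obtain ⟨q, hqd, hq⟩ := exists_polynomial_eval_line P hP (fun j => p j - p i * e j) e
  set c := (4 * l) ^ d with hc
  have hc1 : 1 < c := one_lt_pow₀ (by linarith) hd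
  set δ := (M - c * ε) / (1 + c) with hδ
  have hδ0 : 0 < δ := div_pos (by linarith) (by linarith)
  have hδe : c * (ε + δ) = M - δ := by
    rw [hδ]; field_simp; ring
  obtain ⟨K', hK'U, hK'⟩ := hU {x | |MvPolynomial.eval x P - q.eval (x i)| < δ}
    (isOpen_lt (by fun_prop) continuous_const) (fun x hx => by
      have : q.eval (x i) = MvPolynomial.eval x P := by
        rw [hq]
        congr 2
        ext j
        rw [hx j]
        ring
      simpa [this] using hδ0)
  have hclose : ∀ x ∈ K', |MvPolynomial.eval x P - q.eval (x i)| < δ := fun x hx => hK'U hx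
  have h := mul_volume_le_of_coordinate_polynomial (A := {x | M ≤ |MvPolynomial.eval x P|})
    (B := {x | |MvPolynomial.eval x P| < ε}) i hK'.isCompact hK'.convex hK'.volume_pos hd
    hqd (ε := ε + δ) (N := M - δ) (l := l) (by linarith) (by linarith) (by nlinarith) hδe.le
    (fun x hx => by
      have h1 := hclose x hx.1
      have h2 : M ≤ |MvPolynomial.eval x P| := hx.2
      have := abs_sub_abs_le_abs_sub (MvPolynomial.eval x P) (q.eval (x i))
      linarith)
    (fun x hx => by
      have h1 := hclose x hx.1
      have h2 : |MvPolynomial.eval x P| < ε := hx.2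
      have := abs_sub_abs_le_abs_sub (q.eval (x i)) (MvPolynomial.eval x P)
      rw [abs_sub_comm] at this
      linarith)
    hK'.le_volume_inter
  rw [hK'.volume_inter_eq] at h
  have := hK'.volume_pos
  by_contra! hlt
  nlinarith

/-- Second distribution inequality:
`Vol{x ∈ F : |P(x)| < (4λ)^{-d} M(P)} ≤ 1/λ` for all `λ > 1`. -/
theorem second_distribution_inequality {n : ℕ} (d : ℕ) (P : MvPolynomial (Fin n) ℝ)
    (hPd : P.totalDegree ≤ d) (hPnc : ∀ c : ℝ, P ≠ MvPolynomial.C c)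
    (F : Set (EuclideanSpace ℝ (Fin n))) (hFcomp : IsCompact F) (hFconv : Convex ℝ F)
    (hFvol : volume F = 1)
    (M : ℝ) (hM : 0 < M)
    (hMdef : volume {x ∈ F | M ≤ |MvPolynomial.eval (fun i => x i) P|} =
      ENNReal.ofReal (Real.exp (-1)))
    (lam : ℝ) (hlam : 1 < lam) :
    (volume {x ∈ F | |MvPolynomial.eval (fun i => x i) P| < ((4 * lam) ^ d)⁻¹ * M}).toReal ≤
      1 / lam := by
  cases n with
  | zero => exact absurd (MvPolynomial.eq_C_of_isEmpty P) (hPnc _)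
  | succ m =>
  have hd : d ≠ 0 := by
    rintro rfl
    exact hPnc _ (MvPolynomial.totalDegree_eq_zero_iff_eq_C.mp (Nat.le_zero.mp hPd))
  set ε := ((4 * lam) ^ d)⁻¹ * M with hεdef
  have hε : 0 < ε := by positivity
  set A : Set (Fin (m + 1) → ℝ) := {x | M ≤ |MvPolynomial.eval x P|} with hA
  set B : Set (Fin (m + 1) → ℝ) := {x | |MvPolynomial.eval x P| < ε} with hB
  set K : Set (Fin (m + 1) → ℝ) := WithLp.toLp 2 ⁻¹' F with hK
  have hPc : Continuous fun x : EuclideanSpace ℝ (Fin (m + 1)) =>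
      MvPolynomial.eval (fun i => x i) P :=
    (MvPolynomial.continuous_eval P).comp (by fun_prop)
  have hvol : ∀ S : Set (EuclideanSpace ℝ (Fin (m + 1))), MeasurableSet S →
      volume (WithLp.toLp 2 ⁻¹' S : Set (Fin (m + 1) → ℝ)) = volume S := fun S hS =>
    (PiLp.volume_preserving_toLp (Fin (m + 1))).measure_preimage hS.nullMeasurableSet
  have hKvol : volume.real K = 1 := by
    rw [measureReal_def, hK, hvol F hFcomp.measurableSet, hFvol, ENNReal.toReal_one]
  have hKA : volume.real (K ∩ A) = Real.exp (-1) := by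
    have h := hvol {x ∈ F | M ≤ |MvPolynomial.eval (fun i => x i) P|}
      (hFcomp.measurableSet.inter (isClosed_le continuous_const hPc.abs).measurableSet)
    rw [hMdef] at h
    rw [measureReal_def, ← ENNReal.toReal_ofReal (Real.exp_pos (-1)).le, ← h]
    rfl
  have hKB : volume {x ∈ F | |MvPolynomial.eval (fun i => x i) P| < ε} = volume (K ∩ B) :=
    (hvol {x ∈ F | |MvPolynomial.eval (fun i => x i) P| < ε}
      (hFcomp.measurableSet.inter (isOpen_lt hPc.abs continuous_const).measurableSet)).symm
  have hKc : IsCompact K := by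
    have e : K = WithLp.ofLp '' F := by
      ext z
      exact ⟨fun hz => ⟨_, hz, rfl⟩, by rintro ⟨x, hx, rfl⟩; exact hx⟩
    rw [e]
    exact hFcomp.image (PiLp.continuous_ofLp 2 _)
  have hKconv : Convex ℝ K :=
    hFconv.linear_preimage (WithLp.linearEquiv 2 ℝ (Fin (m + 1) → ℝ)).symm.toLinearMap
  rw [hKB, ← measureReal_def]
  set b := volume.real (K ∩ B) with hb
  have hbal : IsBalanced A B (Real.exp (-1)) b K :=
    ⟨hKc, hKconv, by rw [hKvol]; exact one_pos, by rw [hKvol, mul_one],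
      by rw [hKvol, mul_one, hKA]⟩
  have hb1 : b ≤ 1 := hKvol ▸ measureReal_mono Set.inter_subset_left hKc.measure_lt_top.ne
  by_contra! hlt
  have hb0 : 0 < b := lt_trans (by positivity) hlt
  have h1 : 1 / b < lam := by
    rw [div_lt_iff₀ hb0]
    rw [div_lt_iff₀ (by linarith)] at hlt
    linarith
  have h2 : 1 ≤ 1 / b := by rwa [le_div_iff₀ hb0, one_mul]
  obtain ⟨l, hl1, hl2⟩ := exists_between h1
  have h3 : (4 * l) ^ d * ε < M := by
    have h4 : (4 * l) ^ d < (4 * lam) ^ d :=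
      pow_lt_pow_left₀ (by linarith) (by linarith) hd
    calc (4 * l) ^ d * ε < (4 * lam) ^ d * ε := by gcongr
      _ = M := by rw [hεdef]; field_simp
  have h5 := IsBalanced.mul_le_one hd hPd hε (h2.trans hl1.le) h3 hbal
  rw [div_lt_iff₀ hb0] at hl1
  linarith
end

section
/- Let P be a polynomial of degree at most d on ℝⁿ, and let F ⊂ ℝⁿ be a compact convex set of volume 1. Let T_d(x) = (1/2)[(x + √(x²−1))^d + (x − √(x²−1))^d] be the Chebyshev polynomial of degree d. Then for every c > 0 and every λ ≥ 1, Vol{x ∈ F : |P(x)| ≥ T_d(2λ−1)·c} ≤ (Vol{x ∈ F : |P(x)| ≥ c})^λ. -/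
open MeasureTheory

/-- The Chebyshev polynomial of degree `d`, for `x ≥ 1` given by
`T_d(x) = (1/2)[(x + √(x²-1))^d + (x - √(x²-1))^d]`. -/
noncomputable def chebyshevT (d : ℕ) (x : ℝ) : ℝ :=
  (1 / 2) * ((x + Real.sqrt (x ^ 2 - 1)) ^ d + (x - Real.sqrt (x ^ 2 - 1)) ^ d)

open Polynomial in
theorem chebyshevT_eq_eval (d : ℕ) {x : ℝ} (hx : 1 ≤ x) :
    chebyshevT d x = (Chebyshev.T ℝ d).eval x := by
  have hs : √(x ^ 2 - 1) ^ 2 = x ^ 2 - 1 := Real.sq_sqrt (by nlinarith)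
  induction d using Nat.twoStepInduction with
  | zero => simp [chebyshevT]; norm_num
  | one => simp [chebyshevT]; ring
  | more n ih1 ih2 =>
    have h := Chebyshev.T_add_two ℝ (n : ℤ)
    push_cast at *
    rw [h, eval_sub, eval_mul, ← ih1, ← ih2]
    simp only [chebyshevT, eval_mul, eval_X, eval_ofNat]
    set s := √(x ^ 2 - 1)
    linear_combination (1 / 2) * ((x + s) ^ n + (x - s) ^ n) * hs

open Polynomial in
theorem Lagrange.eval_eq_sum_prod {s : Finset ℕ} {v : ℕ → ℝ} (hv : Set.InjOn v s) {f : ℝ[X]}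
    (hf : f.degree < s.card) (z : ℝ) :
    f.eval z = ∑ i ∈ s, f.eval (v i) * ∏ j ∈ s.erase i, ((z - v j) / (v i - v j)) := by
  conv_lhs => rw [Lagrange.eq_interpolate hv hf]
  simp only [Lagrange.interpolate_apply, eval_finsetSum, eval_mul, eval_C, Lagrange.basis,
    eval_prod, Lagrange.basisDivisor, eval_sub, eval_X, div_eq_inv_mul]

open Polynomial Chebyshev in
theorem Polynomial.Chebyshev.eval_T_eq_sum_prod_node (d : ℕ) (z : ℝ) :
    (T ℝ d).eval z = ∑ i ∈ Finset.range (d + 1),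
      ∏ j ∈ (Finset.range (d + 1)).erase i, ((z - node d j) / |node d i - node d j|) := by
  rw [Lagrange.eval_eq_sum_prod (strictAntiOn_node d).injOn (by
    rw [Finset.card_range, degree_T]; exact_mod_cast Nat.lt_succ_self d) z]
  refine Finset.sum_congr rfl fun i hi => ?_
  rw [eval_T_real_node (by grind), Finset.prod_div_distrib, Finset.prod_div_distrib,
    ← Finset.abs_prod]
  have hp := zero_lt_prod_node_sub_node (n := d) (i := i) (by grind)
  set p := ∏ j ∈ (Finset.range (d + 1)).erase i, (node d i - node d j)
  have h1 : |p| = (-1) ^ i * p := by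
    rw [← abs_of_pos hp, abs_mul, abs_neg_one_pow, one_mul]
  have h2 : ((-1 : ℝ) ^ i) * (-1) ^ i = 1 := by rw [← mul_pow]; simp
  have h3 : p ≠ 0 := by rintro h; simp [h] at hp
  have h4 : ((-1 : ℝ) ^ i) ≠ 0 := by positivity
  rw [h1]
  field_simp
  linear_combination (∏ x ∈ (Finset.range (d + 1)).erase i, (z - node d x)) * h2

open Polynomial Chebyshev in
theorem Polynomial.abs_eval_le_of_spread {q : ℝ[X]} {d : ℕ} (hq : q.natDegree ≤ d)
    {m S D x : ℝ} (hS : 0 < S) (e : ℕ → ℝ)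
    (he : ∀ i ≤ d, |q.eval (e i)| ≤ m)
    (hx : ∀ i ≤ d, |x - e i| ≤ S * (1 - node d i) / 2 + D)
    (hspread : ∀ i ≤ d, ∀ j ≤ d, S * |node d i - node d j| / 2 ≤ |e i - e j|) :
    |q.eval x| ≤ (T ℝ d).eval (1 + 2 * D / S) * m := by
  have hne : ∀ i ≤ d, ∀ j ≤ d, i ≠ j → node d i ≠ node d j := fun i hi j hj hij h =>
    hij ((strictAntiOn_node d).injOn (by grind) (by grind) h)
  have hinj : Set.InjOn e (Finset.range (d + 1)) := by
    intro i hi j hj hij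
    by_contra hcon
    have hi' : i ≤ d := by grind
    have hj' : j ≤ d := by grind
    have h1 := hspread i hi' j hj'
    have h2 : 0 < |node d i - node d j| := abs_pos.2 (sub_ne_zero.2 (hne i hi' j hj' hcon))
    rw [hij, sub_self, abs_zero] at h1
    have := mul_pos hS h2
    linarith
  rw [Lagrange.eval_eq_sum_prod hinj (by
    rw [Finset.card_range]
    exact lt_of_le_of_lt degree_le_natDegree (by exact_mod_cast Nat.lt_succ_of_le hq)) x,
    eval_T_eq_sum_prod_node, Finset.sum_mul]
  refine (Finset.abs_sum_le_sum_abs _ _).trans (Finset.sum_le_sum fun i hi => ?_)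
  have hi' : i ≤ d := by grind
  rw [abs_mul, mul_comm, Finset.abs_prod]
  refine mul_le_mul ?_ (he i hi') (abs_nonneg _) ?_
  · refine Finset.prod_le_prod (fun _ _ => abs_nonneg _) fun j hj => ?_
    have hj' : j ≤ d := by grind
    have hpos : 0 < |node d i - node d j| :=
      abs_pos.2 (sub_ne_zero.2 (hne i hi' j hj' (by grind)))
    rw [abs_div]
    calc |x - e j| / |e i - e j|
        ≤ (S * (1 - node d j) / 2 + D) / (S * |node d i - node d j| / 2) :=
          div_le_div₀ ((abs_nonneg _).trans (hx j hj')) (hx j hj') (by positivity)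
            (hspread i hi' j hj')
      _ = _ := by field_simp; ring
  · refine Finset.prod_nonneg fun j hj => div_nonneg ?_ (abs_nonneg _)
    have h := (abs_nonneg _).trans (hx j (by grind))
    have : 1 + 2 * D / S - node d j = (S * (1 - node d j) / 2 + D) * (2 / S) := by
      field_simp; ring
    rw [this]; positivity

theorem volume_real_inter_Icc_sub_le (K : Set ℝ) (x : ℝ) {s t : ℝ} (hst : s ≤ t) :
    volume.real (K ∩ Set.Icc x t) ≤ volume.real (K ∩ Set.Icc x s) + (t - s) := by
  have : K ∩ Set.Icc x t ⊆ (K ∩ Set.Icc x s) ∪ Set.Icc s t := by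
    rintro u ⟨h1, h2, h3⟩
    rcases le_total u s with h | h
    · exact Or.inl ⟨h1, h2, h⟩
    · exact Or.inr ⟨h, h3⟩
  have hfin : volume ((K ∩ Set.Icc x s) ∪ Set.Icc s t) ≠ ⊤ :=
    ((measure_union_le _ _).trans_lt (ENNReal.add_lt_top.2
      ⟨(measure_mono Set.inter_subset_right).trans_lt measure_Icc_lt_top, measure_Icc_lt_top⟩)).ne
  refine (measureReal_mono this hfin).trans ((measureReal_union_le _ _).trans ?_)
  rw [Real.volume_real_Icc_of_le hst]

theorem volume_real_inter_Icc_mono (K : Set ℝ) (x : ℝ) {s t : ℝ} (hst : s ≤ t) :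
    volume.real (K ∩ Set.Icc x s) ≤ volume.real (K ∩ Set.Icc x t) :=
  measureReal_mono (Set.inter_subset_inter_right _ (Set.Icc_subset_Icc_right hst))
    ((measure_mono Set.inter_subset_right).trans_lt measure_Icc_lt_top).ne

theorem exists_mem_volume_real_inter_Icc_eq {K : Set ℝ} (hK : IsClosed K) {x y s : ℝ}
    (hxy : x ≤ y) (hs0 : 0 ≤ s) (hs : s < volume.real (K ∩ Set.Icc x y)) :
    ∃ e ∈ K ∩ Set.Icc x y, volume.real (K ∩ Set.Icc x e) = s := by
  set φ : ℝ → ℝ := fun t => volume.real (K ∩ Set.Icc x t) with hφ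
  have hcont : ContinuousOn φ (Set.Icc x y) := by
    refine (LipschitzWith.of_le_add (f := φ) fun a b => ?_).continuous.continuousOn
    rcases le_total a b with h | h
    · exact (volume_real_inter_Icc_mono K x h).trans (le_add_of_nonneg_right dist_nonneg)
    · rw [Real.dist_eq, abs_of_nonneg (sub_nonneg.2 h)]
      exact volume_real_inter_Icc_sub_le K x h
  have hx0 : φ x = 0 := by
    have : volume (K ∩ Set.Icc x x) = 0 := measure_mono_null Set.inter_subset_right (by simp)
    simp only [hφ, measureReal_def, this, ENNReal.toReal_zero]
  obtain ⟨t, ht, hts⟩ := intermediate_value_Icc hxy hcont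
    (show s ∈ Set.Icc (φ x) (φ y) from ⟨hx0 ▸ hs0, hs.le⟩)
  have hne : (K ∩ Set.Icc t y).Nonempty := by
    by_contra hcon
    rw [Set.not_nonempty_iff_eq_empty] at hcon
    have : K ∩ Set.Icc x y ⊆ K ∩ Set.Icc x t := by
      rintro u ⟨h1, h2, h3⟩
      refine ⟨h1, h2, ?_⟩
      by_contra! h
      exact (hcon ▸ (show u ∈ K ∩ Set.Icc t y from ⟨h1, h.le, h3⟩) : u ∈ (∅ : Set ℝ))
    have := measureReal_mono (μ := volume) this
      ((measure_mono Set.inter_subset_right).trans_lt measure_Icc_lt_top).ne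
    exact absurd (hs.trans_le this) (by rw [← hts]; exact lt_irrefl _)
  obtain ⟨e, ⟨heK, het, hey⟩, hmin⟩ := (isCompact_Icc.inter_left hK).exists_isLeast hne
  refine ⟨e, ⟨heK, ht.1.trans het, hey⟩, ?_⟩
  rw [← hts]
  refine le_antisymm ?_ (volume_real_inter_Icc_mono K x het)
  have hsub : K ∩ Set.Icc x e ⊆ (K ∩ Set.Icc x t) ∪ {e} := by
    rintro u ⟨h1, h2, h3⟩
    rcases le_total u t with h | h
    · exact Or.inl ⟨h1, h2, h⟩
    · exact Or.inr (le_antisymm h3 (hmin ⟨h1, h, h3.trans hey⟩))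
  have hfin : volume ((K ∩ Set.Icc x t) ∪ {e}) ≠ ⊤ :=
    ((measure_union_le _ _).trans_lt (ENNReal.add_lt_top.2
      ⟨(measure_mono Set.inter_subset_right).trans_lt measure_Icc_lt_top, by simp⟩)).ne
  refine (measureReal_mono hsub hfin).trans ((measureReal_union_le _ _).trans ?_)
  simp [hφ, measureReal_def]

open Polynomial Chebyshev in
/-- One-sided sharp Remez inequality. -/
theorem Polynomial.volume_real_le_of_lt_abs_eval {q : ℝ[X]} {d : ℕ} (hq : q.natDegree ≤ d)
    {m x y lam : ℝ} (hlam : 1 ≤ lam) (hx : (T ℝ d).eval (2 * lam - 1) * m < |q.eval x|)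
    (hxy : x ≤ y) :
    volume.real ({t | |q.eval t| ≤ m} ∩ Set.Icc x y) ≤ (y - x) / lam := by
  by_contra! hcon
  set K : Set ℝ := {t | |q.eval t| ≤ m}
  have hK : IsClosed K := isClosed_le q.continuous.abs continuous_const
  rcases hxy.eq_or_lt with rfl | hlt
  · have : volume (K ∩ Set.Icc x x) = 0 := measure_mono_null Set.inter_subset_right (by simp)
    rw [measureReal_def, this] at hcon
    simp at hcon
  set S := (y - x) / lam with hSdef
  have hS : 0 < S := div_pos (by linarith) (by linarith)
  have hnode : ∀ i, 0 ≤ S * (1 - node d i) / 2 ∧ S * (1 - node d i) / 2 ≤ S := fun i => by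
    have h := node_mem_Icc (n := d) (i := i)
    constructor
    · have := mul_nonneg hS.le (sub_nonneg.2 h.2); linarith
    · nlinarith [h.1]
  choose e heK hes using fun i => exists_mem_volume_real_inter_Icc_eq hK hxy (hnode i).1
    ((hnode i).2.trans_lt hcon)
  refine hx.not_ge ?_
  have key := Polynomial.abs_eval_le_of_spread hq (m := m) (D := (y - x) - S) (x := x) hS e
    (fun i _ => (heK i).1) (fun i _ => ?_) (fun i _ j _ => ?_)
  · have : 1 + 2 * ((y - x) - S) / S = 2 * lam - 1 := by
      have : y - x = S * lam := by rw [hSdef]; field_simp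
      rw [this]; field_simp; ring
    rwa [this] at key
  · have h1 := (heK i).2.1
    rw [abs_sub_comm, abs_of_nonneg (sub_nonneg.2 h1)]
    have h2 := volume_real_inter_Icc_sub_le K x (heK i).2.2
    rw [hes i] at h2
    linarith
  · have hw : ∀ i j, e i ≤ e j → S * |node d i - node d j| / 2 ≤ |e i - e j| := fun i j hij => by
      have h1 := volume_real_inter_Icc_mono K x hij
      have h2 := volume_real_inter_Icc_sub_le K x hij
      rw [hes, hes] at h1 h2
      have h3 : 0 ≤ node d i - node d j := by
        by_contra! h
        nlinarith
      rw [abs_of_nonneg h3, abs_sub_comm, abs_of_nonneg (sub_nonneg.2 hij)]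
      linarith
    rcases le_total (e i) (e j) with h | h
    · exact hw i j h
    · rw [abs_sub_comm, abs_sub_comm (e i)]; exact hw j i h

open Polynomial Chebyshev in
theorem Polynomial.volume_real_le_of_lt_abs_eval' {q : ℝ[X]} {d : ℕ} (hq : q.natDegree ≤ d)
    {m x y lam : ℝ} (hlam : 1 ≤ lam) (hx : (T ℝ d).eval (2 * lam - 1) * m < |q.eval x|)
    (hyx : y ≤ x) :
    volume.real ({t | |q.eval t| ≤ m} ∩ Set.Icc y x) ≤ (x - y) / lam := by
  have h := Polynomial.volume_real_le_of_lt_abs_eval (q := q.comp (-X)) (d := d) (m := m)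
    (x := -x) (y := -y) (by rw [natDegree_comp]; simpa using hq) hlam (by simpa using hx)
    (by linarith)
  have hset : {t | |q.eval t| ≤ m} ∩ Set.Icc y x =
      Neg.neg ⁻¹' ({t | |(q.comp (-X)).eval t| ≤ m} ∩ Set.Icc (-x) (-y)) := by
    ext t; simp [and_comm]
  rw [hset, measureReal_def, Measure.measure_preimage_neg]
  exact h.trans_eq (by ring)

open scoped ENNReal in
theorem IsCompact.volume_add_volume_le {K L C : Set ℝ} (hK : IsCompact K) (hL : IsCompact L)
    (hK' : K.Nonempty) (hL' : L.Nonempty) (h : ∀ x ∈ K, ∀ y ∈ L, x + y ∈ C) :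
    volume K + volume L ≤ volume C := by
  obtain ⟨a, haK, ha⟩ := hK.exists_isGreatest hK'
  obtain ⟨b, hbL, hb⟩ := hL.exists_isLeast hL'
  have h1 : volume ((fun x => x + -b) ⁻¹' K) = volume K := measure_preimage_add_right _ _ _
  have h2 : volume ((fun x => x + -a) ⁻¹' L) = volume L := measure_preimage_add_right _ _ _
  have hd : AEDisjoint volume ((fun x => x + -b) ⁻¹' K) ((fun x => x + -a) ⁻¹' L) := by
    refine measure_mono_null (t := {a + b}) ?_ (by simp)
    rintro x ⟨hx, hy⟩
    have := ha hx
    have := hb hy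
    simp only [Set.mem_singleton_iff]
    linarith
  rw [← h1, ← h2, ← measure_union₀ (((measurable_add_const _) hL.measurableSet).nullMeasurableSet)
    hd]
  refine measure_mono (Set.union_subset (fun x hx => ?_) fun x hx => ?_)
  · simpa using h _ hx _ hbL
  · simpa using h _ haK _ hx

open scoped ENNReal in
/-- One-dimensional Brunn–Minkowski inequality. -/
theorem MeasurableSet.volume_add_volume_le {A B C : Set ℝ} (hA : MeasurableSet A)
    (hB : MeasurableSet B) (hA' : A.Nonempty) (hB' : B.Nonempty)
    (h : ∀ x ∈ A, ∀ y ∈ B, x + y ∈ C) : volume A + volume B ≤ volume C := by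
  obtain ⟨a, ha⟩ := hA'
  obtain ⟨b, hb⟩ := hB'
  rw [hA.measure_eq_iSup_isCompact, hB.measure_eq_iSup_isCompact]
  refine ENNReal.biSup_add_biSup_le' (ι := Set ℝ) (κ := Set ℝ)
    (p := fun K => K ⊆ A ∧ IsCompact K) (q := fun K => K ⊆ B ∧ IsCompact K)
    ⟨∅, by simp⟩ ⟨∅, by simp⟩ (fun K hK L hL => ?_) |> fun H => by simpa [iSup_and] using H
  refine le_trans ?_ (IsCompact.volume_add_volume_le (hK.2.insert a) (hL.2.insert b)
    (Set.insert_nonempty _ _) (Set.insert_nonempty _ _)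
    fun x hx y hy => h x (Set.insert_subset ha hK.1 hx) y (Set.insert_subset hb hL.1 hy))
  gcongr <;> exact Set.subset_insert _ _

open scoped ENNReal in
theorem MeasurableSet.volume_add_volume_le_two_mul {A B C : Set ℝ} (hA : MeasurableSet A)
    (hB : MeasurableSet B) (hA' : A.Nonempty) (hB' : B.Nonempty)
    (h : ∀ x ∈ A, ∀ y ∈ B, (2⁻¹ : ℝ) * (x + y) ∈ C) :
    volume A + volume B ≤ 2 * volume C := by
  refine (hA.volume_add_volume_le hB hA' hB' (C := (fun x => (2⁻¹ : ℝ) * x) ⁻¹' C) h).trans_eq ?_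
  rw [Real.volume_preimage_mul_left (by norm_num)]
  simp

open scoped ENNReal in
theorem lintegral_min_one_eq {f : ℝ → ℝ≥0∞} (hf : Measurable f) :
    ∫⁻ x, min (f x) 1 = ∫⁻ t in Set.Ioo (0 : ℝ) 1, volume {x | ENNReal.ofReal t < f x} := by
  have hne : ∀ x, min (f x) 1 ≠ ⊤ := fun x => ((min_le_right _ _).trans_lt ENNReal.one_lt_top).ne
  have h := lintegral_eq_lintegral_meas_lt (volume : Measure ℝ)
    (f := fun x => (min (f x) 1).toReal)
    (Filter.Eventually.of_forall fun x => ENNReal.toReal_nonneg)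
    (by fun_prop)
  simp only [ENNReal.ofReal_toReal (hne _)] at h
  rw [h, ← lintegral_indicator measurableSet_Ioi, ← lintegral_indicator measurableSet_Ioo]
  refine lintegral_congr fun t => ?_
  by_cases h0 : 0 < t
  · have h1 : {x | t < (min (f x) 1).toReal} =
        if t < 1 then {x | ENNReal.ofReal t < f x} else ∅ := by
      ext x
      rw [Set.mem_ofPred_eq, ← ENNReal.ofReal_lt_iff_lt_toReal h0.le (hne x), lt_min_iff]
      split_ifs with h1
      · simp [h1]
      · simp [h1]
    by_cases h1' : t < 1 <;> simp [Set.indicator, h0, h1, h1']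
  · simp [Set.indicator, h0]

open scoped ENNReal in
theorem lintegral_add_lintegral_le_of_min_le {f g h : ℝ → ℝ≥0∞} (hf : Measurable f)
    (hg : Measurable g) (hh : Measurable h) (hf1 : ∀ x, f x ≤ 1) (hg1 : ∀ x, g x ≤ 1)
    (hf2 : ⨆ x, f x = 1) (hg2 : ⨆ x, g x = 1)
    (hfg : ∀ x y, min (f x) (g y) ≤ h ((2⁻¹ : ℝ) * (x + y))) :
    (∫⁻ x, f x) + ∫⁻ x, g x ≤ 2 * ∫⁻ x, h x := by
  have ef : ∫⁻ x, f x = ∫⁻ x, min (f x) 1 := by simp [hf1]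
  have eg : ∫⁻ x, g x = ∫⁻ x, min (g x) 1 := by simp [hg1]
  have eh : ∫⁻ x, min (h x) 1 ≤ ∫⁻ x, h x := lintegral_mono fun x => min_le_left _ _
  refine le_trans ?_ (mul_le_mul_right eh 2)
  have hmeas : ∀ {u : ℝ → ℝ≥0∞}, Measurable fun t => volume {x | ENNReal.ofReal t < u x} :=
    fun {u} => Antitone.measurable fun s t hst =>
      measure_mono fun x (hx : _ < _) => (ENNReal.ofReal_le_ofReal hst).trans_lt hx
  rw [ef, eg, lintegral_min_one_eq hf, lintegral_min_one_eq hg, lintegral_min_one_eq hh,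
    ← lintegral_add_left hmeas, ← lintegral_const_mul _ hmeas]
  refine setLIntegral_mono' measurableSet_Ioo fun t ht => ?_
  have ht1 : ENNReal.ofReal t < 1 := by simpa using ht.2
  refine MeasurableSet.volume_add_volume_le_two_mul (measurableSet_lt measurable_const hf)
    (measurableSet_lt measurable_const hg) ?_ ?_ fun x hx y hy => ?_
  · rw [← hf2] at ht1; exact lt_iSup_iff.1 ht1
  · rw [← hg2] at ht1; exact lt_iSup_iff.1 ht1
  · exact (lt_min hx hy).trans_le (hfg x y)

open scoped ENNReal in
theorem ENNReal.mul_le_sq_of_add_le_two_mul {a b h : ℝ≥0∞} (H : a + b ≤ 2 * h) :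
    a * b ≤ h ^ 2 := by
  rcases eq_or_ne h ⊤ with rfl | hh
  · simp
  have hab : a + b ≠ ⊤ := (H.trans_lt (ENNReal.mul_lt_top (by simp) hh.lt_top)).ne
  obtain ⟨ha, hb⟩ := ENNReal.add_ne_top.1 hab
  lift a to NNReal using ha
  lift b to NNReal using hb
  lift h to NNReal using hh
  norm_cast at H ⊢
  have H' : (a : ℝ) + b ≤ 2 * h := by exact_mod_cast H
  have : (a : ℝ) * b ≤ h ^ 2 := by nlinarith [sq_nonneg ((a : ℝ) - b), a.2, b.2, h.2]
  exact_mod_cast this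

open scoped ENNReal in
/-- A measure satisfies the midpoint Prékopa–Leindler inequality. -/
def MidpointPrekopaLeindler {E : Type*} [AddCommGroup E] [Module ℝ E] [MeasurableSpace E]
    (μ : Measure E) : Prop :=
  ∀ f g h : E → ℝ≥0∞, Measurable f → Measurable g → Measurable h →
    (∀ x y, f x * g y ≤ h ((2⁻¹ : ℝ) • (x + y)) ^ 2) →
    (∫⁻ x, f x ∂μ) * (∫⁻ x, g x ∂μ) ≤ (∫⁻ x, h x ∂μ) ^ 2

open scoped ENNReal in
theorem lintegral_mul_lintegral_le_of_bounded {f g h : ℝ → ℝ≥0∞} (hf : Measurable f)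
    (hg : Measurable g) (hh : Measurable h) (hf1 : ⨆ x, f x ≠ ⊤) (hg1 : ⨆ x, g x ≠ ⊤)
    (hfg : ∀ x y, f x * g y ≤ h ((2⁻¹ : ℝ) * (x + y)) ^ 2) :
    (∫⁻ x, f x) * (∫⁻ x, g x) ≤ (∫⁻ x, h x) ^ 2 := by
  set A := ⨆ x, f x with hA
  set B := ⨆ x, g x with hB
  have hfA : ∀ x, f x ≤ A := le_iSup f
  have hgB : ∀ x, g x ≤ B := le_iSup g
  rcases eq_or_ne A 0 with hA0 | hA0
  · have : ∀ x, f x = 0 := fun x => by simpa [hA0] using hfA x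
    simp [this]
  rcases eq_or_ne B 0 with hB0 | hB0
  · have : ∀ x, g x = 0 := fun x => by simpa [hB0] using hgB x
    simp [this]
  set c := (A * B) ^ (2⁻¹ : ℝ) with hc
  have hc2 : c ^ 2 = A * B := by
    rw [hc, ← ENNReal.rpow_natCast, ← ENNReal.rpow_mul]; norm_num
  have hAB0 : A * B ≠ 0 := mul_ne_zero hA0 hB0
  have hABt : A * B ≠ ⊤ := ENNReal.mul_ne_top hf1 hg1
  have key := lintegral_add_lintegral_le_of_min_le (f := fun x => A⁻¹ * f x)
    (g := fun x => B⁻¹ * g x) (h := fun x => c⁻¹ * h x) (by fun_prop) (by fun_prop) (by fun_prop)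
    (fun x => ENNReal.inv_mul_cancel hA0 hf1 ▸ mul_le_mul_right (hfA x) _)
    (fun x => ENNReal.inv_mul_cancel hB0 hg1 ▸ mul_le_mul_right (hgB x) _)
    (by rw [← ENNReal.mul_iSup, ← hA, ENNReal.inv_mul_cancel hA0 hf1])
    (by rw [← ENNReal.mul_iSup, ← hB, ENNReal.inv_mul_cancel hB0 hg1])
    (fun x y => by
      rw [← ENNReal.pow_le_pow_left_iff two_ne_zero]
      calc min (A⁻¹ * f x) (B⁻¹ * g y) ^ 2 ≤ (A⁻¹ * f x) * (B⁻¹ * g y) := by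
            rw [sq]; exact mul_le_mul' (min_le_left _ _) (min_le_right _ _)
        _ = (A * B)⁻¹ * (f x * g y) := by
            rw [ENNReal.mul_inv (Or.inl hA0) (Or.inl hf1)]; ring
        _ ≤ (A * B)⁻¹ * h ((2⁻¹ : ℝ) * (x + y)) ^ 2 := by gcongr; exact hfg x y
        _ = _ := by rw [mul_pow, ← ENNReal.inv_pow, hc2])
  rw [lintegral_const_mul _ hf, lintegral_const_mul _ hg, lintegral_const_mul _ hh] at key
  have key2 := ENNReal.mul_le_sq_of_add_le_two_mul key
  rw [mul_pow, ← ENNReal.inv_pow, hc2] at key2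
  have e : A⁻¹ * (∫⁻ x, f x) * (B⁻¹ * ∫⁻ x, g x) =
      (A * B)⁻¹ * ((∫⁻ x, f x) * ∫⁻ x, g x) := by
    rw [ENNReal.mul_inv (Or.inl hA0) (Or.inl hf1)]; ring
  rw [e] at key2
  exact (ENNReal.mul_le_mul_iff_right (ENNReal.inv_ne_zero.2 hABt)
    (ENNReal.inv_ne_top.2 hAB0)).1 key2

open scoped ENNReal in
theorem ENNReal.iSup_min_natCast (a : ℝ≥0∞) : ⨆ n : ℕ, min a n = a := by
  refine le_antisymm (iSup_le fun n => min_le_left _ _) ?_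
  have : (⨆ n : ℕ, min a (n : ℝ≥0∞)) = a ⊓ ⨆ n : ℕ, (n : ℝ≥0∞) := (inf_iSup_eq _ _).symm
  rw [this, ENNReal.iSup_natCast]; simp

open scoped ENNReal in
theorem lintegral_eq_iSup_min_natCast {f : ℝ → ℝ≥0∞} (hf : Measurable f) :
    ∫⁻ x, f x = ⨆ n : ℕ, ∫⁻ x, min (f x) n := by
  rw [← lintegral_iSup (f := fun (n : ℕ) x => min (f x) n) (fun n => by fun_prop)
    (fun m n hmn x => min_le_min_left _ (by exact_mod_cast hmn))]
  simp only [ENNReal.iSup_min_natCast]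

open scoped ENNReal in
theorem midpointPrekopaLeindler_real : MidpointPrekopaLeindler (volume : Measure ℝ) := by
  intro f g h hf hg hh hfg
  rw [lintegral_eq_iSup_min_natCast hf, lintegral_eq_iSup_min_natCast hg, ENNReal.iSup_mul]
  refine iSup_le fun n => ?_
  rw [ENNReal.mul_iSup]
  refine iSup_le fun m => ?_
  have hb : ∀ (u : ℝ → ℝ≥0∞) (k : ℕ), ⨆ x, min (u x) (k : ℝ≥0∞) ≠ ⊤ := fun u k =>
    ((iSup_le fun x => min_le_right _ _).trans_lt (ENNReal.natCast_lt_top k)).ne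
  exact lintegral_mul_lintegral_le_of_bounded (by fun_prop) (by fun_prop) hh (hb f n) (hb g m)
    fun x y => (mul_le_mul' (min_le_left _ _) (min_le_left _ _)).trans (hfg x y)

open scoped ENNReal in
theorem MidpointPrekopaLeindler.prod {E G : Type*} [AddCommGroup E] [Module ℝ E]
    [MeasurableSpace E] [AddCommGroup G] [Module ℝ G] [MeasurableSpace G] {μ : Measure E}
    {ν : Measure G} [SFinite ν] (hμ : MidpointPrekopaLeindler μ)
    (hν : MidpointPrekopaLeindler ν) : MidpointPrekopaLeindler (μ.prod ν) := by
  intro f g h hf hg hh hfg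
  rw [lintegral_prod _ hf.aemeasurable, lintegral_prod _ hg.aemeasurable,
    lintegral_prod _ hh.aemeasurable]
  exact hμ _ _ _ hf.lintegral_prod_right' hg.lintegral_prod_right' hh.lintegral_prod_right'
    fun x y => hν _ _ _ (hf.comp measurable_prodMk_left) (hg.comp measurable_prodMk_left)
      (hh.comp measurable_prodMk_left) fun u v => hfg (x, u) (y, v)

open scoped ENNReal in
theorem MidpointPrekopaLeindler.of_measurePreserving {E G : Type*} [AddCommGroup E] [Module ℝ E]
    [MeasurableSpace E] [AddCommGroup G] [Module ℝ G] [MeasurableSpace G] {μ : Measure E}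
    {ν : Measure G} (hν : MidpointPrekopaLeindler ν) (e : G → E) (he : MeasurePreserving e ν μ)
    (hmid : ∀ x y, e ((2⁻¹ : ℝ) • (x + y)) = (2⁻¹ : ℝ) • (e x + e y)) :
    MidpointPrekopaLeindler μ := by
  intro f g h hf hg hh hfg
  rw [← he.lintegral_comp hf, ← he.lintegral_comp hg, ← he.lintegral_comp hh]
  exact hν _ _ _ (hf.comp he.measurable) (hg.comp he.measurable) (hh.comp he.measurable)
    fun x y => by rw [hmid]; exact hfg _ _

theorem midpointPrekopaLeindler_pi (n : ℕ) :
    MidpointPrekopaLeindler (volume : Measure (Fin n → ℝ)) := by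
  induction n with
  | zero =>
    intro f g h _ _ _ hfg
    rw [volume_pi, Measure.pi_of_empty _ default, lintegral_dirac, lintegral_dirac,
      lintegral_dirac]
    exact (hfg default default).trans_eq (congrArg (fun x => h x ^ 2) (Subsingleton.elim _ _))
  | succ n ih =>
    refine (midpointPrekopaLeindler_real.prod ih).of_measurePreserving _
      ((volume_preserving_piFinSuccAbove (fun _ => ℝ) 0).symm) fun x y => ?_
    ext i
    refine Fin.cases ?_ (fun j => ?_) i <;>
    simp [MeasurableEquiv.piFinSuccAbove, mul_add]

open scoped ENNReal in
/-- Midpoint Brunn–Minkowski inequality in multiplicative form. -/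
theorem volume_mul_volume_le_sq {n : ℕ} {A B C : Set (Fin n → ℝ)} (hA : MeasurableSet A)
    (hB : MeasurableSet B) (hC : MeasurableSet C)
    (h : ∀ x ∈ A, ∀ y ∈ B, (2⁻¹ : ℝ) • (x + y) ∈ C) :
    volume A * volume B ≤ volume C ^ 2 := by
  have := midpointPrekopaLeindler_pi n (A.indicator 1) (B.indicator 1) (C.indicator 1)
    (measurable_one.indicator hA) (measurable_one.indicator hB) (measurable_one.indicator hC)
    fun x y => by
      by_cases hx : x ∈ A
      · by_cases hy : y ∈ B
        · rw [Set.indicator_of_mem hx, Set.indicator_of_mem hy, Set.indicator_of_mem (h x hx y hy)]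
          simp
        · simp [hy]
      · simp [hx]
  rwa [lintegral_indicator_one hA, lintegral_indicator_one hB, lintegral_indicator_one hC] at this

theorem Real.exp_le_of_antitone_sub_of_count_le {θ : ℝ} {N : ℕ} (v : ℕ → ℝ)
    (hmono : ∀ j < N, v j ≤ v (j + 1))
    (hconc : ∀ j, j + 1 < N → v (j + 2) - v (j + 1) ≤ v (j + 1) - v j)
    (bad : ℕ → Prop) [DecidablePred bad]
    (hbad : ∀ j ≤ N, ∑ i ∈ Finset.range j, (if bad i then (1 : ℝ) else 0) ≤ θ * j) :
    Real.exp (θ * v 0 + (1 - θ) * v N) ≤ Real.exp (v N) -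
      ∑ i ∈ Finset.range N, if bad i then Real.exp (v (i + 1)) - Real.exp (v i) else 0 := by
  suffices H : ∀ j ≤ N, ∀ κ, (∀ i, i + 1 = j → κ ≤ v (i + 1) - v i) →
      Real.exp (θ * v 0 + (1 - θ) * v j +
        κ * (θ * j - ∑ i ∈ Finset.range j, if bad i then (1 : ℝ) else 0)) ≤ Real.exp (v j) -
      ∑ i ∈ Finset.range j, if bad i then Real.exp (v (i + 1)) - Real.exp (v i) else 0 by
    have := H N le_rfl 0 fun i hi => sub_nonneg.2 (hmono i (by omega))
    simpa using this
  intro j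
  induction j with
  | zero =>
    intro _ κ _
    simp only [Finset.range_zero, Finset.sum_empty, Nat.cast_zero, mul_zero, sub_zero, add_zero]
    rw [← add_mul]; simp
  | succ j ih =>
    intro hj κ hκ
    have hκj := hκ j rfl
    have hcount := hbad (j + 1) hj
    have key := ih (by omega) (v (j + 1) - v j) fun i hi => by subst hi; exact hconc i (by omega)
    set n := ∑ i ∈ Finset.range j, if bad i then (1 : ℝ) else 0
    set w := ∑ i ∈ Finset.range j, if bad i then Real.exp (v (i + 1)) - Real.exp (v i) else 0
    have hw : 0 ≤ w := Finset.sum_nonneg fun i hi => by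
      split_ifs
      · exact sub_nonneg.2 (Real.exp_le_exp.2 (hmono i (by have := Finset.mem_range.1 hi; omega)))
      · exact le_rfl
    rw [Finset.sum_range_succ] at hcount ⊢
    rw [Finset.sum_range_succ]
    push_cast at hcount ⊢
    have step : κ * (θ * (j + 1) - (n + if bad j then 1 else 0)) ≤
        (v (j + 1) - v j) * (θ * (j + 1) - (n + if bad j then 1 else 0)) :=
      mul_le_mul_of_nonneg_right hκj (sub_nonneg.2 hcount)
    refine (Real.exp_le_exp.2 (add_le_add_right step _)).trans ?_
    by_cases hb : bad j
    · simp only [hb, if_true]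
      refine le_trans (le_of_eq ?_) (key.trans (le_of_eq ?_))
      · congr 1; ring
      · ring
    · simp only [hb, if_false, add_zero]
      have e : θ * v 0 + (1 - θ) * v (j + 1) + (v (j + 1) - v j) * (θ * (j + 1) - n) =
          (v (j + 1) - v j) + (θ * v 0 + (1 - θ) * v j + (v (j + 1) - v j) * (θ * j - n)) := by
        ring
      rw [e, Real.exp_add]
      refine (mul_le_mul_of_nonneg_left key (Real.exp_pos _).le).trans ?_
      rw [mul_sub, ← Real.exp_add]
      have h1 : 1 ≤ Real.exp (v (j + 1) - v j) :=
        Real.one_le_exp (sub_nonneg.2 (hmono j (by omega)))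
      have h2 : v (j + 1) - v j + v j = v (j + 1) := by ring
      rw [h2]
      nlinarith

/-- Midpoint log-concavity of a measure on the line, tested on closed intervals. -/
def MidpointLogConcave (ν : Measure ℝ) : Prop :=
  ∀ l s l' s', ν.real (Set.Icc l s) * ν.real (Set.Icc l' s') ≤
    ν.real (Set.Icc ((l + l') / 2) ((s + s') / 2)) ^ 2

theorem MidpointLogConcave.map_neg {ν : Measure ℝ} (hν : MidpointLogConcave ν) :
    MidpointLogConcave (ν.map Neg.neg) := by
  intro l s l' s'
  simp only [measureReal_def, Measure.map_apply measurable_neg measurableSet_Icc,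
    Set.neg_preimage, Set.neg_Icc]
  have := hν (-s) (-l) (-s') (-l')
  rwa [show (-s + -s') / 2 = -((s + s') / 2) by ring,
    show (-l + -l') / 2 = -((l + l') / 2) by ring] at this

theorem MidpointLogConcave.rpow_mul_rpow_le {ν : Measure ℝ} [IsFiniteMeasure ν]
    (hν : MidpointLogConcave ν) {θ δ l x r : ℝ} {E E' : Set ℝ} (hθ : 0 < θ) (hδ : 0 < δ)
    (hlx : l ≤ x) (hxr : x ≤ r) (hE : ∀ s ∈ E, ∀ t, |s - t| ≤ δ → t ∈ E')
    (hE' : ∀ s, x ≤ s → volume.real (E' ∩ Set.Icc x s) ≤ θ * (s - x)) (hxE : x ∉ E) :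
    ν.real (Set.Icc l x) ^ θ * ν.real (Set.Icc l r) ^ (1 - θ) ≤
      ν.real (Set.Icc l r) - ν.real (E ∩ Set.Icc x r) := by
  classical
  rcases (measureReal_nonneg (μ := ν) (s := Set.Icc l x)).eq_or_lt with h0 | h0
  · rw [← h0, Real.zero_rpow hθ.ne', zero_mul, sub_nonneg]
    exact measureReal_mono (Set.inter_subset_right.trans (Set.Icc_subset_Icc_left hlx))
  rcases hxr.eq_or_lt with rfl | hlt
  · have : E ∩ Set.Icc x x = ∅ := by
      rw [Set.Icc_self]; exact Set.inter_singleton_eq_empty.2 hxE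
    rw [this, ← Real.rpow_add h0]; simp
  obtain ⟨N, hN⟩ := exists_nat_gt ((r - x) / δ)
  have hN0 : 0 < (N : ℝ) := lt_of_le_of_lt (by have := sub_pos.2 hlt; positivity) hN
  set η := (r - x) / N with hη
  have hη0 : 0 < η := div_pos (sub_pos.2 hlt) hN0
  have hηδ : η ≤ δ := by
    rw [hη, div_le_iff₀ hN0]; rw [div_lt_iff₀ hδ] at hN; linarith
  set t : ℕ → ℝ := fun j => x + j * η with ht
  have ht0 : t 0 = x := by simp [ht]
  have htN : t N = r := by simp only [ht, hη]; field_simp; ring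
  have hts : ∀ j, t (j + 1) = t j + η := fun j => by simp only [ht]; push_cast; ring
  have hxt : ∀ j, x ≤ t j := fun j => by simp only [ht]; have : 0 ≤ (j : ℝ) * η := by positivity
                                         linarith
  set f : ℝ → ℝ := fun s => ν.real (Set.Icc l s) with hf
  have hfm : ∀ s s', s ≤ s' → f s ≤ f s' := fun s s' h =>
    measureReal_mono (Set.Icc_subset_Icc_right h)
  have hfpos : ∀ j, 0 < f (t j) := fun j => h0.trans_le (hfm _ _ (hxt j))
  have hfsub : ∀ j, ν.real (Set.Ioc (t j) (t (j + 1))) = f (t (j + 1)) - f (t j) := fun j => by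
    have hd : Disjoint (Set.Icc l (t j)) (Set.Ioc (t j) (t (j + 1))) :=
      Set.disjoint_left.2 fun u hu hu' => absurd hu.2 (not_le.2 hu'.1)
    have := measureReal_union (μ := ν) hd measurableSet_Ioc
    rw [Set.Icc_union_Ioc_eq_Icc (hlx.trans (hxt j)) (by rw [hts]; linarith)] at this
    simp only [hf]; linarith
  set bad : ℕ → Prop := fun j => (E ∩ Set.Ioc (t j) (t (j + 1))).Nonempty with hbad
  have hcount : ∀ j, (∑ i ∈ Finset.range j, if bad i then (1 : ℝ) else 0) * η ≤
      volume.real (E' ∩ Set.Icc x (t j)) := by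
    intro j
    induction j with
    | zero => simp
    | succ j ih =>
      rw [Finset.sum_range_succ, add_mul]
      have hfin : ∀ s, volume (E' ∩ Set.Icc x s) ≠ ⊤ := fun s =>
        ((measure_mono Set.inter_subset_right).trans_lt measure_Icc_lt_top).ne
      have hle : t j ≤ t (j + 1) := by rw [hts]; linarith
      by_cases hb : bad j
      · obtain ⟨u, huE, hu⟩ := hb
        have hd : Disjoint (E' ∩ Set.Icc x (t j)) (Set.Ioc (t j) (t (j + 1))) :=
          Set.disjoint_left.2 fun u hu hu' => absurd hu.2.2 (not_le.2 hu'.1)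
        have := measureReal_union (μ := volume) hd measurableSet_Ioc (hfin _) (by simp)
        rw [Real.volume_real_Ioc_of_le hle] at this
        simp only [show bad j from ⟨u, huE, hu⟩, if_true, one_mul]
        have h2 : t (j + 1) - t j = η := by rw [hts]; ring
        refine (add_le_add_left ih _).trans ?_
        rw [← h2, ← this]
        refine measureReal_mono (Set.union_subset (Set.inter_subset_inter_right _
          (Set.Icc_subset_Icc_right hle)) fun w hw => ⟨hE u huE w ?_, (hxt j).trans hw.1.le, hw.2⟩)
          (hfin _)
        refine abs_sub_le_iff.2 ⟨?_, ?_⟩ <;> linarith [hu.1, hu.2, hw.1, hw.2]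
      · simp only [hb, if_false, zero_mul, add_zero]
        exact ih.trans (volume_real_inter_Icc_mono E' x hle)
  have hEsum : ∀ j, ν.real (E ∩ Set.Icc x (t j)) ≤
      ∑ i ∈ Finset.range j, if bad i then f (t (i + 1)) - f (t i) else 0 := by
    intro j
    induction j with
    | zero => 
      rw [ht0, Set.Icc_self, Set.inter_singleton_eq_empty.2 hxE]; simp
    | succ j ih =>
      rw [Finset.sum_range_succ]
      have hsub : E ∩ Set.Icc x (t (j + 1)) ⊆
          (E ∩ Set.Icc x (t j)) ∪ (E ∩ Set.Ioc (t j) (t (j + 1))) := by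
        rintro u ⟨h1, h2, h3⟩
        rcases le_or_gt u (t j) with h | h
        · exact Or.inl ⟨h1, h2, h⟩
        · exact Or.inr ⟨h1, h, h3⟩
      refine (measureReal_mono hsub).trans ((measureReal_union_le _ _).trans (add_le_add ih ?_))
      by_cases hb : bad j
      · simp only [hb, if_true]
        rw [← hfsub]
        exact measureReal_mono Set.inter_subset_right
      · simp only [hb, if_false]
        rw [Set.not_nonempty_iff_eq_empty.1 hb]; simp
  have key := Real.exp_le_of_antitone_sub_of_count_le (θ := θ) (N := N)
    (fun j => Real.log (f (t j)))
    (fun j _ => Real.log_le_log (hfpos j) (hfm _ _ (by rw [hts]; linarith)))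
    (fun j _ => by
      have h := hν l (t j) l (t (j + 2))
      rw [show (t j + t (j + 2)) / 2 = t (j + 1) by rw [hts, hts]; ring,
        show (l + l) / 2 = l by ring] at h
      have h2 := Real.log_le_log (mul_pos (hfpos j) (hfpos (j + 2))) h
      rw [Real.log_mul (hfpos j).ne' (hfpos _).ne', Real.log_pow] at h2
      push_cast at h2
      linarith) bad
    (fun j _ => by
      have h := (hcount j).trans (hE' (t j) (hxt j))
      rw [show θ * (t j - x) = (θ * j) * η by simp only [ht]; ring] at h
      exact le_of_mul_le_mul_right h hη0)
  simp only [Real.exp_log (hfpos _)] at key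
  rw [htN, ht0, Real.exp_add, mul_comm θ, mul_comm (1 - θ), ← Real.rpow_def_of_pos h0,
    ← Real.rpow_def_of_pos (h0.trans_le (hfm _ _ hxr))] at key
  have := hEsum N
  rw [htN] at this
  linarith

/-- A measure `ν`, a set `E` with a neighbourhood `E'`, and a set `B` disjoint from `E'`, such
that `E'` has density at most `θ` in every interval having an endpoint in `B`. -/
structure RemezSetup (ν : Measure ℝ) (θ δ : ℝ) (E E' B : Set ℝ) : Prop where
  theta_pos : 0 < θ
  theta_le_one : θ ≤ 1
  delta_pos : 0 < δ
  logConcave : MidpointLogConcave ν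
  measurableSet : MeasurableSet E
  isClosed : IsClosed B
  near : ∀ s ∈ E, ∀ t, |s - t| ≤ δ → t ∈ E'
  disj : ∀ x ∈ B, x ∉ E'
  right : ∀ x ∈ B, ∀ s, x ≤ s → volume.real (E' ∩ Set.Icc x s) ≤ θ * (s - x)
  left : ∀ x ∈ B, ∀ s, s ≤ x → volume.real (E' ∩ Set.Icc s x) ≤ θ * (x - s)

/-- The Remez-type comparison on the interval `[l, r]`. -/
def RemezBound (ν : Measure ℝ) (θ : ℝ) (E B : Set ℝ) (l r : ℝ) : Prop :=
  ν.real (B ∩ Set.Icc l r) ^ θ * ν.real (Set.Icc l r) ^ (1 - θ) ≤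
    ν.real (Set.Icc l r) - ν.real (E ∩ Set.Icc l r)

theorem Real.rpow_mul_rpow_one_sub_le {b f θ : ℝ} (hb : 0 ≤ b) (hbf : b ≤ f) (hθ : 0 < θ) :
    b ^ θ * f ^ (1 - θ) ≤ f := by
  rcases (hb.trans hbf).eq_or_lt with h | h
  · subst h
    rw [le_antisymm hbf hb, Real.zero_rpow hθ.ne', zero_mul]
  · calc b ^ θ * f ^ (1 - θ) ≤ f ^ θ * f ^ (1 - θ) := by gcongr
      _ = f := by rw [← Real.rpow_add h]; simp

theorem Real.rpow_add_mul_rpow_add_le {b₁ b₂ f₁ f₂ κ θ : ℝ} (hb₁ : 0 ≤ b₁) (hb₂ : 0 ≤ b₂)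
    (hbf₁ : b₁ ≤ f₁) (hbf₂ : b₂ ≤ f₂) (hκ : 0 ≤ κ) (hθ : 0 < θ)
    (h₁ : b₁ ^ θ * f₁ ^ (1 - θ) ≤ κ * f₁) (h₂ : b₂ ^ θ * f₂ ^ (1 - θ) ≤ κ * f₂) :
    (b₁ + b₂) ^ θ * (f₁ + f₂) ^ (1 - θ) ≤ κ * (f₁ + f₂) := by
  have key : ∀ b f : ℝ, 0 ≤ b → b ≤ f → b ^ θ * f ^ (1 - θ) ≤ κ * f → b ≤ κ ^ θ⁻¹ * f := by
    intro b f hb hbf h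
    rcases (hb.trans hbf).eq_or_lt with h0 | h0
    · subst h0; simpa using hbf
    have h3 : b ^ θ ≤ κ * f ^ θ := by
      have : f ^ θ * f ^ (1 - θ) = f := by rw [← Real.rpow_add h0]; simp
      refine le_of_mul_le_mul_right (h.trans_eq ?_) (Real.rpow_pos_of_pos h0 (1 - θ))
      rw [mul_assoc, this]
    have := Real.rpow_le_rpow (Real.rpow_nonneg hb _) h3 (inv_nonneg.2 hθ.le)
    rwa [Real.mul_rpow hκ (Real.rpow_nonneg h0.le _), Real.rpow_rpow_inv hb hθ.ne',
      Real.rpow_rpow_inv h0.le hθ.ne'] at this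
  have hs := add_le_add (key _ _ hb₁ hbf₁ h₁) (key _ _ hb₂ hbf₂ h₂)
  rw [← mul_add] at hs
  have hf : 0 ≤ f₁ + f₂ := by linarith
  rcases hf.eq_or_lt with h0 | h0
  · rw [← h0, show b₁ + b₂ = 0 by linarith, Real.zero_rpow hθ.ne']; simp
  calc (b₁ + b₂) ^ θ * (f₁ + f₂) ^ (1 - θ)
      ≤ (κ ^ θ⁻¹ * (f₁ + f₂)) ^ θ * (f₁ + f₂) ^ (1 - θ) := by gcongr
    _ = κ * ((f₁ + f₂) ^ θ * (f₁ + f₂) ^ (1 - θ)) := by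
        rw [Real.mul_rpow (Real.rpow_nonneg hκ _) hf, Real.rpow_inv_rpow hκ hθ.ne', mul_assoc]
    _ = κ * (f₁ + f₂) := by rw [← Real.rpow_add h0]; simp

namespace RemezSetup

variable {ν : Measure ℝ} {θ δ : ℝ} {E E' B : Set ℝ}

theorem lt_abs_sub (h : RemezSetup ν θ δ E E' B) {x t : ℝ} (hx : x ∈ B) (ht : t ∈ E) :
    δ < |t - x| := by
  by_contra! hcon
  exact h.disj x hx (h.near t ht x hcon)

theorem neg (h : RemezSetup ν θ δ E E' B) : RemezSetup (ν.map Neg.neg) θ δ (-E) (-E') (-B) := by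
  have hvol : ∀ a b, volume.real (-E' ∩ Set.Icc a b) = volume.real (E' ∩ Set.Icc (-b) (-a)) := by
    intro a b
    have : -E' ∩ Set.Icc a b = Neg.neg ⁻¹' (E' ∩ Set.Icc (-b) (-a)) := by
      ext t; simp [and_comm]
    rw [this, measureReal_def, Measure.measure_preimage_neg, measureReal_def]
  refine ⟨h.theta_pos, h.theta_le_one, h.delta_pos, h.logConcave.map_neg, h.measurableSet.neg,
    h.isClosed.neg, fun s hs t hst => h.near (-s) hs (-t) ?_, fun x hx => h.disj (-x) hx,
    fun x hx s hs => ?_, fun x hx s hs => ?_⟩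
  · rwa [← abs_neg, show -(-s - -t) = s - t by ring]
  · rw [hvol]; exact (h.left (-x) hx (-s) (by linarith)).trans_eq (by ring)
  · rw [hvol]; exact (h.right (-x) hx (-s) (by linarith)).trans_eq (by ring)

theorem remezBound_neg_iff (hE : MeasurableSet E) (hB : MeasurableSet B) (l r : ℝ) :
    RemezBound (ν.map Neg.neg) θ (-E) (-B) l r ↔ RemezBound ν θ E B (-r) (-l) := by
  simp only [RemezBound, measureReal_def]
  rw [Measure.map_apply measurable_neg (hB.neg.inter measurableSet_Icc),
    Measure.map_apply measurable_neg (hE.neg.inter measurableSet_Icc),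
    Measure.map_apply measurable_neg measurableSet_Icc]
  simp

theorem extend_right [IsFiniteMeasure ν] (h : RemezSetup ν θ δ E E' B) {l x r : ℝ} (hlx : l ≤ x)
    (hxr : x ≤ r) (hx : x ∈ B) (hB : ∀ t ∈ B, t ≤ r → t ≤ x) (hS : RemezBound ν θ E B l x) :
    RemezBound ν θ E B l r := by
  have hOS := h.logConcave.rpow_mul_rpow_le h.theta_pos h.delta_pos hlx hxr h.near (h.right x hx)
    (fun hxE => absurd (h.lt_abs_sub hx hxE) (by simpa using h.delta_pos.le))
  unfold RemezBound at hS ⊢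
  have hb : ν.real (B ∩ Set.Icc l r) ≤ ν.real (B ∩ Set.Icc l x) :=
    measureReal_mono fun t ht => ⟨ht.1, ht.2.1, hB t ht.1 ht.2.2⟩
  have he : ν.real (E ∩ Set.Icc l r) ≤ ν.real (E ∩ Set.Icc l x) + ν.real (E ∩ Set.Icc x r) := by
    refine (measureReal_mono ?_).trans (measureReal_union_le _ _)
    rintro u ⟨h1, h2, h3⟩
    rcases le_total u x with h | h
    · exact Or.inl ⟨h1, h2, h⟩
    · exact Or.inr ⟨h1, h, h3⟩
  have hgf : ν.real (Set.Icc l x) ≤ ν.real (Set.Icc l r) :=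
    measureReal_mono (Set.Icc_subset_Icc_right hxr)
  have hb0 : 0 ≤ ν.real (B ∩ Set.Icc l r) := measureReal_nonneg
  have hbg : ν.real (B ∩ Set.Icc l x) ≤ ν.real (Set.Icc l x) :=
    measureReal_mono Set.inter_subset_right
  have he0 : 0 ≤ ν.real (E ∩ Set.Icc l x) := measureReal_nonneg
  have hg0 : 0 ≤ ν.real (Set.Icc l x) := measureReal_nonneg
  have heg : ν.real (E ∩ Set.Icc l r) ≤ ν.real (Set.Icc l r) :=
    measureReal_mono Set.inter_subset_right
  set b' := ν.real (B ∩ Set.Icc l r)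
  set b := ν.real (B ∩ Set.Icc l x)
  set g := ν.real (Set.Icc l x)
  set f := ν.real (Set.Icc l r)
  rcases hg0.eq_or_lt with hg | hg
  · have : b' = 0 := le_antisymm (by linarith) hb0
    rw [this, Real.zero_rpow h.theta_pos.ne']; simpa using heg
  have hf : 0 < f := hg.trans_le hgf
  set R := f ^ (1 - θ) / g ^ (1 - θ) with hR
  have hgp : 0 < g ^ (1 - θ) := Real.rpow_pos_of_pos hg _
  have hfR : f ^ (1 - θ) = g ^ (1 - θ) * R := by rw [hR]; field_simp
  have hR1 : 1 ≤ R := (one_le_div hgp).2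
    (Real.rpow_le_rpow hg.le hgf (by linarith [h.theta_le_one]))
  have hgg : g ^ θ * g ^ (1 - θ) = g := by rw [← Real.rpow_add hg]; simp
  rw [hfR, ← mul_assoc, hgg] at hOS
  have h1 : b' ^ θ * f ^ (1 - θ) ≤ (b ^ θ * g ^ (1 - θ)) * R := by
    rw [hfR, ← mul_assoc]
    gcongr
    exact h.theta_pos.le
  have h2 := mul_le_mul_of_nonneg_right hS (zero_le_one.trans hR1)
  nlinarith

theorem extend_left [IsFiniteMeasure ν] (h : RemezSetup ν θ δ E E' B) {l x r : ℝ} (hlx : l ≤ x)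
    (hxr : x ≤ r) (hx : x ∈ B) (hB : ∀ t ∈ B, l ≤ t → x ≤ t) (hS : RemezBound ν θ E B x r) :
    RemezBound ν θ E B l r := by
  have := h.neg.extend_right (l := -r) (x := -x) (r := -l) (by linarith) (by linarith)
    (by simpa using hx) (fun t ht htl => by linarith [hB (-t) ht (by linarith)])
    ((remezBound_neg_iff h.measurableSet h.isClosed.measurableSet _ _).2 (by simpa using hS))
  simpa using (remezBound_neg_iff h.measurableSet h.isClosed.measurableSet _ _).1 this

theorem continuous_measureReal_inter_Icc (ν : Measure ℝ) [IsFiniteMeasure ν]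
    [NullSingletonClass ν] (E : Set ℝ) (l : ℝ) :
    Continuous fun s => ν.real (E ∩ Set.Icc l s) := by
  have hle : ∀ a b : ℝ, ν.real (E ∩ Set.Icc l a) ≤ ν.real (E ∩ Set.Icc l b) +
      ν.real (Set.Icc (b - |a - b|) (b + |a - b|)) := by
    intro a b
    refine (measureReal_mono ?_).trans (measureReal_union_le _ _)
    rintro u ⟨h1, h2, h3⟩
    rcases le_total u b with h | h
    · exact Or.inl ⟨h1, h2, h⟩
    · exact Or.inr ⟨by linarith [abs_nonneg (a - b)], by linarith [le_abs_self (a - b)]⟩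
  rw [continuous_iff_continuousAt]
  intro b
  have hlim : Filter.Tendsto (fun s => 2 * ν.real (Set.Icc (b - |s - b| - |s - b|)
      (b + |s - b| + |s - b|))) (nhds b) (nhds 0) := by
    have h1 : Filter.Tendsto (fun s : ℝ => |s - b| + |s - b|) (nhds b) (nhds 0) := by
      have : Continuous fun s : ℝ => |s - b| + |s - b| := by fun_prop
      simpa using this.tendsto b
    have h2 := (ENNReal.tendsto_toReal ENNReal.zero_ne_top).comp
      ((_root_.tendsto_measure_Icc ν b).comp h1)
    have h3 := h2.const_mul 2
    simpa [Function.comp_def, measureReal_def, sub_sub, add_assoc] using h3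
  refine tendsto_iff_dist_tendsto_zero.2 (squeeze_zero (fun _ => dist_nonneg) (fun s => ?_) hlim)
  have hmono1 : ν.real (Set.Icc (b - |s - b|) (b + |s - b|)) ≤
      ν.real (Set.Icc (b - |s - b| - |s - b|) (b + |s - b| + |s - b|)) :=
    measureReal_mono (Set.Icc_subset_Icc (by linarith [abs_nonneg (s - b)])
      (by linarith [abs_nonneg (s - b)]))
  have hmono2 : ν.real (Set.Icc (s - |b - s|) (s + |b - s|)) ≤
      ν.real (Set.Icc (b - |s - b| - |s - b|) (b + |s - b| + |s - b|)) := by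
    rw [abs_sub_comm b s]
    exact measureReal_mono (Set.Icc_subset_Icc (by linarith [neg_abs_le (s - b)])
      (by linarith [le_abs_self (s - b)]))
  have hnn : 0 ≤ ν.real (Set.Icc (b - |s - b| - |s - b|) (b + |s - b| + |s - b|)) :=
    measureReal_nonneg
  rw [Real.dist_eq, abs_sub_le_iff]
  constructor <;> linarith [hle s b, hle b s]

theorem measureReal_inter_Icc_add (ν : Measure ℝ) [IsFiniteMeasure ν] [NullSingletonClass ν]
    {E : Set ℝ} (hE : MeasurableSet E) {l s r : ℝ} (hls : l ≤ s) (hsr : s ≤ r) :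
    ν.real (E ∩ Set.Icc l r) = ν.real (E ∩ Set.Icc l s) + ν.real (E ∩ Set.Icc s r) := by
  rw [← measureReal_union₀ (hE.inter measurableSet_Icc).nullMeasurableSet,
    ← Set.inter_union_distrib_left,
    Set.Icc_union_Icc_eq_Icc hls hsr]
  refine measure_mono_null (t := {s}) ?_ (by simp)
  rintro u ⟨⟨_, _, h1⟩, ⟨_, h2, _⟩⟩
  exact le_antisymm h1 h2

theorem bound_of_forall_mem [IsFiniteMeasure ν]
    (h : RemezSetup ν θ δ E E' B) (H : ∀ l r, l ∈ B → r ∈ B → l ≤ r → RemezBound ν θ E B l r)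
    {l r : ℝ} : RemezBound ν θ E B l r := by
  rcases (B ∩ Set.Icc l r).eq_empty_or_nonempty with he | hne
  · unfold RemezBound
    rw [he, measureReal_empty, Real.zero_rpow h.theta_pos.ne', zero_mul, sub_nonneg]
    exact measureReal_mono Set.inter_subset_right
  have hc : IsCompact (B ∩ Set.Icc l r) := isCompact_Icc.inter_left h.isClosed
  obtain ⟨x, ⟨hxB, hlx, hxr⟩, hx⟩ := hc.exists_isLeast hne
  obtain ⟨y, ⟨hyB, hly, hyr⟩, hy⟩ := hc.exists_isGreatest hne
  have hxy : x ≤ y := hy ⟨hxB, hlx, hxr⟩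
  refine h.extend_left hlx hxr hxB (fun t ht hlt => ?_) (h.extend_right hxy hyr hyB
    (fun t ht htr => ?_) (H x y hxB hyB hxy))
  · rcases le_total t r with htr | htr
    · exact hx ⟨ht, hlt, htr⟩
    · linarith
  · rcases le_total l t with hlt | hlt
    · exact hy ⟨ht, hlt, htr⟩
    · linarith

theorem bound_of_le_mul [IsFiniteMeasure ν] [NullSingletonClass ν]
    (h : RemezSetup ν θ δ E E' B) (n : ℕ) : ∀ l r, l ∈ B → r ∈ B → l ≤ r → r - l ≤ n * δ →
      RemezBound ν θ E B l r := by
  have hδ := h.delta_pos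
  induction n with
  | zero =>
    intro l r hl hr hlr hn
    have : r = l := by simp at hn; linarith
    subst this
    unfold RemezBound
    have hθ := h.theta_pos
    have h0 : ∀ s : Set ℝ, ν.real (s ∩ Set.Icc r r) = 0 := fun s => by
      rw [measureReal_def, measure_mono_null Set.inter_subset_right (by simp)]; simp
    have h1 : ν.real (Set.Icc r r) = 0 := by simpa using h0 Set.univ
    rw [h0, h0, h1, Real.zero_rpow hθ.ne']; simp
  | succ n ih =>
    intro l r hl hr hlr hn
    push_cast at hn
    set a : ℝ → ℝ := fun s => ν.real (Set.univ ∩ Set.Icc l s) - ν.real (E ∩ Set.Icc l s) with ha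
    set f : ℝ → ℝ := fun s => ν.real (Set.univ ∩ Set.Icc l s) with hf
    have haf : ∀ s, a s ≤ f s := fun s => sub_le_self _ measureReal_nonneg
    have hsplit : ∀ {X : Set ℝ}, MeasurableSet X → ∀ {s}, l ≤ s → s ≤ r →
      ν.real (X ∩ Set.Icc l r) = ν.real (X ∩ Set.Icc l s) + ν.real (X ∩ Set.Icc s r) :=
      fun hX _ h1 h2 => measureReal_inter_Icc_add ν hX h1 h2
    by_cases he : E ∩ Set.Icc l r = ∅
    · unfold RemezBound
      rw [he, measureReal_empty, sub_zero]
      exact Real.rpow_mul_rpow_one_sub_le measureReal_nonneg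
        (measureReal_mono Set.inter_subset_right) h.theta_pos
    obtain ⟨t, htE, hlt, htr⟩ := Set.nonempty_iff_ne_empty.2 he
    have h1 := h.lt_abs_sub hl htE
    have h2 := h.lt_abs_sub hr htE
    rw [abs_of_nonneg (by linarith)] at h1
    rw [abs_of_nonpos (by linarith)] at h2
    have hf0 : 0 ≤ f r := measureReal_nonneg
    have hE1 : E ∩ Set.Icc l (l + δ) = ∅ := by
      refine Set.eq_empty_of_forall_notMem fun u ⟨hu, hu1, hu2⟩ => ?_
      have := h.lt_abs_sub hl hu
      rw [abs_of_nonneg (by linarith)] at this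
      linarith
    have hE2 : E ∩ Set.Icc (r - δ) r = ∅ := by
      refine Set.eq_empty_of_forall_notMem fun u ⟨hu, hu1, hu2⟩ => ?_
      have := h.lt_abs_sub hr hu
      rw [abs_of_nonpos (by linarith)] at this
      linarith
    have hcont : Continuous fun s => a r * f s - a s * f r := by
      have h1 := continuous_measureReal_inter_Icc ν Set.univ l
      have h2 := continuous_measureReal_inter_Icc ν E l
      exact (continuous_const.mul h1).sub ((h1.sub h2).mul continuous_const)
    obtain ⟨s, ⟨hs1, hs2⟩, hs⟩ := intermediate_value_Icc (by linarith : l + δ ≤ r - δ)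
      hcont.continuousOn (show (0 : ℝ) ∈ Set.Icc _ _ from by
        constructor
        · have : a (l + δ) = f (l + δ) := by simp [ha, hf, hE1]
          rw [this]
          have : 0 ≤ f (l + δ) := measureReal_nonneg
          nlinarith [haf r]
        · have e1 := hsplit MeasurableSet.univ (s := r - δ) (by linarith) (by linarith)
          have e2 := hsplit h.measurableSet (s := r - δ) (by linarith) (by linarith)
          rw [hE2, measureReal_empty, add_zero] at e2
          set φ := ν.real (Set.univ ∩ Set.Icc (r - δ) r)
          have hφ : 0 ≤ φ := measureReal_nonneg
          have e3 : f (r - δ) = f r - φ := by simp only [hf]; linarith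
          have e4 : a (r - δ) = a r - φ := by simp only [ha]; linarith
          rw [e3, e4]
          nlinarith [haf r])
    have hfr : ∀ {l r}, RemezBound ν θ E B l r ↔ ν.real (B ∩ Set.Icc l r) ^ θ *
        ν.real (Set.univ ∩ Set.Icc l r) ^ (1 - θ) ≤
        ν.real (Set.univ ∩ Set.Icc l r) - ν.real (E ∩ Set.Icc l r) := by
      intro l r; simp only [RemezBound, Set.univ_inter]
    have hSl : RemezBound ν θ E B l s := by
      obtain ⟨x, ⟨hxB, hlx, hxs⟩, hx⟩ := (isCompact_Icc.inter_left h.isClosed).exists_isGreatest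
        (⟨l, hl, le_rfl, by linarith⟩ : (B ∩ Set.Icc l s).Nonempty)
      refine h.extend_right hlx hxs hxB (fun t ht hts => ?_)
        (ih l x hl hxB hlx (by linarith))
      rcases le_total l t with hlt | hlt
      · exact hx ⟨ht, hlt, hts⟩
      · linarith
    have hSr : RemezBound ν θ E B s r := by
      obtain ⟨x, ⟨hxB, hsx, hxr⟩, hx⟩ := (isCompact_Icc.inter_left h.isClosed).exists_isLeast
        (⟨r, hr, by linarith, le_rfl⟩ : (B ∩ Set.Icc s r).Nonempty)
      refine h.extend_left hsx hxr hxB (fun t ht hts => ?_)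
        (ih x r hxB hr hxr (by linarith))
      rcases le_total t r with htr | htr
      · exact hx ⟨ht, hts, htr⟩
      · linarith
    rw [hfr] at hSl hSr ⊢
    have eu := hsplit MeasurableSet.univ (s := s) (by linarith) (by linarith)
    have eE := hsplit h.measurableSet (s := s) (by linarith) (by linarith)
    have eB := hsplit h.isClosed.measurableSet (s := s) (by linarith) (by linarith)
    rcases hf0.eq_or_lt with hz | hpos
    · have hz' : ν.real (Set.univ ∩ Set.Icc l r) = 0 := hz.symm
      have hb : ν.real (B ∩ Set.Icc l r) = 0 := le_antisymm (hz' ▸ measureReal_mono (by simp))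
        measureReal_nonneg
      have he : ν.real (E ∩ Set.Icc l r) = 0 := le_antisymm (hz' ▸ measureReal_mono (by simp))
        measureReal_nonneg
      rw [hz', hb, he, Real.zero_rpow h.theta_pos.ne']; simp
    have ha0 : 0 ≤ a r := sub_nonneg.2 (measureReal_mono (by simp))
    set κ := a r / f r with hκ
    have hκ0 : 0 ≤ κ := div_nonneg ha0 hpos.le
    have has : a s = κ * f s := by
      simp only at hs
      rw [hκ]; field_simp; linarith
    have har : a r = κ * f r := by rw [hκ]; field_simp
    have h1' : ν.real (Set.univ ∩ Set.Icc l s) - ν.real (E ∩ Set.Icc l s) =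
      κ * ν.real (Set.univ ∩ Set.Icc l s) := has
    have h2' : ν.real (Set.univ ∩ Set.Icc l r) - ν.real (E ∩ Set.Icc l r) =
      κ * ν.real (Set.univ ∩ Set.Icc l r) := har
    have h3' : ν.real (Set.univ ∩ Set.Icc s r) - ν.real (E ∩ Set.Icc s r) =
      κ * ν.real (Set.univ ∩ Set.Icc s r) := by
      rw [eu, eE] at h2'; linarith
    rw [h1'] at hSl
    rw [h3'] at hSr
    rw [h2', eu, eB]
    exact Real.rpow_add_mul_rpow_add_le measureReal_nonneg measureReal_nonneg
      (measureReal_mono (by simp)) (measureReal_mono (by simp)) hκ0 h.theta_pos hSl hSr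

theorem bound [IsFiniteMeasure ν] [NullSingletonClass ν] (h : RemezSetup ν θ δ E E' B) (l r : ℝ) :
    RemezBound ν θ E B l r := by
  refine h.bound_of_forall_mem fun l r hl hr hlr => ?_
  obtain ⟨n, hn⟩ := exists_nat_ge ((r - l) / δ)
  exact h.bound_of_le_mul n l r hl hr hlr ((div_le_iff₀ h.delta_pos).1 hn)

end RemezSetup

open Polynomial Chebyshev in
theorem MidpointLogConcave.remez {ν : Measure ℝ} [IsFiniteMeasure ν] [NullSingletonClass ν]
    (hν : MidpointLogConcave ν) {L R : ℝ} (hsupp : ν (Set.Icc L R)ᶜ = 0) {p : ℝ[X]} {d : ℕ}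
    (hp : p.natDegree ≤ d) {lam m m' M : ℝ} (hlam : 1 ≤ lam) (hm' : 0 ≤ m') (hm : m < m')
    (hM : (T ℝ d).eval (2 * lam - 1) * m' < M) :
    ν.real {t | M ≤ |p.eval t|} ^ lam⁻¹ * ν.real Set.univ ^ (1 - lam⁻¹) ≤
      ν.real Set.univ - ν.real {t | |p.eval t| ≤ m} := by
  have hcont : Continuous fun t => |p.eval t| := p.continuous.abs
  have hEc : IsCompact ({t | |p.eval t| ≤ m} ∩ Set.Icc L R) :=
    isCompact_Icc.inter_left (isClosed_le hcont continuous_const)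
  obtain ⟨δ, hδ, hthick⟩ := hEc.exists_cthickening_subset_open
    (isOpen_lt hcont continuous_const : IsOpen {t | |p.eval t| < m'})
    (fun t ht => lt_of_le_of_lt ht.1 hm)
  have hT : 1 ≤ (T ℝ d).eval (2 * lam - 1) := one_le_eval_T_real _ (by linarith)
  have h0 : 0 < lam := by linarith
  have hset : RemezSetup ν lam⁻¹ δ ({t | |p.eval t| ≤ m} ∩ Set.Icc L R) {t | |p.eval t| ≤ m'}
      {t | M ≤ |p.eval t|} := by
    refine ⟨inv_pos.2 h0, inv_le_one_of_one_le₀ hlam, hδ, hν, hEc.measurableSet,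
      isClosed_le continuous_const hcont, fun s hs t hst => ?_, fun x hx hx' => ?_,
      fun x hx s hxs => ?_, fun x hx s hxs => ?_⟩
    · have h1 : |p.eval t| < m' := hthick (Metric.mem_cthickening_of_dist_le t s δ _ hs
        (by rwa [dist_comm, Real.dist_eq]))
      exact h1.le
    · have h1 : M ≤ |p.eval x| := hx
      have h2 : |p.eval x| ≤ m' := hx'
      nlinarith
    · exact (Polynomial.volume_real_le_of_lt_abs_eval hp hlam (hM.trans_le hx) hxs).trans_eq
        (by ring)
    · exact (Polynomial.volume_real_le_of_lt_abs_eval' hp hlam (hM.trans_le hx) hxs).trans_eq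
        (by ring)
  have key := hset.bound L R
  unfold RemezBound at key
  have hfull : ∀ X : Set ℝ, ν.real (X ∩ Set.Icc L R) = ν.real X := fun X => by
    rw [measureReal_def, measure_inter_conull hsupp, measureReal_def]
  have huniv := hfull Set.univ
  rw [Set.univ_inter] at huniv
  rwa [Set.inter_assoc, Set.inter_self, hfull, hfull, huniv] at key

theorem midpointLogConcave_map_eval {n : ℕ} {F : Set (Fin n → ℝ)} (hF : IsCompact F)
    (hFc : Convex ℝ F) (i : Fin n) :
    MidpointLogConcave ((volume.restrict F).map fun x => x i) := by
  intro l s l' s'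
  have hmeas : ∀ a b : ℝ, ((volume.restrict F).map fun x => x i) (Set.Icc a b) =
      volume ((fun x => x i) ⁻¹' (Set.Icc a b) ∩ F) := fun a b => by
    rw [Measure.map_apply (measurable_pi_apply i) measurableSet_Icc,
      Measure.restrict_apply (measurable_pi_apply i measurableSet_Icc)]
  have hms : ∀ a b : ℝ, MeasurableSet ((fun x : Fin n → ℝ => x i) ⁻¹' (Set.Icc a b) ∩ F) :=
    fun a b => (measurable_pi_apply i measurableSet_Icc).inter hF.measurableSet
  have key := volume_mul_volume_le_sq
    (hms l s) (hms l' s') (hms ((l + l') / 2) ((s + s') / 2)) <| by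
    rintro x ⟨⟨h1, h2⟩, hx⟩ y ⟨⟨h3, h4⟩, hy⟩
    refine ⟨⟨?_, ?_⟩, ?_⟩
    · simp only [Pi.smul_apply, Pi.add_apply, smul_eq_mul]; linarith
    · simp only [Pi.smul_apply, Pi.add_apply, smul_eq_mul]; linarith
    · rw [smul_add]
      exact hFc hx hy (by norm_num) (by norm_num) (by norm_num)
  simp only [measureReal_def, hmeas]
  rw [← ENNReal.toReal_mul, ← ENNReal.toReal_pow]
  refine ENNReal.toReal_mono (ENNReal.pow_ne_top ?_) key
  exact ((measure_mono Set.inter_subset_right).trans_lt hF.measure_lt_top).ne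

open Polynomial Chebyshev in
theorem Convex.remez_coord {n : ℕ} {F : Set (Fin n → ℝ)} (hF : IsCompact F)
    (hFc : Convex ℝ F) (i : Fin n) {p : ℝ[X]} {d : ℕ}
    (hp : p.natDegree ≤ d) {lam m m' M : ℝ} (hlam : 1 ≤ lam) (hm' : 0 ≤ m') (hm : m < m')
    (hM : (T ℝ d).eval (2 * lam - 1) * m' < M) :
    volume.real (F ∩ {x | M ≤ |p.eval (x i)|}) ^ lam⁻¹ * volume.real F ^ (1 - lam⁻¹) ≤
      volume.real F - volume.real (F ∩ {x | |p.eval (x i)| ≤ m}) := by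
  have hi : Measurable fun x : Fin n → ℝ => x i := measurable_pi_apply i
  have hcont : Continuous fun t => |p.eval t| := p.continuous.abs
  have : Fact (volume F < ⊤) := ⟨hF.measure_lt_top⟩
  set ν := (volume.restrict F).map fun x => x i with hνdef
  have hν : ∀ {S : Set ℝ}, MeasurableSet S → ν S = volume (F ∩ (fun x => x i) ⁻¹' S) := by
    intro S hS
    rw [hνdef, Measure.map_apply hi hS, Measure.restrict_apply (hi hS), Set.inter_comm]
  have hνr : ∀ {S : Set ℝ}, MeasurableSet S → ν.real S = volume.real (F ∩ (fun x => x i) ⁻¹' S) :=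
    fun hS => by rw [measureReal_def, hν hS, measureReal_def]
  have : NullSingletonClass ν := ⟨fun t => by
    rw [hν (measurableSet_singleton t)]
    refine measure_mono_null Set.inter_subset_right ?_
    rw [volume_pi]
    exact Measure.pi_hyperplane (fun _ : Fin n => (volume : Measure ℝ)) i t⟩
  obtain ⟨L, R, hLR⟩ : ∃ L R, (fun x : Fin n → ℝ => x i) '' F ⊆ Set.Icc L R := by
    have hc := hF.image (continuous_apply i)
    exact bddBelow_bddAbove_iff_subset_Icc.1 ⟨hc.bddBelow, hc.bddAbove⟩
  have hsupp : ν (Set.Icc L R)ᶜ = 0 := by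
    rw [hν measurableSet_Icc.compl]
    have : F ∩ (fun x => x i) ⁻¹' (Set.Icc L R)ᶜ = ∅ := by
      refine Set.eq_empty_of_forall_notMem fun x hx => hx.2 (hLR ⟨x, hx.1, rfl⟩)
    rw [this, measure_empty]
  have key := (midpointLogConcave_map_eval hF hFc i).remez hsupp hp hlam hm' hm hM
  rw [hνr (measurableSet_le measurable_const hcont.measurable),
    hνr (measurableSet_le hcont.measurable measurable_const), hνr MeasurableSet.univ] at key
  simpa using key

theorem volume_hyperplane_eq_zero {n : ℕ} (L : (Fin n → ℝ) →ₗ[ℝ] ℝ) (hL : L ≠ 0) (c : ℝ) :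
    volume {x | L x = c} = 0 := by
  rcases {x | L x = c}.eq_empty_or_nonempty with h | ⟨x₀, hx₀⟩
  · rw [h, measure_empty]
  have hx₀' : L x₀ = c := hx₀
  have : {x | L x = c} = (fun x => x + -x₀) ⁻¹' (LinearMap.ker L : Set (Fin n → ℝ)) := by
    ext x
    simp [hx₀', ← sub_eq_add_neg, sub_eq_zero]
  rw [this, measure_preimage_add_right]
  exact Measure.addHaar_submodule _ _ fun h => hL (LinearMap.ker_eq_top.1 h)

theorem Convex.subset_of_volume_inter_eq_zero {n : ℕ} {F : Set (Fin n → ℝ)} (hF : Convex ℝ F)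
    (hF0 : volume F ≠ 0) {U : Set (Fin n → ℝ)} (hU : IsOpen U) (h : volume (F ∩ U) = 0) :
    F ⊆ Uᶜ := by
  intro x hx hxU
  have hF_int : (interior F).Nonempty := by
    by_contra hcon
    rw [Set.not_nonempty_iff_eq_empty] at hcon
    apply hF0
    refine measure_mono_null (t := frontier F) ?_ (hF.addHaar_frontier volume)
    rw [frontier, hcon, Set.sdiff_empty]
    exact subset_closure
  have hcl : x ∈ closure (interior F) := by
    rw [hF.closure_interior_eq_closure_of_nonempty_interior hF_int]
    exact subset_closure hx
  have hne : (U ∩ interior F).Nonempty := mem_closure_iff.1 hcl U hU hxU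
  refine ((hU.inter isOpen_interior).measure_pos volume hne).ne' (measure_mono_null ?_ h)
  exact fun y hy => ⟨interior_subset hy.2, hy.1⟩

/-- The data preserved by the localization procedure: a convex body in which `B` has relative
volume `β` and `A` has relative volume at most `α`. -/
structure IsNeedleBody {n : ℕ} (A B : Set (Fin n → ℝ)) (α β : ℝ) (F : Set (Fin n → ℝ)) : Prop where
  isCompact : IsCompact F
  convex : Convex ℝ F
  pos : 0 < volume.real F
  eq : volume.real (B ∩ F) = β * volume.real F
  le : volume.real (A ∩ F) ≤ α * volume.real F

theorem measureReal_inter_add_inter_of_null {n : ℕ} {X U V : Set (Fin n → ℝ)}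
    (hXm : MeasurableSet X) (hX : volume X ≠ ⊤) (hV : MeasurableSet V)
    (hUV : U ∪ V = Set.univ) (h0 : volume (U ∩ V) = 0) :
    volume.real (X ∩ U) + volume.real (X ∩ V) = volume.real X := by
  have hfin : ∀ S, volume (X ∩ S) ≠ ⊤ := fun S =>
    ((measure_mono Set.inter_subset_left).trans_lt hX.lt_top).ne
  have hd : AEDisjoint volume (X ∩ U) (X ∩ V) :=
    measure_mono_null (Set.inter_subset_inter Set.inter_subset_right Set.inter_subset_right) h0
  rw [← measureReal_union₀ (hXm.inter hV).nullMeasurableSet hd (hfin U) (hfin V),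
    ← Set.inter_union_distrib_left, hUV, Set.inter_univ]

theorem IsNeedleBody.exists_subset {n : ℕ} {A B F : Set (Fin n → ℝ)} {α β : ℝ}
    (h : IsNeedleBody A B α β F) (hA : MeasurableSet A) (hB : MeasurableSet B)
    {L M : (Fin n → ℝ) →ₗ[ℝ] ℝ} (hLM : LinearIndependent ℝ ![L, M]) (p q : ℝ) :
    ∃ F' ⊆ F, IsNeedleBody A B α β F' ∧ ∃ u v : ℝ, (u, v) ≠ 0 ∧
      ∀ x ∈ F', u * (L x - p) + v * (M x - q) ≤ 0 := by
  rw [LinearIndependent.pair_iff] at hLM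
  set ell : ℝ → ℝ → (Fin n → ℝ) → ℝ := fun u v x => u * (L x - p) + v * (M x - q) with hell
  have hLc : Continuous L := L.continuous_of_finiteDimensional
  have hMc : Continuous M := M.continuous_of_finiteDimensional
  have hellc : ∀ u v, Continuous (ell u v) := fun u v => by simp only [hell]; fun_prop
  have hF0 : volume F ≠ 0 := fun h0 => h.pos.ne' (by rw [measureReal_def, h0]; rfl)
  have hFt : volume F ≠ ⊤ := h.isCompact.measure_lt_top.ne
  by_cases hcase : ∃ u v : ℝ, (u, v) ≠ 0 ∧ volume (F ∩ {x | 0 < ell u v x}) = 0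
  · obtain ⟨u, v, huv, h0⟩ := hcase
    refine ⟨F, subset_rfl, h, u, v, huv, fun x hx => ?_⟩
    have := h.convex.subset_of_volume_inter_eq_zero hF0
      (isOpen_lt continuous_const (hellc u v)) h0 hx
    exact not_lt.1 this
  push Not at hcase
  have hnull : ∀ u v : ℝ, (u, v) ≠ 0 → volume {x | ell u v x = 0} = 0 := fun u v huv => by
    have := volume_hyperplane_eq_zero (u • L + v • M) (fun h0 => huv (by
      have := hLM u v h0; simp [this])) (u * p + v * q)
    refine measure_mono_null (fun x (hx : ell u v x = 0) => ?_) this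
    simp only [hell] at hx
    simp only [Set.mem_ofPred_eq, LinearMap.add_apply, LinearMap.smul_apply, smul_eq_mul]
    linarith
  set H : ℝ → Set (Fin n → ℝ) := fun φ => {x | ell (Real.cos φ) (Real.sin φ) x ≤ 0} with hH
  have hHc : ∀ φ, IsClosed (H φ) := fun φ => isClosed_le (hellc _ _) continuous_const
  have hcs : ∀ φ, (Real.cos φ, Real.sin φ) ≠ 0 := fun φ h0 => by
    have := Real.cos_sq_add_sin_sq φ
    simp only [Prod.mk_eq_zero] at h0
    simp [h0.1, h0.2] at this
  have hpi : ∀ φ x, ell (Real.cos (φ + Real.pi)) (Real.sin (φ + Real.pi)) x =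
      -ell (Real.cos φ) (Real.sin φ) x := fun φ x => by
    simp only [hell, Real.cos_add_pi, Real.sin_add_pi]; ring
  have hadd : ∀ X : Set (Fin n → ℝ), MeasurableSet X → volume X ≠ ⊤ → ∀ φ,
      volume.real (X ∩ H φ) + volume.real (X ∩ H (φ + Real.pi)) = volume.real X := by
    intro X hXm hX φ
    refine measureReal_inter_add_inter_of_null hXm hX (hHc _).measurableSet ?_ ?_
    · ext x
      simp only [hH, Set.mem_union, Set.mem_ofPred_eq, hpi, Set.mem_univ, iff_true]
      rcases le_total (ell (Real.cos φ) (Real.sin φ) x) 0 with h | h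
      · exact Or.inl h
      · exact Or.inr (by linarith)
    · refine measure_mono_null (fun x hx => ?_) (hnull _ _ (hcs φ))
      have h1 : ell (Real.cos φ) (Real.sin φ) x ≤ 0 := hx.1
      have h2 : ell (Real.cos (φ + Real.pi)) (Real.sin (φ + Real.pi)) x ≤ 0 := hx.2
      rw [hpi] at h2
      exact le_antisymm h1 (by linarith)
  have hcont : ∀ X : Set (Fin n → ℝ), MeasurableSet X → volume X ≠ ⊤ →
      Continuous fun φ => volume.real (X ∩ H φ) := by
    intro X hXm hX
    rw [continuous_iff_continuousAt]
    intro φ₀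
    refine (ENNReal.tendsto_toReal
      ((measure_mono Set.inter_subset_left).trans_lt hX.lt_top).ne).comp ?_
    refine tendsto_measure_of_ae_tendsto_indicator (nhds φ₀) (B := X)
      (hXm.inter (hHc _).measurableSet) (fun φ => hXm.inter (hHc _).measurableSet) hXm hX
      (Filter.Eventually.of_forall fun φ => Set.inter_subset_left) ?_
    have hae : ∀ᵐ x : Fin n → ℝ, ell (Real.cos φ₀) (Real.sin φ₀) x ≠ 0 :=
      compl_mem_ae_iff.2 (hnull _ _ (hcs φ₀))
    filter_upwards [hae] with x hx
    have hc : Continuous fun φ => ell (Real.cos φ) (Real.sin φ) x := by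
      simp only [hell]; fun_prop
    rcases hx.lt_or_gt with hlt | hgt
    · filter_upwards [hc.continuousAt.eventually_lt continuousAt_const hlt] with φ hφ
      simp only [hH, Set.mem_inter_iff, Set.mem_ofPred_eq, hφ.le, hlt.le]
    · filter_upwards [continuousAt_const.eventually_lt hc.continuousAt hgt] with φ hφ
      simp only [hH, Set.mem_inter_iff, Set.mem_ofPred_eq, not_le.2 hφ, not_le.2 hgt]
  have hBF : volume (B ∩ F) ≠ ⊤ := ((measure_mono Set.inter_subset_right).trans_lt hFt.lt_top).ne
  have hAF : volume (A ∩ F) ≠ ⊤ := ((measure_mono Set.inter_subset_right).trans_lt hFt.lt_top).ne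
  have hFm := h.isCompact.measurableSet
  set D : ℝ → ℝ := fun φ => volume.real (B ∩ F ∩ H φ) - β * volume.real (F ∩ H φ) with hD
  have hDc : Continuous D :=
    (hcont _ (hB.inter hFm) hBF).sub (continuous_const.mul (hcont _ hFm hFt))
  have hDpi : ∀ φ, D φ + D (φ + Real.pi) = 0 := fun φ => by
    have h1 := hadd _ (hB.inter hFm) hBF φ
    have h2 := hadd _ hFm hFt φ
    simp only [hD]
    have h3 := h.eq
    rw [← h1, ← h2] at h3
    linarith
  obtain ⟨φ, hφ⟩ : ∃ φ, D φ = 0 := by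
    have h1 := hDpi 0
    rcases le_total (D 0) 0 with h0 | h0
    · exact mem_range_of_exists_le_of_exists_ge hDc ⟨0, h0⟩ ⟨0 + Real.pi, by linarith⟩
    · exact mem_range_of_exists_le_of_exists_ge hDc ⟨0 + Real.pi, by linarith⟩ ⟨0, h0⟩
  have hφ' : D (φ + Real.pi) = 0 := by have := hDpi φ; linarith
  have hpos : ∀ φ, 0 < volume.real (F ∩ H φ) := fun φ => by
    have h1 := hcase (Real.cos (φ + Real.pi)) (Real.sin (φ + Real.pi)) (hcs _)
    have hsub : F ∩ {x | 0 < ell (Real.cos (φ + Real.pi)) (Real.sin (φ + Real.pi)) x} ⊆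
        F ∩ H φ := fun x hx => ⟨hx.1, by
      have h2 : 0 < ell (Real.cos (φ + Real.pi)) (Real.sin (φ + Real.pi)) x := hx.2
      rw [hpi] at h2
      have : ell (Real.cos φ) (Real.sin φ) x ≤ 0 := by linarith
      exact this⟩
    exact ENNReal.toReal_pos (fun h0 => h1 (measure_mono_null hsub h0))
      ((measure_mono Set.inter_subset_left).trans_lt hFt.lt_top).ne
  have hconv : ∀ φ, Convex ℝ (H φ) := fun φ => by
    have : H φ = {x | (Real.cos φ • L + Real.sin φ • M) x ≤ Real.cos φ * p + Real.sin φ * q} := by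
      ext x
      simp only [hH, hell, Set.mem_ofPred_eq, LinearMap.add_apply, LinearMap.smul_apply,
        smul_eq_mul]
      constructor <;> intro <;> linarith
    rw [this]
    exact convex_halfSpace_le (LinearMap.isLinear _) _
  have hbody : ∀ φ, D φ = 0 → volume.real (A ∩ F ∩ H φ) ≤ α * volume.real (F ∩ H φ) →
      ∃ F' ⊆ F, IsNeedleBody A B α β F' ∧ ∃ u v : ℝ, (u, v) ≠ 0 ∧
        ∀ x ∈ F', ell u v x ≤ 0 := fun φ hφ hAφ =>
    ⟨F ∩ H φ, Set.inter_subset_left, ⟨h.isCompact.inter_right (hHc φ), h.convex.inter (hconv φ),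
      hpos φ, by rw [← Set.inter_assoc]; exact sub_eq_zero.1 hφ, by rwa [← Set.inter_assoc]⟩,
      _, _, hcs φ, fun x hx => hx.2⟩
  by_cases hle : volume.real (A ∩ F ∩ H φ) ≤ α * volume.real (F ∩ H φ)
  · exact hbody φ hφ hle
  · refine hbody _ hφ' ?_
    have h1 := hadd _ (hA.inter hFm) hAF φ
    have h2 := hadd _ hFm hFt φ
    have h3 := h.le
    rw [← h1, ← h2] at h3
    linarith

theorem IsNeedleBody.exists_seq {n : ℕ} [Nonempty (Fin n)] {A B F : Set (Fin n → ℝ)} {α β : ℝ}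
    (h : IsNeedleBody A B α β F) (hA : MeasurableSet A) (hB : MeasurableSet B) :
    ∃ G : ℕ → Set (Fin n → ℝ), Antitone G ∧ (∀ k, IsNeedleBody A B α β (G k)) ∧
      ∀ i j, i ≠ j → ∀ p q : ℚ, ∃ k, ∃ u v : ℝ, (u, v) ≠ 0 ∧
        ∀ x ∈ G k, u * (x i - p) + v * (x j - q) ≤ 0 := by
  have hstep : ∀ (t : Fin n × Fin n × ℚ × ℚ) (S : {F // IsNeedleBody A B α β F}),
      ∃ S' : {F // IsNeedleBody A B α β F}, S'.1 ⊆ S.1 ∧ (t.1 ≠ t.2.1 → ∃ u v : ℝ, (u, v) ≠ 0 ∧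
        ∀ x ∈ S'.1, u * (x t.1 - t.2.2.1) + v * (x t.2.1 - t.2.2.2) ≤ 0) := by
    rintro ⟨i, j, p, q⟩ ⟨S, hS⟩
    by_cases hij : i = j
    · exact ⟨⟨S, hS⟩, subset_rfl, fun h => absurd hij h⟩
    have hLM : LinearIndependent ℝ
        ![LinearMap.proj (R := ℝ) (φ := fun _ : Fin n => ℝ) i, LinearMap.proj j] := by
      rw [LinearIndependent.pair_iff]
      intro s t hst
      have h1 := LinearMap.congr_fun hst (Pi.single i 1)
      have h2 := LinearMap.congr_fun hst (Pi.single j 1)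
      simp [hij, Ne.symm hij] at h1 h2
      exact ⟨h1, h2⟩
    obtain ⟨S', hsub, hS', huv⟩ := hS.exists_subset hA hB hLM p q
    exact ⟨⟨S', hS'⟩, hsub, fun _ => huv⟩
  choose step hsub hcut using hstep
  obtain ⟨e, he⟩ := exists_surjective_nat (Fin n × Fin n × ℚ × ℚ)
  set G : ℕ → {F // IsNeedleBody A B α β F} :=
    fun k => Nat.rec ⟨F, h⟩ (fun m S => step (e m) S) k with hG
  refine ⟨fun k => (G k).1, antitone_nat_of_succ_le fun k => hsub (e k) (G k),
    fun k => (G k).2, fun i j hij p q => ?_⟩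
  obtain ⟨k, hk⟩ := he (i, j, p, q)
  have := hcut (e k) (G k) (by rwa [hk])
  refine ⟨k + 1, ?_⟩
  change ∃ u v : ℝ, (u, v) ≠ 0 ∧ ∀ x ∈ (step (e k) (G k)).1, _
  rw [hk] at this ⊢
  exact this

theorem cross_eq_zero_of_forall_rat {x₁ x₂ y₁ y₂ z₁ z₂ : ℝ}
    (h : ∀ p q : ℚ, ∃ u v : ℝ, (u, v) ≠ 0 ∧ u * (x₁ - p) + v * (x₂ - q) ≤ 0 ∧
      u * (y₁ - p) + v * (y₂ - q) ≤ 0 ∧ u * (z₁ - p) + v * (z₂ - q) ≤ 0) :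
    (y₁ - x₁) * (z₂ - x₂) - (y₂ - x₂) * (z₁ - x₁) = 0 := by
  by_contra hD
  set D := (y₁ - x₁) * (z₂ - x₂) - (y₂ - x₂) * (z₁ - x₁) with hDdef
  set b : ℝ × ℝ → ℝ := fun q => ((q.1 - x₁) * (z₂ - x₂) - (q.2 - x₂) * (z₁ - x₁)) / D with hb
  set c : ℝ × ℝ → ℝ := fun q => ((y₁ - x₁) * (q.2 - x₂) - (y₂ - x₂) * (q.1 - x₁)) / D with hc
  have hbc : Continuous b := by simp only [hb]; fun_prop
  have hcc : Continuous c := by simp only [hc]; fun_prop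
  have hopen : IsOpen ({q | 0 < b q} ∩ {q | 0 < c q} ∩ {q | 0 < 1 - b q - c q}) :=
    ((isOpen_lt continuous_const hbc).inter (isOpen_lt continuous_const hcc)).inter
      (isOpen_lt continuous_const ((continuous_const.sub hbc).sub hcc))
  have hcb : b ((x₁ + y₁ + z₁) / 3, (x₂ + y₂ + z₂) / 3) = 1 / 3 := by
    simp only [hb]; rw [div_eq_iff hD, hDdef]; ring
  have hcc' : c ((x₁ + y₁ + z₁) / 3, (x₂ + y₂ + z₂) / 3) = 1 / 3 := by
    simp only [hc]; rw [div_eq_iff hD, hDdef]; ring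
  have hdense : DenseRange (Prod.map ((↑) : ℚ → ℝ) ((↑) : ℚ → ℝ)) :=
    Rat.denseRange_cast.prodMap Rat.denseRange_cast
  obtain ⟨⟨p, q⟩, ⟨h1, h2⟩, h3⟩ := hdense.exists_mem_open hopen
    ⟨((x₁ + y₁ + z₁) / 3, (x₂ + y₂ + z₂) / 3), by
      simp only [Set.mem_inter_iff, Set.mem_ofPred_eq, hcb, hcc']; norm_num⟩
  simp only [Prod.map_apply, Set.mem_ofPred_eq] at h1 h2 h3
  obtain ⟨u, v, huv, hx, hy, hz⟩ := h p q
  set B := b (p, q) with hB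
  set C := c (p, q) with hC
  have hBD : B * D = (p - x₁) * (z₂ - x₂) - (q - x₂) * (z₁ - x₁) := by
    simp only [hB, hb]; rw [div_mul_cancel₀ _ hD]
  have hCD : C * D = (y₁ - x₁) * (q - x₂) - (y₂ - x₂) * (p - x₁) := by
    simp only [hC, hc]; rw [div_mul_cancel₀ _ hD]
  have hp : (p : ℝ) - x₁ = B * (y₁ - x₁) + C * (z₁ - x₁) := by
    apply mul_right_cancel₀ hD
    linear_combination (x₁ - y₁) * hBD + (x₁ - z₁) * hCD + (p - x₁) * hDdef
  have hq : (q : ℝ) - x₂ = B * (y₂ - x₂) + C * (z₂ - x₂) := by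
    apply mul_right_cancel₀ hD
    linear_combination (x₂ - y₂) * hBD + (x₂ - z₂) * hCD + (q - x₂) * hDdef
  have hsum : (1 - B - C) * (u * (x₁ - p) + v * (x₂ - q)) + B * (u * (y₁ - p) + v * (y₂ - q)) +
      C * (u * (z₁ - p) + v * (z₂ - q)) = 0 := by
    linear_combination (-u) * hp - v * hq
  have e1 : u * (x₁ - p) + v * (x₂ - q) = 0 := by nlinarith
  have e2 : u * (y₁ - p) + v * (y₂ - q) = 0 := by nlinarith
  have e3 : u * (z₁ - p) + v * (z₂ - q) = 0 := by nlinarith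
  apply huv
  have hu : u * D = 0 := by
    linear_combination (z₂ - x₂) * (e2 - e1) - (y₂ - x₂) * (e3 - e1) + u * hDdef
  have hv : v * D = 0 := by
    linear_combination (y₁ - x₁) * (e3 - e1) - (z₁ - x₁) * (e2 - e1) + v * hDdef
  simp [(mul_eq_zero.1 hu).resolve_right hD, (mul_eq_zero.1 hv).resolve_right hD]

theorem exists_line_of_forall_rat {n : ℕ} [Nonempty (Fin n)] {K : Set (Fin n → ℝ)}
    (hne : K.Nonempty)
    (h : ∀ i j, i ≠ j → ∀ p q : ℚ, ∃ u v : ℝ, (u, v) ≠ 0 ∧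
      ∀ x ∈ K, u * (x i - p) + v * (x j - q) ≤ 0) :
    ∃ (i : Fin n) (x w : Fin n → ℝ), ∀ z ∈ K, ∀ j, z j = x j + w j * (z i - x i) := by
  by_cases hsub : K.Subsingleton
  · obtain ⟨x, hx⟩ := hne
    exact ⟨Classical.arbitrary _, x, 0, fun z hz j => by simp [hsub hz hx]⟩
  obtain ⟨x, hx, y, hy, hxy⟩ := Set.not_subsingleton_iff.1 hsub
  obtain ⟨i, hi⟩ := Function.ne_iff.1 hxy
  have hi' : y i - x i ≠ 0 := sub_ne_zero.2 hi.symm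
  refine ⟨i, x, fun j => (y j - x j) / (y i - x i), fun z hz j => ?_⟩
  by_cases hij : i = j
  · subst hij
    simp only [div_self hi']; ring
  have := cross_eq_zero_of_forall_rat (x₁ := x i) (x₂ := x j) (y₁ := y i) (y₂ := y j)
    (z₁ := z i) (z₂ := z j) fun p q => by
      obtain ⟨u, v, huv, hk⟩ := h i j hij p q
      exact ⟨u, v, huv, hk x hx, hk y hy, hk z hz⟩
  field_simp
  linarith

open Polynomial in
theorem exists_natDegree_le_of_line {n d : ℕ} (P : MvPolynomial (Fin n) ℝ) (hP : P.totalDegree ≤ d)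
    (i : Fin n) (x w : Fin n → ℝ) :
    ∃ p : ℝ[X], p.natDegree ≤ d ∧ ∀ z : Fin n → ℝ, (∀ j, z j = x j + w j * (z i - x i)) →
      p.eval (z i) = MvPolynomial.eval z P := by
  refine ⟨MvPolynomial.aeval (fun j => C (x j - w j * x i) + C (w j) * X) P, ?_, fun z hz => ?_⟩
  · have := MvPolynomial.aeval_natDegree_le P hP (fun j => C (x j - w j * x i) + C (w j) * X)
      (n := 1) fun j => by
        refine (natDegree_add_le _ _).trans (max_le (by rw [natDegree_C]; exact zero_le_one) ?_)
        exact (natDegree_C_mul_le _ _).trans natDegree_X_le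
    simpa using this
  · rw [← Polynomial.coe_evalRingHom, MvPolynomial.aeval_def, MvPolynomial.hom_eval₂,
      ← MvPolynomial.eval₂_id]
    congr 1
    · ext; simp
    · funext j
      simp only [coe_evalRingHom, eval_add, eval_mul, eval_C, eval_X]
      rw [hz j]
      ring

open Polynomial in
theorem MvPolynomial.volume_real_le_rpow_of_lt {n d : ℕ} [Nonempty (Fin n)]
    (P : MvPolynomial (Fin n) ℝ) (hP : P.totalDegree ≤ d) {F : Set (Fin n → ℝ)} (hF : IsCompact F)
    (hFc : Convex ℝ F) (hF1 : volume.real F = 1) {c lam σ : ℝ} (hc : 0 < c) (hlam : 1 ≤ lam)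
    (hσ : (Chebyshev.T ℝ d).eval (2 * lam - 1) < σ) :
    volume.real ({x | σ * c ≤ |eval x P|} ∩ F) ≤ volume.real ({x | c ≤ |eval x P|} ∩ F) ^ lam := by
  have hPc : Continuous fun x => eval x P := MvPolynomial.continuous_eval P
  set A : Set (Fin n → ℝ) := {x | c ≤ |eval x P|} with hA
  set B : Set (Fin n → ℝ) := {x | σ * c ≤ |eval x P|} with hB
  have hAm : MeasurableSet A := (isClosed_le continuous_const hPc.abs).measurableSet
  have hBm : MeasurableSet B := (isClosed_le continuous_const hPc.abs).measurableSet
  set α := volume.real (A ∩ F) with hα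
  set β := volume.real (B ∩ F) with hβ
  have hbody : IsNeedleBody A B α β F :=
    ⟨hF, hFc, by rw [hF1]; exact one_pos, by rw [hF1, mul_one], by rw [hF1, mul_one]⟩
  obtain ⟨G, hGanti, hG, hcut⟩ := hbody.exists_seq hAm hBm
  have hGne : ∀ k, (G k).Nonempty := fun k => by
    by_contra hcon
    have := (hG k).pos
    rw [Set.not_nonempty_iff_eq_empty.1 hcon, measureReal_empty] at this
    exact this.false
  have hKne : (⋂ k, G k).Nonempty :=
    IsCompact.nonempty_iInter_of_sequence_nonempty_isCompact_isClosed G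
      (fun k => hGanti k.le_succ) hGne (hG 0).isCompact fun k => (hG k).isCompact.isClosed
  obtain ⟨i, x, w, hline⟩ := exists_line_of_forall_rat hKne fun i j hij p q => by
    obtain ⟨k, u, v, huv, hk⟩ := hcut i j hij p q
    exact ⟨u, v, huv, fun y hy => hk y (Set.mem_iInter.1 hy k)⟩
  obtain ⟨p, hpd, hp⟩ := exists_natDegree_le_of_line P hP i x w
  set t := (Chebyshev.T ℝ d).eval (2 * lam - 1) with ht
  have ht1 : 1 ≤ t := Chebyshev.one_le_eval_T_real d (by linarith)
  have hgap : 0 < (σ - t) * c := mul_pos (by linarith) hc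
  set η := (σ - t) * c / (4 * t) with hη
  have hηpos : 0 < η := by positivity
  have hηt : η * (4 * t) = (σ - t) * c := by rw [hη]; field_simp
  have hgc : Continuous fun z : Fin n → ℝ => |eval z P - p.eval (z i)| :=
    (hPc.sub (p.continuous.comp (continuous_apply i))).abs
  obtain ⟨k, hk⟩ := exists_subset_nhds_of_isCompact (V := G) (hGanti.directed_ge)
    (fun k => (hG k).isCompact) (U := {z | |eval z P - p.eval (z i)| < η}) fun z hz =>
      (isOpen_lt hgc continuous_const).mem_nhds (by
        simp only [Set.mem_ofPred_eq, hp z (hline z hz), sub_self, abs_zero, hηpos])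
  have hrem := (hG k).convex.remez_coord (hG k).isCompact i hpd hlam (m := c + η)
    (m' := c + 2 * η) (M := σ * c - η) (by positivity) (by linarith) (by
      rw [← ht]; nlinarith [mul_nonneg hηpos.le (sub_nonneg.2 ht1)])
  have hfpos := (hG k).pos
  set f := volume.real (G k) with hf
  have hfin : ∀ S, volume (G k ∩ S) ≠ ⊤ := fun S =>
    ((measure_mono Set.inter_subset_left).trans_lt (hG k).isCompact.measure_lt_top).ne
  have hBle : β * f ≤ volume.real (G k ∩ {x | σ * c - η ≤ |p.eval (x i)|}) := by
    rw [← (hG k).eq]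
    refine measureReal_mono (fun z hz => ⟨hz.2, ?_⟩) (hfin _)
    have h1 : |eval z P - p.eval (z i)| < η := hk hz.2
    have h2 : σ * c ≤ |eval z P| := hz.1
    have h3 := abs_sub_abs_le_abs_sub (eval z P) (p.eval (z i))
    change σ * c - η ≤ |p.eval (z i)|
    linarith
  have hAle : f - volume.real (G k ∩ {x | |p.eval (x i)| ≤ c + η}) ≤ α * f := by
    refine le_trans ?_ (hG k).le
    have h0 : f ≤ volume.real (G k ∩ {x | |p.eval (x i)| ≤ c + η}) + volume.real (A ∩ G k) := by
      refine le_trans (measureReal_mono (fun z hz => ?_) ?_) (measureReal_union_le _ _)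
      · by_cases hzA : z ∈ A
        · exact Or.inr ⟨hzA, hz⟩
        · refine Or.inl ⟨hz, ?_⟩
          have h1 : |eval z P - p.eval (z i)| < η := hk hz
          have h2 : |eval z P| < c := not_le.1 hzA
          have h3 := abs_sub_abs_le_abs_sub (p.eval (z i)) (eval z P)
          rw [abs_sub_comm] at h3
          change |p.eval (z i)| ≤ c + η
          linarith
      · rw [Set.inter_comm A]
        exact (measure_union_lt_top (hfin _).lt_top (hfin _).lt_top).ne
    linarith
  have hlam0 : 0 < lam := by linarith
  have hβ0 : 0 ≤ β := measureReal_nonneg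
  have hα0 : 0 ≤ α := measureReal_nonneg
  have hmain : β ^ lam⁻¹ * f ≤ α * f :=
    calc β ^ lam⁻¹ * f = (β * f) ^ lam⁻¹ * f ^ (1 - lam⁻¹) := by
          rw [Real.mul_rpow hβ0 hfpos.le, mul_assoc, ← Real.rpow_add hfpos,
            add_sub_cancel, Real.rpow_one]
      _ ≤ _ := by gcongr
      _ ≤ _ := hrem.trans hAle
  rw [← Real.rpow_inv_le_iff_of_pos hβ0 hα0 hlam0]
  exact le_of_mul_le_mul_right hmain hfpos

open Polynomial Chebyshev in
theorem Polynomial.Chebyshev.strictMonoOn_eval_T_real {d : ℕ} (hd : d ≠ 0) :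
    StrictMonoOn (fun x => (T ℝ d).eval x) (Set.Ici 1) := by
  intro x hx y hy hxy
  have hxy' : Real.arcosh x < Real.arcosh y :=
    (Real.arcosh_lt_arcosh (one_pos.trans_le hx) (one_pos.trans_le hy)).2 hxy
  have hd' : (0 : ℝ) < (d : ℤ) := by exact_mod_cast Nat.pos_of_ne_zero hd
  have hx0 := Real.arcosh_nonneg hx
  simp only
  rw [← Real.cosh_arcosh hx, ← Real.cosh_arcosh hy, T_real_cosh, T_real_cosh, Real.cosh_lt_cosh,
    abs_of_nonneg (by positivity), abs_of_nonneg (mul_nonneg hd'.le (hx0.trans hxy'.le))]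
  gcongr

theorem MvPolynomial.volume_real_le_rpow {n d : ℕ} (P : MvPolynomial (Fin n) ℝ)
    (hP : P.totalDegree ≤ d) {F : Set (Fin n → ℝ)} (hF : IsCompact F) (hFc : Convex ℝ F)
    (hF1 : volume.real F = 1) {c lam : ℝ} (hc : 0 < c) (hlam : 1 ≤ lam) :
    volume.real ({x | chebyshevT d (2 * lam - 1) * c ≤ |eval x P|} ∩ F) ≤
      volume.real ({x | c ≤ |eval x P|} ∩ F) ^ lam := by
  rw [chebyshevT_eq_eval d (by linarith)]
  have hT := Polynomial.Chebyshev.one_le_eval_T_real d (x := 2 * lam - 1) (by linarith)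
  have hle : volume.real
        ({x | (Polynomial.Chebyshev.T ℝ d).eval (2 * lam - 1) * c ≤ |eval x P|} ∩ F) ≤
      volume.real ({x | c ≤ |eval x P|} ∩ F) := by
    refine measureReal_mono (Set.inter_subset_inter_left _ fun x hx => ?_)
      ((measure_mono Set.inter_subset_right).trans_lt hF.measure_lt_top).ne
    exact (le_mul_of_one_le_left hc.le hT).trans hx
  by_cases hconst : ∃ v, ∀ x, eval x P = v
  · obtain ⟨v, hv⟩ := hconst
    refine hle.trans (le_of_eq ?_)
    simp only [hv]
    by_cases hcv : c ≤ |v|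
    · simp [hcv, hF1]
    · simp [hcv, Real.zero_rpow (by linarith : lam ≠ 0)]
  have hd : d ≠ 0 := by
    rintro rfl
    rw [Nat.le_zero, totalDegree_eq_zero_iff_eq_C] at hP
    exact hconst ⟨P.coeff 0, fun x => by rw [hP]; simp⟩
  have hn : Nonempty (Fin n) := by
    by_contra hempty
    rw [not_nonempty_iff] at hempty
    exact hconst ⟨eval 0 P, fun x => by rw [Subsingleton.elim x 0]⟩
  rcases hlam.eq_or_lt with rfl | hlam
  · rwa [Real.rpow_one]
  have hlt : ∀ᶠ r in nhdsWithin lam (Set.Iio lam), 1 < r :=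
    Filter.Eventually.filter_mono nhdsWithin_le_nhds (lt_mem_nhds hlam)
  refine ge_of_tendsto ((Real.continuousAt_const_rpow' (by linarith : lam ≠ 0)).tendsto.mono_left
    (nhdsWithin_le_nhds (s := Set.Iio lam))) ?_
  filter_upwards [hlt, self_mem_nhdsWithin] with r hr hrlam
  have hrlam' : r < lam := hrlam
  refine P.volume_real_le_rpow_of_lt hP hF hFc hF1 hc hr.le ?_
  refine Polynomial.Chebyshev.strictMonoOn_eval_T_real hd ?_ ?_ (by linarith)
  · exact Set.mem_Ici.2 (by linarith)
  · exact Set.mem_Ici.2 (by linarith)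

/-- The sharp dimension-free comparison lemma:
`Vol{x ∈ F : |P(x)| ≥ T_d(2λ-1)·c} ≤ (Vol{x ∈ F : |P(x)| ≥ c})^λ`. -/
theorem sharp_comparison_lemma {n : ℕ} (d : ℕ) (P : MvPolynomial (Fin n) ℝ)
    (hPd : P.totalDegree ≤ d)
    (F : Set (EuclideanSpace ℝ (Fin n))) (hFcomp : IsCompact F) (hFconv : Convex ℝ F)
    (hFvol : volume F = 1)
    (c : ℝ) (hc : 0 < c) (lam : ℝ) (hlam : 1 ≤ lam) :
    (volume {x ∈ F |
        chebyshevT d (2 * lam - 1) * c ≤ |MvPolynomial.eval (fun i => x i) P|}).toReal ≤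
      (volume {x ∈ F | c ≤ |MvPolynomial.eval (fun i => x i) P|}).toReal ^ lam := by
  have hvol : MeasurePreserving (@WithLp.ofLp 2 (Fin n → ℝ)) := PiLp.volume_preserving_ofLp _
  have hK : IsCompact (WithLp.toLp 2 ⁻¹' F : Set (Fin n → ℝ)) := by
    have himage := (WithLp.equiv 2 (Fin n → ℝ)).image_eq_preimage_symm F
    change _ = WithLp.toLp 2 ⁻¹' F at himage
    rw [← himage]
    exact hFcomp.image (PiLp.continuous_ofLp 2 _)
  have hKc : Convex ℝ (WithLp.toLp 2 ⁻¹' F : Set (Fin n → ℝ)) :=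
    hFconv.linear_preimage (WithLp.linearEquiv 2 ℝ (Fin n → ℝ)).symm.toLinearMap
  have hK1 : volume.real (WithLp.toLp 2 ⁻¹' F : Set (Fin n → ℝ)) = 1 := by
    rw [measureReal_def, ← hvol.measure_preimage hK.measurableSet.nullMeasurableSet]
    change (volume F).toReal = 1
    rw [hFvol, ENNReal.toReal_one]
  have htrans : ∀ a : ℝ, (volume {x ∈ F | a ≤ |MvPolynomial.eval (fun i => x i) P|}).toReal =
      volume.real ({x | a ≤ |MvPolynomial.eval x P|} ∩ WithLp.toLp 2 ⁻¹' F) := fun a => by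
    rw [measureReal_def, ← hvol.measure_preimage
      ((isClosed_le continuous_const (MvPolynomial.continuous_eval P).abs).measurableSet.inter
        hK.measurableSet).nullMeasurableSet]
    congr 2
    ext x
    exact and_comm
  rw [htrans, htrans]
  exact P.volume_real_le_rpow hPd hK hKc hK1 hc hlam
end
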